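/- Let n ≥ 2, suppose (1/p, 1/q) belongs to the interior of the region OCDA and let s be given by 2s = n − (2/q + n/p). Then for every α < q there is a constant C such that ‖ Σ_j λ_j |e^{itΔ}f_j|² ‖_{L^q(ℝ, L^p(ℝⁿ))} ≤ C ‖{λ_j}‖_{ℓ^α} for all families {f_j} orthonormal in Ḣ^s(ℝⁿ) and all {λ_j} ∈ ℓ^α; moreover, for every α > q no such finite constant exists. -/

import Mathlib

noncomputable section

open MeasureTheory ENNReal Real Set

namespace OS

/-- `ℝⁿ` as a Euclidean space. -/
abbrev Rn (n : ℕ) := EuclideanSpace ℝ (Fin n)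

/-- The real dot product `x·ξ`, viewed as a complex number. -/
def dotC {n : ℕ} (x ξ : Rn n) : ℂ := ((∑ i, x i * ξ i : ℝ) : ℂ)

/-- The Fourier transform `f̂(ξ) = ∫ f(x) e^{-i x·ξ} dx`. -/
def FT {n : ℕ} (f : Rn n → ℂ) (ξ : Rn n) : ℂ :=
  ∫ x : Rn n, Complex.exp (-(Complex.I * dotC x ξ)) * f x

/-- The propagator `e^{itΔ}` composed with a Fourier multiplier `m`:
`x ↦ (2π)^{-n} ∫ e^{i(x·ξ - t|ξ|²)} m(ξ) f̂(ξ) dξ`. -/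
def prop {n : ℕ} (m : Rn n → ℂ) (f : Rn n → ℂ) (t : ℝ) (x : Rn n) : ℂ :=
  ((2 * π : ℝ) ^ (-(n : ℝ)) : ℝ) •
    ∫ ξ : Rn n, Complex.exp (Complex.I * (dotC x ξ - (t : ℂ) * ((‖ξ‖ : ℝ) : ℂ) ^ 2)) *
      (m ξ * FT f ξ)

/-- The free Schrödinger propagator `e^{itΔ} f`, as a function of `(t, x)`. -/
def schrodinger {n : ℕ} (f : Rn n → ℂ) : ℝ → Rn n → ℂ := prop (fun _ => 1) f

/-- The Fourier multiplier `|ξ|^{-s} ψ(2^{-k}|ξ|)` of `(-Δ)^{-s/2} P_k`. -/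
def LPmult {n : ℕ} (s : ℝ) (ψ : ℝ → ℝ) (k : ℤ) (ξ : Rn n) : ℂ :=
  ((‖ξ‖ ^ (-s) * ψ ((2 : ℝ) ^ (-k) * ‖ξ‖) : ℝ) : ℂ)

/-- The Littlewood–Paley projection `P_k h`. -/
def LP {n : ℕ} (ψ : ℝ → ℝ) (k : ℤ) (h : Rn n → ℂ) (x : Rn n) : ℂ :=
  ((2 * π : ℝ) ^ (-(n : ℝ)) : ℝ) •
    ∫ ξ : Rn n, Complex.exp (Complex.I * dotC x ξ) *
      (((ψ ((2 : ℝ) ^ (-k) * ‖ξ‖) : ℝ) : ℂ) * FT h ξ)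

/-- The standing hypotheses on the Littlewood–Paley bump function `ψ`:
smooth, `[0,1]`-valued, supported in `[1/2,2]`, with `∑_{k∈ℤ} ψ(2^{-k} r) = 1` for `r ≠ 0`. -/
structure IsLPF (ψ : ℝ → ℝ) : Prop where
  smooth : ContDiff ℝ (⊤ : ℕ∞) ψ
  mem_Icc : ∀ r, ψ r ∈ Icc (0 : ℝ) 1
  supp : Function.support ψ ⊆ Icc (1 / 2 : ℝ) 2
  sum_one : ∀ r : ℝ, r ≠ 0 → ∑' k : ℤ, ψ ((2 : ℝ) ^ (-k) * r) = 1

/-- Orthonormality in `L²(ℝⁿ)`. -/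
def OrthonormalL2 {n : ℕ} (f : ℕ → Rn n → ℂ) : Prop :=
  ∀ j k, (∫ x : Rn n, f j x * (starRingEnd ℂ) (f k x)) = if j = k then 1 else 0

/-- Orthonormality in the homogeneous Sobolev space `Ḣ^s(ℝⁿ)`:
`(2π)^{-n} ∫ |ξ|^{2s} f̂_j(ξ) conj(f̂_k(ξ)) dξ = δ_{jk}`. -/
def OrthonormalHs {n : ℕ} (s : ℝ) (f : ℕ → Rn n → ℂ) : Prop :=
  ∀ j k, ((2 * π : ℝ) ^ (-(n : ℝ)) : ℝ) •
    (∫ ξ : Rn n, ((‖ξ‖ ^ (2 * s) : ℝ) : ℂ) * (FT (f j) ξ * (starRingEnd ℂ) (FT (f k) ξ)))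
      = if j = k then 1 else 0

/-- The density `Σ_j λ_j |u_j(t,x)|²` of a system of space-time functions. -/
def density2 {n : ℕ} (lam : ℕ → ℝ) (u : ℕ → ℝ → Rn n → ℂ) (t : ℝ) (x : Rn n) : ℝ :=
  ∑' j, lam j * ‖u j t x‖ ^ 2

/-- The density `Σ_j λ_j |e^{itΔ}f_j(x)|²`. -/
def density {n : ℕ} (lam : ℕ → ℝ) (f : ℕ → Rn n → ℂ) : ℝ → Rn n → ℝ :=
  density2 lam fun j => schrodinger (f j)

/-- The `L^q` norm (w.r.t. `μ`) of an `ℝ≥0∞`-valued function. -/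
def eLp {α : Type*} [MeasurableSpace α] (μ : Measure α) (q : ℝ≥0∞) (F : α → ℝ≥0∞) : ℝ≥0∞ :=
  if q = ∞ then essSup F μ
  else (∫⁻ t, F t ^ q.toReal ∂μ) ^ (1 / q.toReal)

/-- The Lorentz `L^{p,r}` (quasi)norm of an `ℝ≥0∞`-valued function, via the
distribution function.  For `r = ∞` this is the weak-`L^p` quasinorm
`sup_{s>0} s μ(G > s)^{1/p} = sup_{t>0} t^{1/p} G^*(t)`. -/
def lor {α : Type*} [MeasurableSpace α] (μ : Measure α) (p r : ℝ≥0∞) (G : α → ℝ≥0∞) : ℝ≥0∞ :=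
  if p = ∞ then essSup G μ
  else if r = ∞ then
    ⨆ (s : ℝ) (_ : 0 < s), ENNReal.ofReal s * μ {x | ENNReal.ofReal s < G x} ^ (1 / p.toReal)
  else
    (∫⁻ s in Ioi (0 : ℝ),
      (ENNReal.ofReal s * μ {x | ENNReal.ofReal s < G x} ^ (1 / p.toReal)) ^ r.toReal *
        (ENNReal.ofReal s)⁻¹) ^ (1 / r.toReal)

/-- The mixed norm `‖u‖_{L^q(ℝ, L^p(ℝⁿ))}`. -/
def mixedLp {n : ℕ} {E : Type*} [NormedAddCommGroup E] (q p : ℝ≥0∞)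
    (u : ℝ → Rn n → E) : ℝ≥0∞ :=
  eLp volume q fun t => eLpNorm (u t) p volume

/-- The mixed norm `‖u‖_{L^{q,∞}(ℝ, L^p(ℝⁿ))}` (weak in time). -/
def mixedWeakLp {n : ℕ} {E : Type*} [NormedAddCommGroup E] (q p : ℝ≥0∞)
    (u : ℝ → Rn n → E) : ℝ≥0∞ :=
  lor volume q ∞ fun t => eLpNorm (u t) p volume

/-- The weak `L^{p,∞}(ℝⁿ)` quasinorm. -/
def wLp {n : ℕ} {E : Type*} [NormedAddCommGroup E] (p : ℝ≥0∞) (g : Rn n → E) : ℝ≥0∞ :=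
  lor volume p ∞ fun x => (‖g x‖₊ : ℝ≥0∞)

/-- The mixed Lorentz norm `‖u‖_{L^{q,r}(ℝ, L^{p,r̃}(ℝⁿ))}`. -/
def mixedLorentz {n : ℕ} {E : Type*} [NormedAddCommGroup E] (q r p rt : ℝ≥0∞)
    (u : ℝ → Rn n → E) : ℝ≥0∞ :=
  lor volume q r fun t => lor volume p rt fun x => (‖u t x‖₊ : ℝ≥0∞)

/-- The `ℓ^a` norm of a sequence (with `ℓ^∞` the supremum norm). -/
def seqNormE (a : ℝ≥0∞) (lam : ℕ → ℝ) : ℝ≥0∞ :=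
  if a = ∞ then ⨆ j, ENNReal.ofReal |lam j|
  else (∑' j, ENNReal.ofReal |lam j| ^ a.toReal) ^ (1 / a.toReal)

/-- The decreasing rearrangement of a sequence: `seqRearr lam j` is the
`(j+1)`-th largest value of `|lam i|`. -/
def seqRearr (lam : ℕ → ℝ) (j : ℕ) : ℝ≥0∞ :=
  sInf {s : ℝ≥0∞ | Measure.count {i : ℕ | s < ENNReal.ofReal |lam i|} ≤ (j : ℝ≥0∞)}

/-- The Lorentz sequence norm `‖lam‖_{ℓ^{q,r}} = (Σ_j (j^{1/q} λ*_j)^r / j)^{1/r}`,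
parametrized by `qinv = 1/q` and a finite second exponent `r`. -/
def seqLor (qinv r : ℝ) (lam : ℕ → ℝ) : ℝ≥0∞ :=
  (∑' j : ℕ, (((j : ℝ≥0∞) + 1) ^ qinv * seqRearr lam j) ^ r * ((j : ℝ≥0∞) + 1)⁻¹) ^ (1 / r)

/-- The interior of the triangle `OAB`, in the coordinates `(a, b) = (1/p, 1/q)`. -/
def IntOAB (n : ℕ) (a b : ℝ) : Prop :=
  a ∈ Ioo (0 : ℝ) 1 ∧ b ∈ Ioo (0 : ℝ) 1 ∧ b < (n : ℝ) / (n - 1) * a ∧ 2 * b + n * a < n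

/-- The interior of the quadrilateral `OCDA`, in the coordinates `(a, b) = (1/p, 1/q)`. -/
def IntOCDA (n : ℕ) (a b : ℝ) : Prop :=
  a ∈ Ioo (0 : ℝ) 1 ∧ b ∈ Ioo (0 : ℝ) 1 ∧ (n : ℝ) / (n - 1) * a < b ∧ 2 * b + n * a < n

def ptO : ℝ × ℝ := (0, 0)
def ptA (n : ℕ) : ℝ × ℝ := (((n : ℝ) - 1) / (n + 1), (n : ℝ) / (n + 1))
def ptB : ℝ × ℝ := (1, 0)
def ptC : ℝ × ℝ := (0, 1)
def ptD (n : ℕ) : ℝ × ℝ := (((n : ℝ) - 2) / n, 1)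

/-- The closed triangle `OAB`. -/
def OAB (n : ℕ) : Set (ℝ × ℝ) := convexHull ℝ {ptO, ptA n, ptB}

/-- The closed quadrilateral `OCDA`. -/
def OCDA (n : ℕ) : Set (ℝ × ℝ) := convexHull ℝ {ptO, ptC, ptD n, ptA n}

/-- The half-open segment `[A, D)`. -/
def segAD (n : ℕ) : Set (ℝ × ℝ) := {x | ∃ t ∈ Ico (0 : ℝ) 1, x = (1 - t) • ptA n + t • ptD n}

/-- The Lebesgue exponent with reciprocal `a` (so `expOf 0 = ∞`). -/
def expOf (a : ℝ) : ℝ≥0∞ := (ENNReal.ofReal a)⁻¹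

/-- The weighted velocity average `∫ f(x - tv, v) |v|^{-2s} dv` of the solution of
the kinetic transport equation with datum `f`. -/
def velAvg {n : ℕ} (s : ℝ) (f : Rn n × Rn n → ℂ) (t : ℝ) (x : Rn n) : ℂ :=
  ∫ v : Rn n, ((‖v‖ ^ (-(2 * s)) : ℝ) : ℂ) * f (x - t • v, v)

end OS

open OS

open scoped InnerProductSpace

namespace OS

/-- A family of vectors `e (t, x)` in a Hilbert space whose Gram matrix obeys a dispersive bound
and which is a Bessel system at each fixed time. -/
structure DispersiveFamily {H X : Type*} [NormedAddCommGroup H] [InnerProductSpace ℂ H]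
    [MeasurableSpace X] (μ : Measure X) (d ω C₀ : ℝ) (e : ℝ × X → H) : Prop where
  meas : StronglyMeasurable e
  gram_le : ∀ z z', ‖⟪e z, e z'⟫_ℂ‖ ≤ (π / max ω |z.1 - z'.1|) ^ d
  bessel : ∀ (t : ℝ) (φ : X → ℂ), Integrable φ μ →
    ‖∫ x, φ x • e (t, x) ∂μ‖ₑ ^ 2 ≤ ENNReal.ofReal C₀ * ∫⁻ x, ‖φ x‖ₑ ^ 2 ∂μ

/-- A measurable space-time set with time support in `F` and bounded slices. -/
structure Slab {X : Type*} [MeasurableSpace X] (μ : Measure X) (E : Set (ℝ × X)) (F : Set ℝ)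
    (M Φ : ℝ) : Prop where
  meas : MeasurableSet E
  measF : MeasurableSet F
  slice_le : ∀ t, μ (Prod.mk t ⁻¹' E) ≤ ENNReal.ofReal M
  time_mem : ∀ z ∈ E, z.1 ∈ F
  time_le : volume F ≤ ENNReal.ofReal Φ

section
variable {H X : Type*} [NormedAddCommGroup H] [InnerProductSpace ℂ H]
  [MeasurableSpace X] {μ : Measure X} {d ω C₀ M Φ : ℝ} {e : ℝ × X → H}
  {E : Set (ℝ × X)} {F : Set ℝ}

theorem DispersiveFamily.norm_sq_le (he : DispersiveFamily μ d ω C₀ e) (hω : 0 < ω) (z : ℝ × X) :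
    ‖e z‖ ^ 2 ≤ (π / ω) ^ d := by
  have := he.gram_le z z
  simpa [hω.le, norm_inner_eq_norm_iff, inner_self_eq_norm_sq_to_K] using this

theorem DispersiveFamily.norm_le (he : DispersiveFamily μ d ω C₀ e) (hω : 0 < ω) (z : ℝ × X) :
    ‖e z‖ ≤ √((π / ω) ^ d) := Real.le_sqrt_of_sq_le (he.norm_sq_le hω z)

/-- The frame coefficients of `G` restricted to `E`. -/
def coeff (e : ℝ × X → H) (E : Set (ℝ × X)) (G : H) : ℝ × X → ℂ :=
  E.indicator fun z => ⟪e z, G⟫_ℂ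

/-- The frame operator of `e` restricted to `E`, applied to `G`. -/
def frameOp (μ : Measure X) (e : ℝ × X → H) (E : Set (ℝ × X)) (G : H) : H :=
  ∫ z, coeff e E G z • e z ∂((volume : Measure ℝ).prod μ)

theorem coeff_meas (he : DispersiveFamily μ d ω C₀ e) (hE : Slab μ E F M Φ) (G : H) :
    StronglyMeasurable (coeff e E G) :=
  (he.meas.inner stronglyMeasurable_const).indicator hE.meas

theorem coeff_norm_le (he : DispersiveFamily μ d ω C₀ e) (hω : 0 < ω) (G : H) (z : ℝ × X) :
    ‖coeff e E G z‖ ≤ √((π / ω) ^ d) * ‖G‖ := by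
  unfold coeff
  refine (norm_indicator_le_norm_self _ _).trans ((norm_inner_le_norm _ _).trans ?_)
  gcongr
  exact he.norm_le hω z

theorem integrable_of_bdd_on {V : Type*} [NormedAddCommGroup V] {Z : Type*} [MeasurableSpace Z]
    {m : Measure Z} {A : Set Z} (hA : m A < ∞) {f : Z → V}
    (hf : AEStronglyMeasurable f m) {C : ℝ} (hC : ∀ z, ‖f z‖ ≤ C) (h0 : ∀ z, z ∉ A → f z = 0) :
    Integrable f m := by
  have h1 : IntegrableOn f A m :=
    Measure.integrableOn_of_bounded (M := C) hA.ne hf (Filter.Eventually.of_forall hC)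
  exact (integrableOn_iff_integrable_of_support_subset (fun z hz => by
    by_contra h; exact hz (h0 z h))).1 h1

/-- The fixed-time part of `frameOp`. -/
def sliceOp (μ : Measure X) (e : ℝ × X → H) (E : Set (ℝ × X)) (G : H) (t : ℝ) : H :=
  ∫ x, coeff e E G (t, x) • e (t, x) ∂μ

theorem sliceOp_eq_zero (hE : Slab μ E F M Φ) (G : H) {t : ℝ} (ht : t ∉ F) :
    sliceOp μ e E G t = 0 := by
  have : ∀ x, (t, x) ∉ E := fun x hx => ht (hE.time_mem _ hx)
  simp [sliceOp, coeff, this]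

/-- The squared `L²` norm of a slice of the coefficients. -/
def sliceSq (μ : Measure X) (e : ℝ × X → H) (E : Set (ℝ × X)) (G : H) (t : ℝ) : ℝ≥0∞ :=
  ∫⁻ x, ‖coeff e E G (t, x)‖ₑ ^ 2 ∂μ

/-- The integrand of `‖frameOp G‖²` over pairs of space-time points. -/
def pairing (e : ℝ × X → H) (E : Set (ℝ × X)) (G : H) (y : (ℝ × X) × (ℝ × X)) : ℂ :=
  (starRingEnd ℂ) (coeff e E G y.1) * coeff e E G y.2 * ⟪e y.1, e y.2⟫_ℂ

theorem slice_integrable (he : DispersiveFamily μ d ω C₀ e) (hω : 0 < ω)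
    (hE : Slab μ E F M Φ) (G : H) (t : ℝ) :
    Integrable (fun x => coeff e E G (t, x)) μ := by
  refine integrable_of_bdd_on (A := Prod.mk t ⁻¹' E) ((hE.slice_le t).trans_lt ofReal_lt_top)
    ((coeff_meas he hE G).comp_measurable measurable_prodMk_left).aestronglyMeasurable
    (fun x => coeff_norm_le he hω G (t, x)) fun z hz => by
      simp [coeff, show (t, z) ∉ E from hz]

theorem slice_frame_integrable (he : DispersiveFamily μ d ω C₀ e) (hω : 0 < ω)
    (hE : Slab μ E F M Φ) (G : H) (t : ℝ) :
    Integrable (fun x => coeff e E G (t, x) • e (t, x)) μ := by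
  refine integrable_of_bdd_on (A := Prod.mk t ⁻¹' E) ((hE.slice_le t).trans_lt ofReal_lt_top)
    (C := √((π / ω) ^ d) * ‖G‖ * √((π / ω) ^ d))
    (((coeff_meas he hE G).comp_measurable measurable_prodMk_left).smul
      (he.meas.comp_measurable measurable_prodMk_left)).aestronglyMeasurable
    (fun x => ?_) fun z hz => ?_
  · rw [norm_smul]
    have := coeff_norm_le (E := E) he hω G (t, x)
    have h2 := he.norm_le hω (t, x)
    gcongr
  · simp [coeff, show (t, z) ∉ E from hz]

variable [SFinite μ]

theorem Slab.measure_le (hE : Slab μ E F M Φ) :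
    ((volume : Measure ℝ).prod μ) E ≤ ENNReal.ofReal M * ENNReal.ofReal Φ := by
  rw [Measure.prod_apply hE.meas]
  calc ∫⁻ t, μ (Prod.mk t ⁻¹' E) ≤ ∫⁻ t, F.indicator (fun _ => ENNReal.ofReal M) t := by
        apply lintegral_mono
        intro t
        by_cases ht : t ∈ F
        · simpa [ht] using hE.slice_le t
        · have : Prod.mk t ⁻¹' E = ∅ := by
            ext x; simp only [mem_preimage, mem_empty_iff_false, iff_false]
            intro hx; exact ht (hE.time_mem _ hx)
          simp [this]
    _ = ENNReal.ofReal M * volume F := by rw [lintegral_indicator hE.measF]; simp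
    _ ≤ _ := by gcongr; exact hE.time_le

theorem Slab.measure_lt_top (hE : Slab μ E F M Φ) :
    ((volume : Measure ℝ).prod μ) E < ∞ :=
  hE.measure_le.trans_lt (ENNReal.mul_lt_top ofReal_lt_top ofReal_lt_top)

theorem coeff_integrable (he : DispersiveFamily μ d ω C₀ e) (hω : 0 < ω) (hE : Slab μ E F M Φ)
    (G : H) : Integrable (coeff e E G) ((volume : Measure ℝ).prod μ) :=
  integrable_of_bdd_on hE.measure_lt_top (coeff_meas he hE G).aestronglyMeasurable
    (coeff_norm_le he hω G) fun _ hz => indicator_of_notMem hz _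

theorem coeff_mul_integrable (he : DispersiveFamily μ d ω C₀ e) (hω : 0 < ω)
    (hE : Slab μ E F M Φ) (G : H) {V : Type*} [NormedAddCommGroup V] [NormedSpace ℂ V]
    {f : ℝ × X → V} (hf : AEStronglyMeasurable f ((volume : Measure ℝ).prod μ)) {C : ℝ}
    (hC : ∀ z, ‖f z‖ ≤ C) :
    Integrable (fun z => coeff e E G z • f z) ((volume : Measure ℝ).prod μ) := by
  refine integrable_of_bdd_on hE.measure_lt_top (C := √((π / ω) ^ d) * ‖G‖ * C)
    ((coeff_meas he hE G).aestronglyMeasurable.smul hf) (fun z => ?_)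
    fun z hz => by simp [coeff, hz]
  rw [norm_smul]
  have := coeff_norm_le (E := E) he hω G z
  have h2 := hC z
  gcongr

theorem frame_integrable (he : DispersiveFamily μ d ω C₀ e) (hω : 0 < ω)
    (hE : Slab μ E F M Φ) (G : H) :
    Integrable (fun z => coeff e E G z • e z) ((volume : Measure ℝ).prod μ) :=
  coeff_mul_integrable he hω hE G he.meas.aestronglyMeasurable (he.norm_le hω)

theorem coeff_sq_integrable (he : DispersiveFamily μ d ω C₀ e) (hω : 0 < ω)
    (hE : Slab μ E F M Φ) (G : H) :
    Integrable (fun z => ‖coeff e E G z‖ ^ 2) ((volume : Measure ℝ).prod μ) := by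
  have := (coeff_mul_integrable he hω hE G (coeff_meas he hE G).aestronglyMeasurable
    (coeff_norm_le he hω G)).norm
  simpa [norm_mul, sq] using this

variable [CompleteSpace H]

theorem inner_frameOp (he : DispersiveFamily μ d ω C₀ e) (hω : 0 < ω)
    (hE : Slab μ E F M Φ) (G h : H) :
    ⟪h, frameOp μ e E G⟫_ℂ = ∫ z, coeff e E G z * ⟪h, e z⟫_ℂ ∂((volume : Measure ℝ).prod μ) := by
  rw [frameOp, ← integral_inner (frame_integrable he hω hE G)]
  simp [inner_smul_right]

theorem inner_frameOp_eq (he : DispersiveFamily μ d ω C₀ e) (hω : 0 < ω)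
    (hE : Slab μ E F M Φ) (G G' : H) :
    ⟪G', frameOp μ e E G⟫_ℂ =
      ∫ z, coeff e E G z * (starRingEnd ℂ) (coeff e E G' z) ∂((volume : Measure ℝ).prod μ) := by
  rw [inner_frameOp he hω hE]
  congr 1; ext z
  by_cases hz : z ∈ E <;> simp [coeff, hz]

theorem inner_frameOp_self (he : DispersiveFamily μ d ω C₀ e) (hω : 0 < ω)
    (hE : Slab μ E F M Φ) (G : H) :
    ⟪G, frameOp μ e E G⟫_ℂ =
      ((∫ z, ‖coeff e E G z‖ ^ 2 ∂((volume : Measure ℝ).prod μ) : ℝ) : ℂ) := by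
  rw [inner_frameOp_eq he hω hE, ← integral_complex_ofReal]
  congr 1; ext z
  simp [Complex.mul_conj, Complex.normSq_eq_norm_sq]

theorem enorm_integral_prod_le {A B V : Type*} [MeasurableSpace A] [MeasurableSpace B]
    [NormedAddCommGroup V] [NormedSpace ℝ V] {a : Measure A} {b : Measure B} [SFinite a] [SFinite b]
    (f : A × B → V) : ‖∫ z, f z ∂a.prod b‖ₑ ≤ ∫⁻ x, ‖∫ y, f (x, y) ∂b‖ₑ ∂a := by
  by_cases hf : Integrable f (a.prod b)
  · rw [integral_prod _ hf]; exact enorm_integral_le_lintegral_enorm _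
  · rw [integral_undef hf]; simp

theorem pairing_integrable (he : DispersiveFamily μ d ω C₀ e) (hω : 0 < ω)
    (hE : Slab μ E F M Φ) (G : H) :
    Integrable (pairing e E G)
      (((volume : Measure ℝ).prod μ).prod ((volume : Measure ℝ).prod μ)) := by
  have h1 := (coeff_integrable he hω hE G)
  have h2 : Integrable (fun z => (starRingEnd ℂ) (coeff e E G z)) ((volume : Measure ℝ).prod μ) :=
    (RCLike.conjLIE (K := ℂ)).integrable_comp_iff.2 h1
  have h3 := h2.mul_prod h1
  refine h3.mul_bdd (c := √((π / ω) ^ d) * √((π / ω) ^ d)) ?_ (Filter.Eventually.of_forall ?_)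
  · exact ((he.meas.comp_measurable measurable_fst).inner
      (he.meas.comp_measurable measurable_snd)).aestronglyMeasurable
  · intro y
    refine (norm_inner_le_norm _ _).trans ?_
    have h1 := he.norm_le hω y.1
    have h2 := he.norm_le hω y.2
    gcongr

theorem integral_pairing (he : DispersiveFamily μ d ω C₀ e) (hω : 0 < ω)
    (hE : Slab μ E F M Φ) (G : H) :
    ∫ y, pairing e E G y ∂(((volume : Measure ℝ).prod μ).prod ((volume : Measure ℝ).prod μ)) =
      ((‖frameOp μ e E G‖ ^ 2 : ℝ) : ℂ) := by
  rw [integral_prod _ (pairing_integrable he hω hE G)]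
  have h1 : ∀ z, ∫ z', pairing e E G (z, z') ∂((volume : Measure ℝ).prod μ) =
      (starRingEnd ℂ) (coeff e E G z) * ⟪e z, frameOp μ e E G⟫_ℂ := by
    intro z
    rw [inner_frameOp he hω hE, ← integral_const_mul]
    simp only [pairing, mul_assoc]
  simp_rw [h1]
  have h2 : ∀ z, (starRingEnd ℂ) (coeff e E G z) * ⟪e z, frameOp μ e E G⟫_ℂ
      = (starRingEnd ℂ) (⟪frameOp μ e E G, coeff e E G z • e z⟫_ℂ) := by
    intro z; rw [inner_smul_right]; simp
  simp_rw [h2]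
  rw [integral_conj, integral_inner (frame_integrable he hω hE G)]
  change (starRingEnd ℂ) ⟪frameOp μ e E G, frameOp μ e E G⟫_ℂ = _
  rw [inner_self_eq_norm_sq_to_K]
  simp

theorem near_le (he : DispersiveFamily μ d ω C₀ e) (hω : 0 < ω)
    (hE : Slab μ E F M Φ) (G : H) {T : Set ℝ} (hT : MeasurableSet T) :
    ‖∫ y in {y : (ℝ × X) × (ℝ × X) | y.2.1 - y.1.1 ∈ T}, pairing e E G y
      ∂(((volume : Measure ℝ).prod μ).prod ((volume : Measure ℝ).prod μ))‖ₑ ≤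
    ∫⁻ t, ∫⁻ s, T.indicator 1 (s - t) * ‖⟪sliceOp μ e E G t, sliceOp μ e E G s⟫_ℂ‖ₑ := by
  have hS : MeasurableSet {y : (ℝ × X) × (ℝ × X) | y.2.1 - y.1.1 ∈ T} :=
    (measurable_snd.fst.sub measurable_fst.fst) hT
  rw [← integral_indicator hS,
    integral_prod _ ((pairing_integrable he hω hE G).indicator hS)]
  refine (enorm_integral_prod_le _).trans (lintegral_mono fun t => ?_)
  -- the part of `frameOp` coming from times `s ∈ t + T`
  set f : ℝ × X → H := fun z => T.indicator (fun _ => (1 : ℂ)) (z.1 - t) • (coeff e E G z • e z)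
    with hf
  have hTt : MeasurableSet {z : ℝ × X | z.1 - t ∈ T} := (measurable_fst.sub_const t) hT
  have hfi : f = {z : ℝ × X | z.1 - t ∈ T}.indicator fun z => coeff e E G z • e z := by
    ext z; by_cases hz : z.1 - t ∈ T <;> simp [hf, hz]
  have hfint : Integrable f ((volume : Measure ℝ).prod μ) := by
    rw [hfi]; exact (frame_integrable he hω hE G).indicator hTt
  set w := ∫ z, f z ∂((volume : Measure ℝ).prod μ) with hw
  have h1 : ∀ x, ∫ z', {y : (ℝ × X) × (ℝ × X) | y.2.1 - y.1.1 ∈ T}.indicator (pairing e E G)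
      ((t, x), z') ∂((volume : Measure ℝ).prod μ) =
      (starRingEnd ℂ) ⟪w, coeff e E G (t, x) • e (t, x)⟫_ℂ := by
    intro x
    rw [inner_smul_right, map_mul, inner_conj_symm, hw, ← integral_inner hfint,
      ← integral_const_mul]
    congr 1; ext z'
    by_cases hz : z'.1 - t ∈ T
    · simp [indicator, hz, hf, pairing, inner_smul_right]; ring
    · simp [indicator, hz, hf]
  have h2' : ∀ s, ∫ x, f (s, x) ∂μ =
      T.indicator (fun _ => (1 : ℂ)) (s - t) • sliceOp μ e E G s := fun s =>
    integral_smul (T.indicator (fun _ => (1 : ℂ)) (s - t)) fun x => coeff e E G (s, x) • e (s, x)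
  have h2 : w = ∫ s, T.indicator (fun _ => (1 : ℂ)) (s - t) • sliceOp μ e E G s := by
    rw [hw, integral_prod _ hfint]
    exact integral_congr_ae (Filter.Eventually.of_forall h2')
  have h3 : Integrable (fun s => T.indicator (fun _ => (1 : ℂ)) (s - t) • sliceOp μ e E G s) := by
    refine hfint.integral_prod_left.congr (Filter.Eventually.of_forall h2')
  simp_rw [h1]
  rw [integral_conj, integral_inner (slice_frame_integrable he hω hE G t)]
  change ‖(starRingEnd ℂ) ⟪w, sliceOp μ e E G t⟫_ℂ‖ₑ ≤ _
  rw [inner_conj_symm, h2, ← integral_inner h3]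
  refine (enorm_integral_le_lintegral_enorm _).trans (lintegral_mono fun s => ?_)
  by_cases hs : s - t ∈ T <;> simp [hs]

end

theorem ennreal_two_mul_le (a b : ℝ≥0∞) : 2 * (a * b) ≤ a ^ 2 + b ^ 2 := by
  induction a with
  | top => simp
  | coe a =>
    induction b with
    | top => simp
    | coe b =>
      norm_cast
      have := two_mul_le_add_sq a b
      rwa [mul_assoc] at this

theorem lintegral_schur {F : Set ℝ} {Λ : ℝ≥0∞} {K A : ℝ → ℝ≥0∞} {g : ℝ → ℝ → ℝ≥0∞}
    (hF : MeasurableSet F) (hK : Measurable K) (hA : Measurable A) (hKe : ∀ τ, K (-τ) = K τ)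
    (hΛ : ∀ t, ∫⁻ s in F, K (s - t) ≤ Λ)
    (hg : ∀ t ∈ F, ∀ s ∈ F, 2 * g t s ≤ K (s - t) * (A t + A s))
    (h0 : ∀ t s, t ∉ F ∨ s ∉ F → g t s = 0) : ∫⁻ t, ∫⁻ s, g t s ≤ Λ * ∫⁻ t, A t := by
  have key : ∀ t s, 2 * g t s ≤ F.indicator 1 s * K (s - t) * A t +
      F.indicator 1 t * K (s - t) * A s := by
    intro t s
    by_cases h : t ∈ F ∧ s ∈ F
    · simp only [indicator_of_mem h.1, indicator_of_mem h.2, Pi.one_apply, one_mul, ← mul_add]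
      exact hg t h.1 s h.2
    · rw [h0 t s (by tauto)]; simp
  have hFm : Measurable (F.indicator (1 : ℝ → ℝ≥0∞)) := measurable_one.indicator hF
  have e1 : ∀ t, ∫⁻ s, F.indicator 1 s * K (s - t) ≤ Λ := by
    intro t
    refine le_trans (le_of_eq ?_) (hΛ t)
    rw [← lintegral_indicator hF]
    congr 1; ext s; by_cases hs : s ∈ F <;> simp [hs]
  have e2 : ∀ s, ∫⁻ t, F.indicator 1 t * K (s - t) ≤ Λ := by
    intro s
    refine le_trans (le_of_eq ?_) (e1 s)
    congr 1; ext t; rw [← hKe, neg_sub]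
  have mK : Measurable fun z : ℝ × ℝ => K (z.2 - z.1) := hK.comp (measurable_snd.sub measurable_fst)
  have step : 2 * ∫⁻ t, ∫⁻ s, g t s ≤ 2 * (Λ * ∫⁻ t, A t) := by
    calc 2 * ∫⁻ t, ∫⁻ s, g t s = ∫⁻ t, ∫⁻ s, 2 * g t s := by
          rw [← lintegral_const_mul' _ _ (by simp)]
          congr 1; ext t
          rw [lintegral_const_mul' _ _ (by simp)]
      _ ≤ ∫⁻ t, ∫⁻ s, (F.indicator 1 s * K (s - t) * A t + F.indicator 1 t * K (s - t) * A s) :=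
          lintegral_mono fun t => lintegral_mono fun s => key t s
      _ = (∫⁻ t, ∫⁻ s, F.indicator 1 s * K (s - t) * A t) +
            ∫⁻ t, ∫⁻ s, F.indicator 1 t * K (s - t) * A s := by
          rw [← lintegral_add_left]
          · congr 1; ext t
            rw [lintegral_add_left]
            fun_prop
          · exact Measurable.lintegral_prod_right' (f := fun z : ℝ × ℝ =>
              F.indicator 1 z.2 * K (z.2 - z.1) * A z.1) (by fun_prop)
      _ = (∫⁻ t, ∫⁻ s, F.indicator 1 s * K (s - t) * A t) +
            ∫⁻ s, ∫⁻ t, F.indicator 1 t * K (s - t) * A s := by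
          congr 1
          rw [lintegral_lintegral_swap]
          apply Measurable.aemeasurable
          change Measurable fun z : ℝ × ℝ => F.indicator 1 z.1 * K (z.2 - z.1) * A z.2
          fun_prop
      _ ≤ (∫⁻ t, Λ * A t) + ∫⁻ s, Λ * A s := by
          gcongr with t s
          · rw [lintegral_mul_const _ (by fun_prop)]
            gcongr; exact e1 t
          · rw [lintegral_mul_const _ (by fun_prop)]
            gcongr; exact e2 s
      _ = 2 * (Λ * ∫⁻ t, A t) := by rw [lintegral_const_mul _ hA, two_mul]
  exact (ENNReal.mul_le_mul_iff_right (by simp) (by simp)).1 step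

theorem lintegral_max_rpow_le {γ ω : ℝ} (hγ : 1 < γ) (hω : 0 < ω) :
    ∫⁻ τ : ℝ, ENNReal.ofReal ((max ω |τ|) ^ (-γ)) ≤
      ENNReal.ofReal ((2 + 2 / (γ - 1)) * ω ^ (1 - γ)) := by
  have hI : ∫⁻ τ in Ioi ω, ENNReal.ofReal (τ ^ (-γ)) =
      ENNReal.ofReal (ω ^ (1 - γ) / (γ - 1)) := by
    rw [← ofReal_integral_eq_lintegral_ofReal
      (integrableOn_Ioi_rpow_of_lt (by linarith) hω)
      ((ae_restrict_iff' measurableSet_Ioi).2 (Filter.Eventually.of_forall fun τ hτ =>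
        rpow_nonneg (hω.trans hτ).le _)), integral_Ioi_rpow_of_lt (by linarith) hω]
    congr 1
    rw [show -γ + 1 = -(γ - 1) by ring, show 1 - γ = -(γ - 1) by ring, div_neg, neg_div, neg_neg]
  have hI2 : ∫⁻ τ in Iio (-ω), ENNReal.ofReal ((-τ) ^ (-γ)) =
      ENNReal.ofReal (ω ^ (1 - γ) / (γ - 1)) := by
    rw [← hI, ← lintegral_indicator measurableSet_Iio, ← lintegral_indicator measurableSet_Ioi,
      ← lintegral_neg_eq_self]
    congr 1; ext τ
    by_cases h : ω < τ <;> simp [indicator, h]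
  have hb : ∀ τ : ℝ, ENNReal.ofReal ((max ω |τ|) ^ (-γ)) ≤
      (Icc (-ω) ω).indicator (fun _ => ENNReal.ofReal (ω ^ (-γ))) τ +
      ((Ioi ω).indicator (fun τ => ENNReal.ofReal (τ ^ (-γ))) τ +
       (Iio (-ω)).indicator (fun τ => ENNReal.ofReal ((-τ) ^ (-γ))) τ) := by
    intro τ
    rcases lt_or_ge ω τ with h | h
    · rw [indicator_of_mem (show τ ∈ Ioi ω from h), abs_of_pos (hω.trans h), max_eq_right h.le]
      exact le_add_left (le_add_right le_rfl)
    · rcases lt_or_ge τ (-ω) with h2 | h2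
      · rw [indicator_of_mem (show τ ∈ Iio (-ω) from h2), abs_of_neg (by linarith),
          max_eq_right (by linarith)]
        exact le_add_left (le_add_left le_rfl)
      · rw [indicator_of_mem (show τ ∈ Icc (-ω) ω from ⟨h2, h⟩), max_eq_left (abs_le.2 ⟨h2, h⟩)]
        exact le_add_right le_rfl
  calc _ ≤ ∫⁻ τ, _ := lintegral_mono hb
    _ = ENNReal.ofReal (ω ^ (-γ)) * ENNReal.ofReal (2 * ω) +
        (ENNReal.ofReal (ω ^ (1 - γ) / (γ - 1)) + ENNReal.ofReal (ω ^ (1 - γ) / (γ - 1))) := by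
        rw [lintegral_add_left (measurable_const.indicator measurableSet_Icc), lintegral_add_left,
          lintegral_indicator measurableSet_Icc, lintegral_indicator measurableSet_Ioi,
          lintegral_indicator measurableSet_Iio, hI, hI2]
        · simp only [lintegral_const, MeasurableSet.univ, Measure.restrict_apply, univ_inter,
            volume_Icc]
          ring_nf
        · exact Measurable.indicator (by fun_prop) measurableSet_Ioi
    _ = _ := by
        have h1 : (0:ℝ) ≤ ω ^ (1 - γ) / (γ - 1) := by
          have : 0 < γ - 1 := by linarith
          positivity
        rw [← ENNReal.ofReal_mul (by positivity), ← ENNReal.ofReal_add h1 h1,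
          ← ENNReal.ofReal_add (by positivity) (by positivity)]
        congr 1
        rw [show 1 - γ = -γ + 1 by ring, rpow_add hω, Real.rpow_one]
        have : γ - 1 ≠ 0 := by linarith
        field_simp; ring

section
variable {H X : Type*} [NormedAddCommGroup H] [InnerProductSpace ℂ H] [CompleteSpace H]
  [MeasurableSpace X] {μ : Measure X} [SFinite μ] {d ω C₀ M Φ : ℝ} {e : ℝ × X → H}
  {E : Set (ℝ × X)} {F : Set ℝ}

theorem sliceSq_meas (he : DispersiveFamily μ d ω C₀ e) (hE : Slab μ E F M Φ) (G : H) :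
    Measurable (sliceSq μ e E G) :=
  Measurable.lintegral_prod_right ((coeff_meas he hE G).measurable.enorm.pow_const 2)

theorem lintegral_sliceSq (he : DispersiveFamily μ d ω C₀ e) (hE : Slab μ E F M Φ) (G : H) :
    ∫⁻ t, sliceSq μ e E G t = ∫⁻ z, ‖coeff e E G z‖ₑ ^ 2 ∂((volume : Measure ℝ).prod μ) := by
  rw [lintegral_prod _ ((coeff_meas he hE G).measurable.enorm.pow_const 2).aemeasurable]
  rfl

theorem inner_slice_le_bessel (he : DispersiveFamily μ d ω C₀ e) (hω : 0 < ω)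
    (hE : Slab μ E F M Φ) (G : H) (t s : ℝ) :
    2 * ‖⟪sliceOp μ e E G t, sliceOp μ e E G s⟫_ℂ‖ₑ ≤
      ENNReal.ofReal C₀ * (sliceSq μ e E G t + sliceSq μ e E G s) := by
  have h1 : ‖⟪sliceOp μ e E G t, sliceOp μ e E G s⟫_ℂ‖ₑ ≤
      ‖sliceOp μ e E G t‖ₑ * ‖sliceOp μ e E G s‖ₑ := by
    rw [← ofReal_norm, ← ofReal_norm, ← ofReal_norm, ← ENNReal.ofReal_mul (norm_nonneg _)]
    exact ENNReal.ofReal_le_ofReal (norm_inner_le_norm _ _)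
  calc _ ≤ 2 * (‖sliceOp μ e E G t‖ₑ * ‖sliceOp μ e E G s‖ₑ) := by gcongr
    _ ≤ _ := ennreal_two_mul_le _ _
    _ ≤ _ := by
      rw [mul_add]
      exact add_le_add (he.bessel t _ (slice_integrable he hω hE G t))
        (he.bessel s _ (slice_integrable he hω hE G s))

theorem inner_slice_le_gram (he : DispersiveFamily μ d ω C₀ e) (hω : 0 < ω)
    (hE : Slab μ E F M Φ) (G : H) (t s : ℝ) :
    2 * ‖⟪sliceOp μ e E G t, sliceOp μ e E G s⟫_ℂ‖ₑ ≤
      ENNReal.ofReal ((π / max ω |t - s|) ^ d) * ENNReal.ofReal M *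
        (sliceSq μ e E G t + sliceSq μ e E G s) := by
  set κ := ENNReal.ofReal ((π / max ω |t - s|) ^ d) with hκ
  set φ : X → ℂ := fun x => coeff e E G (t, x)
  set ψ : X → ℂ := fun x => coeff e E G (s, x)
  have h1 : ‖⟪sliceOp μ e E G t, sliceOp μ e E G s⟫_ℂ‖ₑ ≤
      ∫⁻ x, ∫⁻ y, ‖φ x‖ₑ * ‖ψ y‖ₑ * κ ∂μ ∂μ := by
    rw [← inner_conj_symm]
    rw [RCLike.enorm_conj]
    conv_lhs => rw [sliceOp.eq_1 μ e E G t, ← integral_inner (slice_frame_integrable he hω hE G t)]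
    refine (enorm_integral_le_lintegral_enorm _).trans (lintegral_mono fun x => ?_)
    rw [← inner_conj_symm, RCLike.enorm_conj, sliceOp,
      ← integral_inner (slice_frame_integrable he hω hE G s)]
    refine (enorm_integral_le_lintegral_enorm _).trans (lintegral_mono fun y => ?_)
    rw [inner_smul_left, inner_smul_right, enorm_mul, enorm_mul, RCLike.enorm_conj, ← mul_assoc]
    gcongr
    rw [← ofReal_norm]
    exact ENNReal.ofReal_le_ofReal (he.gram_le _ _)
  have hm : ∀ r, MeasurableSet (Prod.mk r ⁻¹' E : Set X) := fun r =>
    measurable_prodMk_left hE.meas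
  have hmc : ∀ r, Measurable fun x => coeff e E G (r, x) := fun r =>
    (coeff_meas he hE G).measurable.comp measurable_prodMk_left
  have hφ : Measurable φ := hmc t
  have hψ : Measurable ψ := hmc s
  have hpt : ∀ x y, 2 * (‖φ x‖ₑ * ‖ψ y‖ₑ) ≤
      ‖φ x‖ₑ ^ 2 * (Prod.mk s ⁻¹' E).indicator 1 y +
      (Prod.mk t ⁻¹' E).indicator 1 x * ‖ψ y‖ₑ ^ 2 := by
    intro x y
    by_cases hx : (t, x) ∈ E
    · by_cases hy : (s, y) ∈ E
      · simpa [indicator, hx, hy] using ennreal_two_mul_le _ _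
      · simp [ψ, coeff, hy]
    · simp [φ, coeff, hx]
  calc 2 * ‖⟪sliceOp μ e E G t, sliceOp μ e E G s⟫_ℂ‖ₑ
      ≤ 2 * ∫⁻ x, ∫⁻ y, ‖φ x‖ₑ * ‖ψ y‖ₑ * κ ∂μ ∂μ := by gcongr
    _ = κ * ∫⁻ x, ∫⁻ y, 2 * (‖φ x‖ₑ * ‖ψ y‖ₑ) ∂μ ∂μ := by
        rw [← lintegral_const_mul' _ _ (by simp), ← lintegral_const_mul' _ _ (by simp [hκ])]
        congr 1; ext x
        rw [← lintegral_const_mul' _ _ (by simp), ← lintegral_const_mul' _ _ (by simp [hκ])]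
        congr 1; ext y; ring
    _ ≤ κ * ∫⁻ x, ∫⁻ y, (‖φ x‖ₑ ^ 2 * (Prod.mk s ⁻¹' E).indicator 1 y +
      (Prod.mk t ⁻¹' E).indicator 1 x * ‖ψ y‖ₑ ^ 2) ∂μ ∂μ := by
        gcongr with x y; exact hpt x y
    _ = κ * (sliceSq μ e E G t * μ (Prod.mk s ⁻¹' E) +
          μ (Prod.mk t ⁻¹' E) * sliceSq μ e E G s) := by
        congr 1
        have : ∀ x, ∫⁻ y, (‖φ x‖ₑ ^ 2 * (Prod.mk s ⁻¹' E).indicator 1 y +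
            (Prod.mk t ⁻¹' E).indicator 1 x * ‖ψ y‖ₑ ^ 2) ∂μ =
            ‖φ x‖ₑ ^ 2 * μ (Prod.mk s ⁻¹' E) +
              (Prod.mk t ⁻¹' E).indicator 1 x * sliceSq μ e E G s := by
          intro x
          rw [lintegral_add_left ((measurable_one.indicator (hm s)).const_mul _),
            lintegral_const_mul _ (measurable_one.indicator (hm s)),
            lintegral_const_mul _ (hψ.enorm.pow_const 2), lintegral_indicator_one (hm s)]
          rfl
        simp_rw [this]
        rw [lintegral_add_left ((hφ.enorm.pow_const 2).mul_const _),
            lintegral_mul_const _ (measurable_one.indicator (hm t)),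
            lintegral_mul_const _ (hφ.enorm.pow_const 2), lintegral_indicator_one (hm t)]
        rfl
    _ ≤ κ * (sliceSq μ e E G t * ENNReal.ofReal M + ENNReal.ofReal M * sliceSq μ e E G s) := by
        gcongr <;> exact hE.slice_le _
    _ = _ := by ring

theorem near_le_schur (he : DispersiveFamily μ d ω C₀ e) (hω : 0 < ω)
    (hE : Slab μ E F M Φ) (G : H) {T : Set ℝ} (hT : MeasurableSet T) (hTs : ∀ τ, -τ ∈ T ↔ τ ∈ T)
    {Λ : ℝ≥0∞}
    (hΛ : ∀ t, ∫⁻ s in F, T.indicator 1 (s - t) * min (ENNReal.ofReal C₀)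
      (ENNReal.ofReal ((π / max ω |s - t|) ^ d) * ENNReal.ofReal M) ≤ Λ) :
    ‖∫ y in {y : (ℝ × X) × (ℝ × X) | y.2.1 - y.1.1 ∈ T}, pairing e E G y
      ∂(((volume : Measure ℝ).prod μ).prod ((volume : Measure ℝ).prod μ))‖ₑ ≤
    Λ * ∫⁻ z, ‖coeff e E G z‖ₑ ^ 2 ∂((volume : Measure ℝ).prod μ) := by
  refine (near_le he hω hE G hT).trans ?_
  rw [← lintegral_sliceSq he hE]
  refine lintegral_schur (K := fun τ => T.indicator 1 τ * min (ENNReal.ofReal C₀)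
      (ENNReal.ofReal ((π / max ω |τ|) ^ d) * ENNReal.ofReal M)) hE.measF ?_ (sliceSq_meas he hE G)
      ?_ hΛ ?_ ?_
  · exact (measurable_one.indicator hT).mul (by fun_prop)
  · intro τ; by_cases h : τ ∈ T <;> simp [indicator, hTs, h]
  · intro t _ s _
    by_cases h : s - t ∈ T
    · simp only [indicator_of_mem h, Pi.one_apply, one_mul]
      rcases min_choice (ENNReal.ofReal C₀)
        (ENNReal.ofReal ((π / max ω |s - t|) ^ d) * ENNReal.ofReal M) with h | h <;> rw [h]
      · exact inner_slice_le_bessel he hω hE G t s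
      · rw [abs_sub_comm]; exact inner_slice_le_gram he hω hE G t s
    · simp [h]
  · rintro t s (h | h) <;> simp [sliceOp_eq_zero hE G h]

end

section
variable {H X : Type*} [NormedAddCommGroup H] [InnerProductSpace ℂ H]
  [MeasurableSpace X] {μ : Measure X} {d ω C₀ M Φ : ℝ} {e : ℝ × X → H}
  {E : Set (ℝ × X)} {F : Set ℝ} {ι : Type*} {J : Finset ι} {G : ι → H} {ν : ℝ}

/-- Total mass of the coefficients of the system `G` over `E`. -/
def mass (μ : Measure X) (e : ℝ × X → H) (E : Set (ℝ × X)) (J : Finset ι) (G : ι → H) : ℝ :=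
  ∑ j ∈ J, ∫ z, ‖coeff e E (G j) z‖ ^ 2 ∂((volume : Measure ℝ).prod μ)

/-- Total squared norm of the frame operator on the system `G`. -/
def energy (μ : Measure X) (e : ℝ × X → H) (E : Set (ℝ × X)) (J : Finset ι) (G : ι → H) : ℝ :=
  ∑ j ∈ J, ‖frameOp μ e E (G j)‖ ^ 2

theorem mass_nonneg : 0 ≤ mass μ e E J G :=
  Finset.sum_nonneg fun _ _ => integral_nonneg fun _ => by positivity

theorem energy_nonneg : 0 ≤ energy μ e E J G := Finset.sum_nonneg fun _ _ => by positivity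

variable [CompleteSpace H] [SFinite μ]

theorem lintegral_coeff_sq (he : DispersiveFamily μ d ω C₀ e) (hω : 0 < ω)
    (hE : Slab μ E F M Φ) (g : H) :
    ∫⁻ z, ‖coeff e E g z‖ₑ ^ 2 ∂((volume : Measure ℝ).prod μ) =
      ENNReal.ofReal (∫ z, ‖coeff e E g z‖ ^ 2 ∂((volume : Measure ℝ).prod μ)) := by
  rw [ofReal_integral_eq_lintegral_ofReal (coeff_sq_integrable he hω hE g)
    (Filter.Eventually.of_forall fun _ => by positivity)]
  congr 1; ext z
  rw [ENNReal.ofReal_pow (norm_nonneg _), ofReal_norm]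

theorem mass_sq_le (he : DispersiveFamily μ d ω C₀ e) (hω : 0 < ω)
    (hE : Slab μ E F M Φ) (hν : ∑ j ∈ J, ‖G j‖ ^ 2 ≤ ν) :
    mass μ e E J G ^ 2 ≤ ν * energy μ e E J G := by
  have h1 : mass μ e E J G ≤ ∑ j ∈ J, ‖G j‖ * ‖frameOp μ e E (G j)‖ := by
    refine Finset.sum_le_sum fun j _ => ?_
    have h := inner_frameOp_self he hω hE (G j)
    have h2 := norm_inner_le_norm (𝕜 := ℂ) (G j) (frameOp μ e E (G j))
    rw [h, Complex.norm_real] at h2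
    exact (le_abs_self _).trans h2
  calc mass μ e E J G ^ 2 ≤ (∑ j ∈ J, ‖G j‖ * ‖frameOp μ e E (G j)‖) ^ 2 := by
        gcongr; exact mass_nonneg
    _ ≤ (∑ j ∈ J, ‖G j‖ ^ 2) * energy μ e E J G := Finset.sum_mul_sq_le_sq_mul_sq _ _ _
    _ ≤ _ := by gcongr; exact energy_nonneg

theorem mass_le_trivial (he : DispersiveFamily μ d ω C₀ e) (hω : 0 < ω)
    (hE : Slab μ E F M Φ) (hM : 0 ≤ M) (hΦ : 0 ≤ Φ)
    (hB : ∀ h, ∑ j ∈ J, ‖⟪G j, h⟫_ℂ‖ ^ 2 ≤ ‖h‖ ^ 2) :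
    mass μ e E J G ≤ (π / ω) ^ d * (M * Φ) := by
  rw [mass, ← integral_finsetSum _ fun j _ => coeff_sq_integrable he hω hE (G j)]
  have hi : Integrable (E.indicator fun _ => (π / ω) ^ d) ((volume : Measure ℝ).prod μ) :=
    (integrable_indicator_iff hE.meas).2 (integrableOn_const hE.measure_lt_top.ne)
  have hle : ∀ z, ∑ j ∈ J, ‖coeff e E (G j) z‖ ^ 2 ≤ E.indicator (fun _ => (π / ω) ^ d) z := by
    intro z
    by_cases hz : z ∈ E
    · simp only [coeff, indicator_of_mem hz]
      refine le_trans ?_ ((hB (e z)).trans (he.norm_sq_le hω z))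
      simp_rw [norm_inner_symm]; rfl
    · simp [coeff, hz]
  refine (integral_mono (integrable_finsetSum _ fun j _ => coeff_sq_integrable he hω hE (G j))
    hi hle).trans ?_
  rw [integral_indicator_const _ hE.meas, smul_eq_mul, mul_comm]
  have : (0:ℝ) ≤ (π / ω) ^ d := by positivity
  gcongr
  rw [Measure.real]
  refine ENNReal.toReal_le_of_le_ofReal (by positivity) ?_
  rw [ENNReal.ofReal_mul hM]; exact hE.measure_le

theorem energy_eq (he : DispersiveFamily μ d ω C₀ e) (hω : 0 < ω)
    (hE : Slab μ E F M Φ) : ((energy μ e E J G : ℝ) : ℂ) = ∑ j ∈ J, ∫ y, pairing e E (G j) y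
      ∂(((volume : Measure ℝ).prod μ).prod ((volume : Measure ℝ).prod μ)) := by
  rw [energy, Complex.ofReal_sum]
  exact Finset.sum_congr rfl fun j _ => (integral_pairing he hω hE (G j)).symm

theorem mass_le_schur (he : DispersiveFamily μ d ω C₀ e) (hω : 0 < ω)
    (hE : Slab μ E F M Φ) (hν : ∑ j ∈ J, ‖G j‖ ^ 2 ≤ ν) {Λ : ℝ} (hΛ0 : 0 ≤ Λ)
    (hΛ : ∀ t, ∫⁻ s in F, min (ENNReal.ofReal C₀)
      (ENNReal.ofReal ((π / max ω |s - t|) ^ d) * ENNReal.ofReal M) ≤ ENNReal.ofReal Λ) :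
    mass μ e E J G ≤ ν * Λ := by
  have hν0 : 0 ≤ ν := (Finset.sum_nonneg fun _ _ => by positivity).trans hν
  have h1 : energy μ e E J G ≤ Λ * mass μ e E J G := by
    rw [energy, mass, Finset.mul_sum]
    refine Finset.sum_le_sum fun j _ => ?_
    have := near_le_schur he hω hE (G j) (T := univ) MeasurableSet.univ (by simp)
      (Λ := ENNReal.ofReal Λ) (by simpa using hΛ)
    simp only [mem_univ, ofPred_true, Measure.restrict_univ] at this
    rw [integral_pairing he hω hE, lintegral_coeff_sq he hω hE, ← ENNReal.ofReal_mul hΛ0,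
      ← ofReal_norm, Complex.norm_real, Real.norm_of_nonneg (by positivity)] at this
    exact (ENNReal.ofReal_le_ofReal_iff
      (mul_nonneg hΛ0 (integral_nonneg fun _ => by positivity))).1 this
  have h2 := mass_sq_le he hω hE hν
  have h3 : mass μ e E J G * mass μ e E J G ≤ (ν * Λ) * mass μ e E J G := by nlinarith
  rcases (mass_nonneg (μ := μ) (e := e) (E := E) (J := J) (G := G)).eq_or_lt with h | h
  · rw [← h]; positivity
  · exact le_of_mul_le_mul_right h3 h

theorem lintegral_hs_le (he : DispersiveFamily μ d ω C₀ e) (hω : 0 < ω)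
    (hE : Slab μ E F M Φ) (hB : ∀ h, ∑ j ∈ J, ‖⟪G j, h⟫_ℂ‖ ^ 2 ≤ ‖h‖ ^ 2) :
    ∫⁻ y, ‖∑ j ∈ J, (starRingEnd ℂ) (coeff e E (G j) y.1) * coeff e E (G j) y.2‖ₑ ^ 2
      ∂(((volume : Measure ℝ).prod μ).prod ((volume : Measure ℝ).prod μ)) ≤
      ENNReal.ofReal (energy μ e E J G) := by
  set m := (volume : Measure ℝ).prod μ
  set D : (ℝ × X) × (ℝ × X) → ℂ := fun y =>
    ∑ j ∈ J, (starRingEnd ℂ) (coeff e E (G j) y.1) * coeff e E (G j) y.2 with hD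
  have hmul : ∀ i j, Integrable (fun z => coeff e E (G j) z * (starRingEnd ℂ) (coeff e E (G i) z)) m
      := fun i j => coeff_mul_integrable he hω hE (G j)
        (Complex.continuous_conj.comp_stronglyMeasurable
          (coeff_meas he hE (G i))).aestronglyMeasurable
        (fun z => by rw [RCLike.norm_conj]; exact coeff_norm_le he hω (G i) z)
  have hexp : ∀ y, ((‖D y‖ ^ 2 : ℝ) : ℂ) = ∑ i ∈ J, ∑ j ∈ J,
      (coeff e E (G j) y.1 * (starRingEnd ℂ) (coeff e E (G i) y.1)) *
      (coeff e E (G i) y.2 * (starRingEnd ℂ) (coeff e E (G j) y.2)) := by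
    intro y
    rw [← Complex.normSq_eq_norm_sq, Complex.normSq_eq_conj_mul_self, mul_comm, hD, map_sum,
      Finset.sum_mul_sum]
    refine Finset.sum_congr rfl fun i _ => Finset.sum_congr rfl fun j _ => ?_
    simp only [map_mul, Complex.conj_conj]; ring
  have hij : ∀ i j, Integrable (fun y : (ℝ × X) × (ℝ × X) =>
      (coeff e E (G j) y.1 * (starRingEnd ℂ) (coeff e E (G i) y.1)) *
      (coeff e E (G i) y.2 * (starRingEnd ℂ) (coeff e E (G j) y.2))) (m.prod m) :=
    fun i j => (hmul i j).mul_prod (hmul j i)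
  have hinner : Integrable (fun y => ((‖D y‖ ^ 2 : ℝ) : ℂ)) (m.prod m) := by
    simp_rw [hexp]
    exact integrable_finsetSum _ fun i _ => integrable_finsetSum _ fun j _ => hij i j
  have hval : ((∫ y, ‖D y‖ ^ 2 ∂m.prod m : ℝ) : ℂ) =
      ∑ i ∈ J, ∑ j ∈ J, ((‖⟪G i, frameOp μ e E (G j)⟫_ℂ‖ ^ 2 : ℝ) : ℂ) := by
    rw [← integral_complex_ofReal]
    simp_rw [hexp]
    rw [integral_finsetSum _ fun i _ => integrable_finsetSum _ fun j _ => hij i j]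
    refine Finset.sum_congr rfl fun i _ => ?_
    rw [integral_finsetSum _ fun j _ => hij i j]
    refine Finset.sum_congr rfl fun j _ => ?_
    rw [integral_prod_mul (fun z => coeff e E (G j) z * (starRingEnd ℂ) (coeff e E (G i) z))
      (fun z => coeff e E (G i) z * (starRingEnd ℂ) (coeff e E (G j) z)),
      ← inner_frameOp_eq he hω hE (G j) (G i)]
    have : ∫ z, coeff e E (G i) z * (starRingEnd ℂ) (coeff e E (G j) z) ∂m =
        (starRingEnd ℂ) ⟪G i, frameOp μ e E (G j)⟫_ℂ := by
      rw [inner_frameOp_eq he hω hE, ← integral_conj]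
      congr 1; ext z; simp [mul_comm]
    rw [this, Complex.mul_conj, Complex.normSq_eq_norm_sq]
  have hval' : ∫ y, ‖D y‖ ^ 2 ∂m.prod m =
      ∑ i ∈ J, ∑ j ∈ J, ‖⟪G i, frameOp μ e E (G j)⟫_ℂ‖ ^ 2 := by exact_mod_cast hval
  have hle : ∫ y, ‖D y‖ ^ 2 ∂m.prod m ≤ energy μ e E J G := by
    rw [hval', Finset.sum_comm]
    exact Finset.sum_le_sum fun j _ => hB _
  calc _ = ∫⁻ y, ENNReal.ofReal (‖D y‖ ^ 2) ∂m.prod m := by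
        congr 1; ext y; rw [ENNReal.ofReal_pow (norm_nonneg _), ofReal_norm]
    _ = ENNReal.ofReal (∫ y, ‖D y‖ ^ 2 ∂m.prod m) := by
        rw [ofReal_integral_eq_lintegral_ofReal]
        · exact hinner.re.congr (Filter.Eventually.of_forall fun y => Complex.ofReal_re _)
        · exact Filter.Eventually.of_forall fun _ => by positivity
    _ ≤ _ := ENNReal.ofReal_le_ofReal hle

theorem lintegral_far_le (hE : Slab μ E F M Φ) {h : ℝ → ℝ≥0∞} (hh : Measurable h) :
    ∫⁻ y, E.indicator 1 y.1 * (E.indicator 1 y.2 * h (y.2.1 - y.1.1))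
      ∂(((volume : Measure ℝ).prod μ).prod ((volume : Measure ℝ).prod μ)) ≤
      ENNReal.ofReal M * ENNReal.ofReal Φ * (ENNReal.ofReal M * ∫⁻ τ, h τ) := by
  have mE : Measurable (E.indicator (1 : ℝ × X → ℝ≥0∞)) := measurable_one.indicator hE.meas
  rw [lintegral_prod _ (by fun_prop)]
  have h1 : ∀ z : ℝ × X, ∫⁻ z', E.indicator 1 z' * h (z'.1 - z.1) ∂((volume : Measure ℝ).prod μ) ≤
      ENNReal.ofReal M * ∫⁻ τ, h τ := by
    intro z
    rw [lintegral_prod _ (by fun_prop)]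
    calc _ = ∫⁻ s, μ (Prod.mk s ⁻¹' E) * h (s - z.1) := by
          congr 1; ext s
          change ∫⁻ y, E.indicator 1 (s, y) * h (s - z.1) ∂μ = _
          rw [lintegral_mul_const _ (by fun_prop),
            ← lintegral_indicator_one (measurable_prodMk_left hE.meas)]
          rfl
      _ ≤ ∫⁻ s, ENNReal.ofReal M * h (s - z.1) := by
          gcongr with s; exact hE.slice_le s
      _ = _ := by
          rw [lintegral_const_mul _ (by fun_prop), lintegral_sub_right_eq_self h z.1]
  calc _ ≤ ∫⁻ z, E.indicator 1 z * (ENNReal.ofReal M * ∫⁻ τ, h τ)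
          ∂((volume : Measure ℝ).prod μ) := by
        refine lintegral_mono fun z => ?_
        simp only
        rw [lintegral_const_mul _ (by fun_prop)]
        gcongr; exact h1 z
    _ = ((volume : Measure ℝ).prod μ) E * (ENNReal.ofReal M * ∫⁻ τ, h τ) := by
        rw [lintegral_mul_const _ mE, lintegral_indicator_one hE.meas]
    _ ≤ _ := by gcongr; exact hE.measure_le

end

section
variable {H X : Type*} [NormedAddCommGroup H] [InnerProductSpace ℂ H] [CompleteSpace H]
  [MeasurableSpace X] {μ : Measure X} [SFinite μ] {d ω C₀ M Φ : ℝ} {e : ℝ × X → H}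
  {E : Set (ℝ × X)} {F : Set ℝ} {ι : Type*} {J : Finset ι} {G : ι → H} {ν : ℝ}

theorem far_le (he : DispersiveFamily μ d ω C₀ e) (hω : 0 < ω) (hd : 1 < 2 * d)
    (hE : Slab μ E F M Φ) (hM : 0 ≤ M) (hΦ : 0 ≤ Φ)
    (hB : ∀ h, ∑ j ∈ J, ‖⟪G j, h⟫_ℂ‖ ^ 2 ≤ ‖h‖ ^ 2) {L : ℝ} (hL : 0 < L) :
    ‖∑ j ∈ J, ∫ y in {y : (ℝ × X) × (ℝ × X) | y.2.1 - y.1.1 ∈ Ioo (-L) L}ᶜ, pairing e E (G j) y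
      ∂(((volume : Measure ℝ).prod μ).prod ((volume : Measure ℝ).prod μ))‖ ≤
    √(energy μ e E J G) *
      √(M * Φ * (M * (π ^ (2 * d) * ((2 + 2 / (2 * d - 1)) * L ^ (1 - 2 * d))))) := by
  set m := (volume : Measure ℝ).prod μ
  set N := {y : (ℝ × X) × (ℝ × X) | y.2.1 - y.1.1 ∈ Ioo (-L) L}
  have hN : MeasurableSet N := (measurable_snd.fst.sub measurable_fst.fst) measurableSet_Ioo
  set D : (ℝ × X) × (ℝ × X) → ℂ := fun y =>
    ∑ j ∈ J, (starRingEnd ℂ) (coeff e E (G j) y.1) * coeff e E (G j) y.2 with hD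
  set k : (ℝ × X) × (ℝ × X) → ℝ≥0∞ := fun y => E.indicator 1 y.1 * (E.indicator 1 y.2 *
    ENNReal.ofReal (π ^ d * (max L |y.2.1 - y.1.1|) ^ (-d))) with hk
  have mE : Measurable (E.indicator (1 : ℝ × X → ℝ≥0∞)) := measurable_one.indicator hE.meas
  have mD : Measurable D := by
    refine Finset.measurable_sum _ fun j _ => ?_
    have := (coeff_meas he hE (G j)).measurable
    exact (Complex.continuous_conj.measurable.comp (this.comp measurable_fst)).mul
      (this.comp measurable_snd)
  have mk : Measurable k := by
    refine (mE.comp measurable_fst).mul ((mE.comp measurable_snd).mul ?_)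
    fun_prop
  have hd0 : 0 < d := by linarith
  have hpt : ∀ y ∈ Nᶜ, ‖∑ j ∈ J, pairing e E (G j) y‖ₑ ≤ ‖D y‖ₑ * k y := by
    intro y hy
    have h1 : ∑ j ∈ J, pairing e E (G j) y = D y * ⟪e y.1, e y.2⟫_ℂ := by
      rw [hD, Finset.sum_mul]; rfl
    rw [h1, enorm_mul]
    by_cases h : y.1 ∈ E ∧ y.2 ∈ E
    · gcongr
      simp only [hk, indicator_of_mem h.1, indicator_of_mem h.2, Pi.one_apply, one_mul]
      rw [← ofReal_norm]
      apply ENNReal.ofReal_le_ofReal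
      refine (he.gram_le _ _).trans ?_
      have h3 : L ≤ |y.2.1 - y.1.1| := by
        by_contra hc; exact hy (abs_lt.1 (not_le.1 hc))
      rw [max_eq_right h3, rpow_neg (by positivity), ← div_eq_mul_inv,
        ← Real.div_rpow pi_pos.le (abs_nonneg _)]
      have h4 : 0 < |y.2.1 - y.1.1| := hL.trans_le h3
      gcongr
      rw [abs_sub_comm]; exact le_max_right _ _
    · have : D y = 0 := by
        rw [hD]; refine Finset.sum_eq_zero fun j _ => ?_
        rcases not_and_or.1 h with h | h <;> simp [coeff, h]
      simp [this]
  have hsum : ∑ j ∈ J, ∫ y in Nᶜ, pairing e E (G j) y ∂m.prod m =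
      ∫ y in Nᶜ, ∑ j ∈ J, pairing e E (G j) y ∂m.prod m :=
    (integral_finsetSum _ fun j _ => (pairing_integrable he hω hE (G j)).integrableOn).symm
  have h1 : ‖∑ j ∈ J, ∫ y in Nᶜ, pairing e E (G j) y ∂m.prod m‖ₑ ≤
      (∫⁻ y, ‖D y‖ₑ ^ 2 ∂m.prod m) ^ (1 / 2 : ℝ) * (∫⁻ y, k y ^ 2 ∂m.prod m) ^ (1 / 2 : ℝ) := by
    rw [hsum]
    calc _ ≤ ∫⁻ y in Nᶜ, ‖∑ j ∈ J, pairing e E (G j) y‖ₑ ∂m.prod m :=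
          enorm_integral_le_lintegral_enorm _
      _ ≤ ∫⁻ y in Nᶜ, ‖D y‖ₑ * k y ∂m.prod m := setLIntegral_mono' hN.compl hpt
      _ ≤ ∫⁻ y, ‖D y‖ₑ * k y ∂m.prod m := setLIntegral_le_lintegral _ _
      _ ≤ _ := by
        have := ENNReal.lintegral_mul_le_Lp_mul_Lq (m.prod m) (Real.HolderConjugate.two_two)
          mD.enorm.aemeasurable mk.aemeasurable
        simpa using this
  have h2 : ∫⁻ y, k y ^ 2 ∂m.prod m ≤
      ENNReal.ofReal (M * Φ * (M * (π ^ (2 * d) * ((2 + 2 / (2 * d - 1)) * L ^ (1 - 2 * d))))) := by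
    have hkk : ∀ y, k y ^ 2 = E.indicator 1 y.1 * (E.indicator 1 y.2 *
        (fun τ : ℝ => ENNReal.ofReal (π ^ (2 * d)) *
          ENNReal.ofReal ((max L |τ|) ^ (-(2 * d)))) (y.2.1 - y.1.1)) := by
      intro y
      have hp : 0 < max L |y.2.1 - y.1.1| := lt_max_of_lt_left hL
      have : ENNReal.ofReal (π ^ d * max L |y.2.1 - y.1.1| ^ (-d)) ^ 2 =
          ENNReal.ofReal (π ^ (2 * d)) * ENNReal.ofReal ((max L |y.2.1 - y.1.1|) ^ (-(2 * d))) := by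
        rw [← ENNReal.ofReal_pow (by positivity), ← ENNReal.ofReal_mul (by positivity), mul_pow,
          ← Real.rpow_mul_natCast pi_pos.le, ← Real.rpow_mul_natCast hp.le]
        congr 3 <;> push_cast <;> ring
      simp only [hk, ← this, mul_pow]
      by_cases h1 : y.1 ∈ E <;> by_cases h2 : y.2 ∈ E <;> simp [h1, h2]
    simp_rw [hkk]
    have hm : Measurable fun τ : ℝ => ENNReal.ofReal (π ^ (2 * d)) *
          ENNReal.ofReal ((max L |τ|) ^ (-(2 * d))) := by fun_prop
    refine (lintegral_far_le hE hm).trans ?_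
    rw [lintegral_const_mul _ (by fun_prop)]
    calc _ ≤ ENNReal.ofReal M * ENNReal.ofReal Φ *
            (ENNReal.ofReal M * (ENNReal.ofReal (π ^ (2 * d)) *
          ENNReal.ofReal ((2 + 2 / (2 * d - 1)) * L ^ (1 - 2 * d)))) := by
          gcongr; exact lintegral_max_rpow_le hd hL
      _ = _ := by
        rw [← ENNReal.ofReal_mul hM, ← ENNReal.ofReal_mul (p := π ^ (2 * d)) (by positivity),
          ← ENNReal.ofReal_mul hM, ← ENNReal.ofReal_mul (by positivity)]
  have h3 : ‖∑ j ∈ J, ∫ y in Nᶜ, pairing e E (G j) y ∂m.prod m‖ₑ ≤ ENNReal.ofReal (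
      √(energy μ e E J G) *
      √(M * Φ * (M * (π ^ (2 * d) * ((2 + 2 / (2 * d - 1)) * L ^ (1 - 2 * d)))))) := by
    refine h1.trans ?_
    rw [ENNReal.ofReal_mul (by positivity), Real.sqrt_eq_rpow, Real.sqrt_eq_rpow,
      ← ENNReal.ofReal_rpow_of_nonneg energy_nonneg (by norm_num),
      ← ENNReal.ofReal_rpow_of_nonneg _ (by norm_num)]
    · gcongr
      exact lintegral_hs_le he hω hE hB
    · have : 0 < 2 * d - 1 := by linarith
      positivity
  rw [← ofReal_norm] at h3
  exact (ENNReal.ofReal_le_ofReal_iff (by positivity)).1 h3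

theorem mass_le_near_far (he : DispersiveFamily μ d ω C₀ e) (hω : 0 < ω) (hd : 1 < 2 * d)
    (hC : 0 ≤ C₀) (hE : Slab μ E F M Φ) (hM : 0 ≤ M) (hΦ : 0 ≤ Φ)
    (hB : ∀ h, ∑ j ∈ J, ‖⟪G j, h⟫_ℂ‖ ^ 2 ≤ ‖h‖ ^ 2) (hν : ∑ j ∈ J, ‖G j‖ ^ 2 ≤ ν)
    {L : ℝ} (hL : 0 < L) :
    mass μ e E J G ≤ C₀ * (2 * L) * ν + √ν *
      √(M * Φ * (M * (π ^ (2 * d) * ((2 + 2 / (2 * d - 1)) * L ^ (1 - 2 * d))))) := by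
  have hν0 : 0 ≤ ν := (Finset.sum_nonneg fun _ _ => by positivity).trans hν
  set Hh := energy μ e E J G
  set S := mass μ e E J G
  set κ := √(M * Φ * (M * (π ^ (2 * d) * ((2 + 2 / (2 * d - 1)) * L ^ (1 - 2 * d)))))
  have hH0 : 0 ≤ Hh := energy_nonneg
  set m := (volume : Measure ℝ).prod μ
  set N := {y : (ℝ × X) × (ℝ × X) | y.2.1 - y.1.1 ∈ Ioo (-L) L}
  have hN : MeasurableSet N := (measurable_snd.fst.sub measurable_fst.fst) measurableSet_Ioo
  have hnear : ∀ j ∈ J, ‖∫ y in N, pairing e E (G j) y ∂m.prod m‖ ≤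
      C₀ * (2 * L) * ∫ z, ‖coeff e E (G j) z‖ ^ 2 ∂m := by
    intro j _
    have := near_le_schur he hω hE (G j) (T := Ioo (-L) L) measurableSet_Ioo
      (fun τ => by constructor <;> rintro ⟨h1, h2⟩ <;> constructor <;> linarith)
      (Λ := ENNReal.ofReal (C₀ * (2 * L))) (fun t => by
        calc _ ≤ ∫⁻ s, (Ioo (-L) L).indicator 1 (s - t) * ENNReal.ofReal C₀ := by
              refine (setLIntegral_le_lintegral _ _).trans ?_
              gcongr; exact min_le_left _ _
          _ = _ := by
              have mI : Measurable ((Ioo (-L) L).indicator (1 : ℝ → ℝ≥0∞)) :=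
                measurable_one.indicator measurableSet_Ioo
              rw [lintegral_mul_const _ (by fun_prop),
                lintegral_sub_right_eq_self ((Ioo (-L) L).indicator 1) t,
                lintegral_indicator_one measurableSet_Ioo, Real.volume_Ioo,
                ← ENNReal.ofReal_mul (by linarith)]
              congr 1; ring)
    rw [lintegral_coeff_sq he hω hE, ← ENNReal.ofReal_mul (by positivity), ← ofReal_norm] at this
    exact (ENNReal.ofReal_le_ofReal_iff
      (mul_nonneg (by positivity) (integral_nonneg fun _ => by positivity))).1 this
  have hmain : Hh ≤ C₀ * (2 * L) * S + √Hh * κ := by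
    have h1 : ((Hh : ℝ) : ℂ) = (∑ j ∈ J, ∫ y in N, pairing e E (G j) y ∂m.prod m) +
        ∑ j ∈ J, ∫ y in Nᶜ, pairing e E (G j) y ∂m.prod m := by
      rw [energy_eq he hω hE, ← Finset.sum_add_distrib]
      exact Finset.sum_congr rfl fun j _ =>
        (integral_add_compl hN (pairing_integrable he hω hE (G j))).symm
    calc Hh = ‖((Hh : ℝ) : ℂ)‖ := by rw [Complex.norm_real, Real.norm_of_nonneg hH0]
      _ ≤ ‖∑ j ∈ J, ∫ y in N, pairing e E (G j) y ∂m.prod m‖ +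
          ‖∑ j ∈ J, ∫ y in Nᶜ, pairing e E (G j) y ∂m.prod m‖ := by rw [h1]; exact norm_add_le _ _
      _ ≤ _ := by
        refine add_le_add ?_ (far_le he hω hd hE hM hΦ hB hL)
        refine (norm_sum_le _ _).trans ?_
        simp only [S, mass]
        rw [Finset.mul_sum]
        exact Finset.sum_le_sum hnear
  have hS : S ≤ √ν * √Hh := by
    rw [← Real.sqrt_mul hν0]
    exact Real.le_sqrt_of_sq_le (mass_sq_le he hω hE hν)
  have hr : √Hh ≤ C₀ * (2 * L) * √ν + κ := by
    have hsq : √Hh * √Hh = Hh := Real.mul_self_sqrt hH0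
    rcases (Real.sqrt_nonneg Hh).eq_or_lt with h | h
    · rw [← h]; positivity
    · refine le_of_mul_le_mul_right ?_ h
      have : C₀ * (2 * L) * S ≤ C₀ * (2 * L) * (√ν * √Hh) := by gcongr
      nlinarith
  calc S ≤ √ν * √Hh := hS
    _ ≤ √ν * (C₀ * (2 * L) * √ν + κ) := by gcongr
    _ = _ := by
      have : √ν * √ν = ν := Real.mul_self_sqrt hν0
      linear_combination (C₀ * (2 * L)) * this

end

theorem setLIntegral_le_holder {F : Set ℝ} {f : ℝ → ℝ≥0∞} (hf : Measurable f) {b : ℝ}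
    (hb : b ∈ Ioo (0 : ℝ) 1) :
    ∫⁻ s in F, f s ≤ volume F ^ b * (∫⁻ s, f s ^ (1 - b)⁻¹) ^ (1 - b) := by
  have hpq : Real.HolderConjugate (1 - b)⁻¹ b⁻¹ := by
    rw [Real.holderConjugate_iff]
    refine ⟨(one_lt_inv₀ (by linarith [hb.2])).2 (by linarith [hb.1]), ?_⟩
    simp
  have := ENNReal.lintegral_mul_le_Lp_mul_Lq (volume.restrict F) hpq hf.aemeasurable
    (g := fun _ => 1) aemeasurable_const
  simp only [Pi.mul_apply, mul_one, ENNReal.one_rpow, lintegral_const, one_mul, one_div, inv_inv,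
    Measure.restrict_apply MeasurableSet.univ, univ_inter] at this
  refine this.trans ?_
  rw [mul_comm]
  have h1 : (0 : ℝ) ≤ 1 - b := by linarith [hb.2]
  gcongr
  exact Measure.restrict_le_self

theorem setLIntegral_max_rpow_le {F : Set ℝ} {ω a b c Φ : ℝ} (hω : 0 < ω) (hb : b ∈ Ioo (0 : ℝ) 1)
    (hab : 1 < a + b) (hF : volume F ≤ ENNReal.ofReal Φ) (hΦ : 0 < Φ) :
    ∫⁻ s in F, ENNReal.ofReal ((max ω |s - c|) ^ (-a)) ≤
      ENNReal.ofReal (Φ ^ b * ((2 + 2 / (a / (1 - b) - 1)) ^ (1 - b) * ω ^ (1 - b - a))) := by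
  have h1 : (0 : ℝ) < 1 - b := by linarith [hb.2]
  have hγ : 1 < a / (1 - b) := by rw [lt_div_iff₀ h1]; linarith
  have hγ' : 0 < a / (1 - b) - 1 := by linarith
  have hm : ∀ τ : ℝ, 0 < max ω |τ| := fun τ => lt_max_of_lt_left hω
  refine (setLIntegral_le_holder (by fun_prop) hb).trans ?_
  have e1 : ∀ s : ℝ, ENNReal.ofReal ((max ω |s - c|) ^ (-a)) ^ (1 - b)⁻¹ =
      ENNReal.ofReal ((max ω |s - c|) ^ (-(a / (1 - b)))) := by
    intro s
    rw [ENNReal.ofReal_rpow_of_nonneg (rpow_nonneg (hm _).le _) (by positivity),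
      ← Real.rpow_mul (hm _).le]
    congr 2; rw [div_eq_mul_inv]; ring
  simp_rw [e1]
  rw [lintegral_sub_right_eq_self (fun s => ENNReal.ofReal ((max ω |s|) ^ (-(a / (1 - b))))) c]
  calc _ ≤ ENNReal.ofReal Φ ^ b *
        ENNReal.ofReal ((2 + 2 / (a / (1 - b) - 1)) * ω ^ (1 - a / (1 - b))) ^ (1 - b) := by
        have := hb.1.le
        gcongr
        exact lintegral_max_rpow_le hγ hω
    _ = _ := by
      rw [ENNReal.ofReal_rpow_of_pos hΦ, ENNReal.ofReal_rpow_of_pos (by positivity),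
        ← ENNReal.ofReal_mul (by positivity), Real.mul_rpow (by positivity) (by positivity),
        ← Real.rpow_mul hω.le]
      congr 4
      field_simp

theorem min_le_rpow_mul_rpow {x y a : ℝ} (hx : 0 ≤ x) (hy : 0 ≤ y) (ha0 : 0 ≤ a) (ha1 : a ≤ 1) :
    min x y ≤ x ^ (1 - a) * y ^ a := by
  have hm : 0 ≤ min x y := le_min hx hy
  rcases hm.eq_or_lt with h | h
  · rw [← h]; positivity
  calc min x y = min x y ^ (1 - a) * min x y ^ a := by
        rw [← Real.rpow_add h]; simp
    _ ≤ _ := by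
      have : 0 ≤ 1 - a := by linarith
      gcongr
      · exact min_le_left _ _
      · exact min_le_right _ _

section
variable {H X : Type*} [NormedAddCommGroup H] [InnerProductSpace ℂ H] [CompleteSpace H]
  [MeasurableSpace X] {μ : Measure X} [SFinite μ] {d ω C₀ M Φ : ℝ} {e : ℝ × X → H}
  {E : Set (ℝ × X)} {F : Set ℝ} {ι : Type*} {J : Finset ι} {G : ι → H} {ν : ℝ}

/-- Constant in `mass_le_kinetic`. -/
def kineticConst (d C₀ : ℝ) : ℝ := 2 * C₀ + √(π ^ (2 * d) * (2 + 2 / (2 * d - 1)))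

/-- Constant in `mass_le_mixed`. -/
def mixedConst (d C₀ a b : ℝ) : ℝ :=
  C₀ ^ (1 - a) * π ^ (d * a) * (2 + 2 / (d * a / (1 - b) - 1)) ^ (1 - b)

theorem mass_le_kinetic (he : DispersiveFamily μ d ω C₀ e) (hω : 0 < ω) (hd : 1 < 2 * d)
    (hC : 0 ≤ C₀) (hE : Slab μ E F M Φ) (hM : 0 < M) (hΦ : 0 < Φ)
    (hB : ∀ h, ∑ j ∈ J, ‖⟪G j, h⟫_ℂ‖ ^ 2 ≤ ‖h‖ ^ 2) (hν : ∑ j ∈ J, ‖G j‖ ^ 2 ≤ ν)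
    (hν0 : 0 < ν) :
    mass μ e E J G ≤ kineticConst d C₀ * ν * (M ^ 2 * Φ / ν) ^ (1 / (2 * d + 1)) := by
  set Q := M ^ 2 * Φ / ν with hQ
  have hQ0 : 0 < Q := by positivity
  set L := Q ^ (1 / (2 * d + 1)) with hL
  have hL0 : 0 < L := by positivity
  have h1 := mass_le_near_far he hω hd hC hE hM.le hΦ.le hB hν hL0
  refine h1.trans (le_of_eq ?_)
  have hLL : L ^ (2 * d + 1) = Q := by
    rw [hL, ← Real.rpow_mul hQ0.le, one_div, inv_mul_cancel₀ (by linarith), Real.rpow_one]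
  have h2 : ν * (M * Φ * (M * (π ^ (2 * d) * ((2 + 2 / (2 * d - 1)) * L ^ (1 - 2 * d))))) =
      (π ^ (2 * d) * (2 + 2 / (2 * d - 1))) * (ν * L) ^ 2 := by
    have h3 : M ^ 2 * Φ = ν * L ^ (2 * d + 1) := by rw [hLL, hQ]; field_simp
    have h4 : L ^ (2 * d + 1) * L ^ (1 - 2 * d) = L ^ 2 := by
      rw [← Real.rpow_add hL0, ← Real.rpow_natCast]; congr 1; push_cast; ring
    calc _ = ν * (π ^ (2 * d) * (2 + 2 / (2 * d - 1))) * (M ^ 2 * Φ) * L ^ (1 - 2 * d) := by ring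
      _ = ν ^ 2 * (π ^ (2 * d) * (2 + 2 / (2 * d - 1))) * (L ^ (2 * d + 1) * L ^ (1 - 2 * d)) := by
        rw [h3]; ring
      _ = _ := by rw [h4]; ring
  have hpos : 0 ≤ π ^ (2 * d) * (2 + 2 / (2 * d - 1)) := by
    have : 0 < 2 * d - 1 := by linarith
    positivity
  rw [← Real.sqrt_mul hν0.le, h2, Real.sqrt_mul hpos, Real.sqrt_sq (by positivity), kineticConst]
  ring

theorem mass_le_mixed (he : DispersiveFamily μ d ω C₀ e) (hω : 0 < ω)
    (hC : 0 < C₀) (hE : Slab μ E F M Φ) (hM : 0 < M) (hΦ : 0 < Φ)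
    (hν : ∑ j ∈ J, ‖G j‖ ^ 2 ≤ ν) {a b : ℝ} (ha : 0 < a) (ha1 : a ≤ 1) (hb : b ∈ Ioo (0 : ℝ) 1)
    (hab : 1 < d * a + b) :
    mass μ e E J G ≤ mixedConst d C₀ a b * ν * (M ^ a * Φ ^ b * ω ^ (1 - b - d * a)) := by
  have h1b : (0 : ℝ) < 1 - b := by linarith [hb.2]
  have hγ : 1 < d * a / (1 - b) := by rw [lt_div_iff₀ h1b]; linarith
  have hγ' : 0 < d * a / (1 - b) - 1 := by linarith
  have key := mass_le_schur he hω hE hν (Λ := C₀ ^ (1 - a) * M ^ a * π ^ (d * a) *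
    (Φ ^ b * ((2 + 2 / (d * a / (1 - b) - 1)) ^ (1 - b) * ω ^ (1 - b - d * a)))) (by positivity) ?_
  · refine key.trans (le_of_eq ?_)
    rw [mixedConst]; ring
  intro t
  rw [ENNReal.ofReal_mul (by positivity)]
  calc _ ≤ ∫⁻ s in F, ENNReal.ofReal (C₀ ^ (1 - a) * M ^ a * π ^ (d * a)) *
        ENNReal.ofReal ((max ω |s - t|) ^ (-(d * a))) := by
        refine lintegral_mono fun s => ?_
        have hm : 0 < max ω |s - t| := lt_max_of_lt_left hω
        simp only
        rw [← ENNReal.ofReal_mul (by positivity), ← ENNReal.ofReal_mul (by positivity),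
          ← ENNReal.ofReal_min]
        apply ENNReal.ofReal_le_ofReal
        refine (min_le_rpow_mul_rpow hC.le (by positivity) ha.le ha1).trans (le_of_eq ?_)
        rw [Real.mul_rpow (by positivity) hM.le, ← Real.rpow_mul (by positivity),
          Real.div_rpow pi_pos.le hm.le, Real.rpow_neg hm.le]
        ring
    _ ≤ _ := by
        rw [lintegral_const_mul' _ _ (by simp)]
        gcongr
        exact setLIntegral_max_rpow_le hω hb hab hE.time_le hΦ

/-- The three basic bounds in scale-invariant variables. -/
theorem mass_three_bounds (he : DispersiveFamily μ d ω C₀ e) (hω : 0 < ω) (hd : 1 < 2 * d)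
    (hC : 0 < C₀) (hE : Slab μ E F M Φ) (hM : 0 < M) (hΦ : 0 < Φ)
    (hB : ∀ h, ∑ j ∈ J, ‖⟪G j, h⟫_ℂ‖ ^ 2 ≤ ‖h‖ ^ 2) (hν : ∑ j ∈ J, ‖G j‖ ^ 2 ≤ ν) (hν0 : 0 < ν)
    {a b : ℝ} (ha : 0 < a) (ha1 : a ≤ 1) (hb : b ∈ Ioo (0 : ℝ) 1) (hab : 1 < d * a + b)
    {P R : ℝ} (hP : P = M * ω ^ (-d)) (hR : R = Φ / (ω * ν)) :
    mass μ e E J G ≤ π ^ d * (ω * ν) * (R * P) ∧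
    mass μ e E J G ≤ kineticConst d C₀ * (ω * ν) *
      (R ^ (1 / (2 * d + 1)) * P ^ (2 / (2 * d + 1))) ∧
    mass μ e E J G ≤ mixedConst d C₀ a b * (ω * ν) * (ν ^ b * (R ^ b * P ^ a)) := by
  have hP0 : 0 < P := by rw [hP]; positivity
  have hR0 : 0 < R := by rw [hR]; positivity
  have hMP : M = P * ω ^ d := by
    rw [hP, mul_assoc, ← Real.rpow_add hω]; simp
  have hΦR : Φ = R * (ω * ν) := by rw [hR]; field_simp
  refine ⟨?_, ?_, ?_⟩
  · refine (mass_le_trivial he hω hE hM.le hΦ.le hB).trans (le_of_eq ?_)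
    rw [Real.div_rpow pi_pos.le hω.le, hMP, hΦR]
    field_simp
  · refine (mass_le_kinetic he hω hd hC.le hE hM hΦ hB hν hν0).trans (le_of_eq ?_)
    have h1 : M ^ 2 * Φ / ν = R * P ^ 2 * ω ^ (2 * d + 1) := by
      rw [hMP, hΦR, mul_pow, Real.rpow_add hω, Real.rpow_one, ← Real.rpow_mul_natCast hω.le]
      push_cast
      rw [mul_comm d 2]; field_simp
    have hd1 : 2 * d + 1 ≠ 0 := by linarith
    have h2 : (R * P ^ 2 * ω ^ (2 * d + 1)) ^ (1 / (2 * d + 1)) =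
        R ^ (1 / (2 * d + 1)) * P ^ (2 / (2 * d + 1)) * ω := by
      rw [Real.mul_rpow (by positivity) (by positivity), Real.mul_rpow (by positivity)
        (by positivity), ← Real.rpow_mul hω.le, ← Real.rpow_natCast, ← Real.rpow_mul hP0.le,
        mul_one_div_cancel hd1, Real.rpow_one]
      push_cast
      rw [mul_one_div]
    rw [h1, h2]; ring
  · refine (mass_le_mixed he hω hC hE hM hΦ hν ha ha1 hb hab).trans (le_of_eq ?_)
    have h1 : M ^ a * Φ ^ b * ω ^ (1 - b - d * a) = ω * (ν ^ b * (R ^ b * P ^ a)) := by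
      rw [hMP, hΦR, Real.mul_rpow hP0.le (by positivity), Real.mul_rpow hR0.le (by positivity),
        Real.mul_rpow hω.le hν0.le, ← Real.rpow_mul hω.le]
      have : ω ^ (d * a) * ω ^ b * ω ^ (1 - b - d * a) = ω := by
        rw [← Real.rpow_add hω, ← Real.rpow_add hω]
        convert Real.rpow_one ω using 2; ring
      linear_combination (P ^ a * R ^ b * ν ^ b) * this
    rw [h1]; ring

end

/-- The triangle spanned by the exponents of the three basic bounds contains a neighbourhood
of the target exponent. -/
theorem exists_barycentric {D β κ δ : ℝ} (hD : 2 ≤ D) (hβ : β ∈ Ioo (0 : ℝ) 1)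
    (hκ : κ ∈ Ioo (0 : ℝ) 1) (h1 : 2 < 2 * β + D * κ) (h2 : 1 + (D - 1) * β < D * κ)
    (hδ : 0 < δ) :
    ∃ b ∈ Ioo (0 : ℝ) 1, b ≤ δ ∧ ∃ a : ℝ, 0 < a ∧ a ≤ 1 ∧ 1 < D / 2 * a + b ∧
      ∃ ε > 0, ∀ d₁ d₂ : ℝ, |d₁| ≤ ε → |d₂| ≤ ε → ∃ u v w : ℝ, 0 ≤ u ∧ 0 ≤ v ∧ 0 ≤ w ∧
        u + v + w = 1 ∧ β + d₁ = u + v * (1 / (D + 1)) + w * b ∧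
        κ + d₂ = u + v * (2 / (D + 1)) + w * a := by
  obtain ⟨hβ0, hβ1⟩ := hβ
  obtain ⟨hκ0, hκ1⟩ := hκ
  set b : ℝ := min δ (β / 2) with hb
  have hb0 : 0 < b := lt_min hδ (by linarith)
  have hbβ : b < β := (min_le_right _ _).trans_lt (by linarith)
  set t : ℝ := (b + D / 2 - 1) / (β + D / 2 - 1) with ht
  have hden : 0 < β + D / 2 - 1 := by linarith
  have ht0 : 0 < t := div_pos (by linarith) hden
  have ht1 : t < 1 := (div_lt_one hden).2 (by linarith)
  have hbt : b = 1 - D / 2 + t * (β - (1 - D / 2)) := by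
    have h : t * (β + D / 2 - 1) = b + D / 2 - 1 := by rw [ht, div_mul_cancel₀ _ hden.ne']
    linarith
  set a : ℝ := 1 + t * (κ - 1) with ha
  have ha0 : 0 < a := by nlinarith
  have ha1 : a < 1 := by nlinarith
  clear_value b t a
  have hab : 1 < D / 2 * a + b := by
    rw [hbt, ha]; nlinarith [mul_pos ht0 (sub_pos.2 h1)]
  have hX : 0 < D * a - 1 - (D - 1) * b := by
    rw [hbt, ha]
    nlinarith [mul_pos ht0 (sub_pos.2 h2),
      mul_pos (sub_pos.2 ht1) (show 0 < (D - 1) * D by nlinarith)]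
  have wX : 0 < D * κ - 1 - (D - 1) * β := by linarith
  have wA : 0 < (1 - κ) * (1 - b) - (1 - β) * (1 - a) := by
    have : (1 - κ) * (1 - b) - (1 - β) * (1 - a) = (1 - t) * (1 - κ) * (D / 2) := by
      rw [hbt, ha]; ring
    rw [this]
    exact mul_pos (mul_pos (by linarith) (by linarith)) (by linarith)
  have wO : 0 < (D * a - 1 - (D - 1) * b) - (D * κ - 1 - (D - 1) * β) -
      (D + 1) * ((1 - κ) * (1 - b) - (1 - β) * (1 - a)) := by
    have : (D * a - 1 - (D - 1) * b) - (D * κ - 1 - (D - 1) * β) -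
      (D + 1) * ((1 - κ) * (1 - b) - (1 - β) * (1 - a)) =
        (1 - t) * (D - 1) * (β + D * κ / 2 - 1) := by
      rw [hbt, ha]; ring
    rw [this]
    exact mul_pos (mul_pos (by linarith) (by linarith)) (by linarith)
  refine ⟨b, ⟨hb0, hbβ.trans hβ1⟩, hb ▸ min_le_left _ _, a, ha0, ha1.le, hab, ?_⟩
  set X := D * κ - 1 - (D - 1) * β with hXd
  set A := (1 - κ) * (1 - b) - (1 - β) * (1 - a) with hAd
  set Δ := D * a - 1 - (D - 1) * b with hΔ
  set O := Δ - X - (D + 1) * A with hO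
  have hD1 : 0 < D + 1 := by linarith
  have hb1 : b < 1 := hbβ.trans hβ1
  refine ⟨min X (min A O) / (4 * (D + 1)), by positivity, fun d₁ d₂ h₁ h₂ => ?_⟩
  rw [le_div_iff₀ (by positivity)] at h₁ h₂
  have m1 : min X (min A O) ≤ X := min_le_left _ _
  have m2 : min X (min A O) ≤ A := (min_le_right _ _).trans (min_le_left _ _)
  have m3 : min X (min A O) ≤ O := (min_le_right _ _).trans (min_le_right _ _)
  set m := min X (min A O)
  have hm : 0 < m := by positivity
  clear_value m
  clear hbt ha ht hden h1 h2 hb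
  have e1 : |D * d₂ - (D - 1) * d₁| ≤ m / 2 := by
    have : |D * d₂ - (D - 1) * d₁| ≤ D * |d₂| + (D - 1) * |d₁| := by
      refine (abs_sub _ _).trans (le_of_eq ?_)
      rw [abs_mul, abs_mul, abs_of_pos (by linarith : 0 < D), abs_of_pos (by linarith : 0 < D - 1)]
    have h3 : D * |d₂| ≤ (D + 1) * |d₂| := by gcongr; linarith
    have h4 : (D - 1) * |d₁| ≤ (D + 1) * |d₁| := by gcongr; linarith
    linarith
  have e2 : (D + 1) * |d₁ * (1 - a) - d₂ * (1 - b)| ≤ m / 2 := by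
    have : |d₁ * (1 - a) - d₂ * (1 - b)| ≤ |d₁| * (1 - a) + |d₂| * (1 - b) := by
      refine (abs_sub _ _).trans (le_of_eq ?_)
      rw [abs_mul, abs_mul, abs_of_pos (by linarith : 0 < 1 - a),
        abs_of_pos (by linarith : 0 < 1 - b)]
    have h3 : |d₁| * (1 - a) ≤ |d₁| := mul_le_of_le_one_right (abs_nonneg _) (by linarith)
    have h4 : |d₂| * (1 - b) ≤ |d₂| := mul_le_of_le_one_right (abs_nonneg _) (by linarith)
    calc (D + 1) * |d₁ * (1 - a) - d₂ * (1 - b)| ≤ (D + 1) * (|d₁| + |d₂|) := by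
          gcongr; linarith
      _ ≤ m / 2 := by linarith
  have e3 : |d₁ * (1 - a) - d₂ * (1 - b)| ≤ m / 2 := by
    refine le_trans (le_mul_of_one_le_left (abs_nonneg _) (by linarith)) e2
  rw [abs_le] at e1 e3
  rw [← abs_of_pos hD1, ← abs_mul, abs_le] at e2
  refine ⟨(O - (D * d₂ - (D - 1) * d₁) - (D + 1) * (d₁ * (1 - a) - d₂ * (1 - b))) / Δ,
    (D + 1) * (A + (d₁ * (1 - a) - d₂ * (1 - b))) / Δ,
    (X + (D * d₂ - (D - 1) * d₁)) / Δ, div_nonneg ?_ hX.le, div_nonneg ?_ hX.le,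
    div_nonneg ?_ hX.le, ?_, ?_, ?_⟩
  · linarith [e1.2, e2.2]
  · exact mul_nonneg hD1.le (by linarith [e3.1])
  · linarith [e1.1]
  · have := hX.ne'
    field_simp
    rw [hO]; ring
  · have := hX.ne'
    field_simp
    rw [hO, hXd, hAd, hΔ]; ring
  · have := hX.ne'
    field_simp
    rw [hO, hXd, hAd, hΔ]; ring

/-- Geometric decay away from `1`: `decay ε x = min (x ^ ε) (x ^ (-ε))`. -/
def decay (ε x : ℝ) : ℝ := rexp (-(ε * |Real.log x|))

theorem exists_rpow_eq_mul_decay {ε x : ℝ} (hε : 0 ≤ ε) (hx : 0 < x) (β : ℝ) :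
    ∃ d, |d| ≤ ε ∧ x ^ (β + d) = x ^ β * decay ε x := by
  rcases le_total 0 (Real.log x) with h | h
  · refine ⟨-ε, by rw [abs_neg, abs_of_nonneg hε], ?_⟩
    rw [Real.rpow_add hx, decay, abs_of_nonneg h, Real.rpow_def_of_pos hx (-ε)]
    congr 2; ring
  · refine ⟨ε, by rw [abs_of_nonneg hε], ?_⟩
    rw [Real.rpow_add hx, decay, abs_of_nonpos h, Real.rpow_def_of_pos hx ε]
    congr 2; ring

theorem le_rpow_mul_rpow_mul_rpow {m x y z u v w : ℝ} (hm : 0 ≤ m) (hx : m ≤ x) (hy : m ≤ y)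
    (hz : m ≤ z) (hu : 0 ≤ u) (hv : 0 ≤ v) (hw : 0 ≤ w) (h : u + v + w = 1) :
    m ≤ x ^ u * y ^ v * z ^ w := by
  calc m = m ^ (u + v + w) := by rw [h, Real.rpow_one]
    _ = m ^ u * m ^ v * m ^ w := by
        rw [Real.rpow_add_of_nonneg hm (by positivity) hw, Real.rpow_add_of_nonneg hm hu hv]
    _ ≤ _ := by
        have := hm.trans hx
        have := hm.trans hy
        gcongr

theorem interp_rpow {S R P N r₁ p₁ r₂ p₂ b u v w : ℝ} (hS : 0 < S) (hR : 0 < R) (hP : 0 < P)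
    (hN : 0 < N) (hs : u + v + w = 1) :
    (S * (R * P)) ^ u * (S * (R ^ r₁ * P ^ p₁)) ^ v * (S * (N ^ b * (R ^ r₂ * P ^ p₂))) ^ w =
      S * N ^ (b * w) * (R ^ (u + v * r₁ + w * r₂) * P ^ (u + v * p₁ + w * p₂)) := by
  have hS' : S = S ^ u * S ^ v * S ^ w := by
    rw [← Real.rpow_add hS, ← Real.rpow_add hS, hs, Real.rpow_one]
  rw [Real.mul_rpow hS.le (by positivity), Real.mul_rpow hS.le (by positivity),
    Real.mul_rpow hS.le (by positivity), Real.mul_rpow hR.le hP.le,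
    Real.mul_rpow (by positivity) (by positivity), Real.mul_rpow (by positivity) (by positivity),
    Real.mul_rpow (by positivity) (by positivity), ← Real.rpow_mul hR.le, ← Real.rpow_mul hP.le,
    ← Real.rpow_mul hR.le, ← Real.rpow_mul hP.le, ← Real.rpow_mul hN.le, Real.rpow_add hR,
    Real.rpow_add hR, Real.rpow_add hP, Real.rpow_add hP]
  conv_rhs => rw [hS']
  ring_nf

theorem exists_mass_le_decay (H X ι : Type*) [NormedAddCommGroup H] [InnerProductSpace ℂ H]
    [CompleteSpace H] [MeasurableSpace X] (μ : Measure X) [SFinite μ] {d β κ δ C₀ : ℝ}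
    (hd : 1 ≤ d) (hC : 0 < C₀) (hβ : β ∈ Ioo (0 : ℝ) 1)
    (hκ : κ ∈ Ioo (0 : ℝ) 1) (h1 : 1 < β + d * κ) (h2 : 1 + (2 * d - 1) * β < 2 * d * κ)
    (hδ : 0 < δ) :
    ∃ K > 0, ∃ ε > 0, ∀ (ω M Φ ν N : ℝ) (e : ℝ × X → H) (E : Set (ℝ × X)) (F : Set ℝ)
      (J : Finset ι) (G : ι → H), DispersiveFamily μ d ω C₀ e → 0 < ω → Slab μ E F M Φ → 0 < M →
      0 < Φ → (∀ h, ∑ j ∈ J, ‖⟪G j, h⟫_ℂ‖ ^ 2 ≤ ‖h‖ ^ 2) → ∑ j ∈ J, ‖G j‖ ^ 2 ≤ ν → 0 < ν →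
      ν ≤ N → 1 ≤ N →
      mass μ e E J G ≤ K * N ^ δ * (ω * ν) * ((Φ / (ω * ν)) ^ β * (M * ω ^ (-d)) ^ κ) *
        (decay ε (Φ / (ω * ν)) * decay ε (M * ω ^ (-d))) := by
  obtain ⟨b, hb, hbδ, a, ha0, ha1, hab, ε, hε, hT⟩ := exists_barycentric (D := 2 * d) (by linarith)
    hβ hκ (by linarith) h2 hδ
  set K := max (π ^ d) (max (kineticConst d C₀) (mixedConst d C₀ a b)) with hK
  have hK0 : 0 < K := lt_max_of_lt_left (by positivity)
  refine ⟨K, hK0, ε, hε, fun ω M Φ ν N e E F J G he hω hE hM hΦ hB hν hν0 hνN hN => ?_⟩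
  obtain ⟨b1, b2, b3⟩ := mass_three_bounds he hω (by linarith) hC hE hM hΦ hB hν hν0 ha0 ha1 hb
    (by linarith) rfl rfl
  set R := Φ / (ω * ν)
  set P := M * ω ^ (-d)
  have hR : 0 < R := by positivity
  have hP : 0 < P := by positivity
  obtain ⟨d₁, hd₁, hR'⟩ := exists_rpow_eq_mul_decay hε.le hR β
  obtain ⟨d₂, hd₂, hP'⟩ := exists_rpow_eq_mul_decay hε.le hP κ
  obtain ⟨u, v, w, hu, hv, hw, hs, e1, e2⟩ := hT d₁ d₂ hd₁ hd₂
  have c1 : mass μ e E J G ≤ K * (ω * ν) * (R * P) :=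
    b1.trans (by gcongr; exact le_max_left _ _)
  have c2 : mass μ e E J G ≤ K * (ω * ν) *
      (R ^ (1 / (2 * d + 1)) * P ^ (2 / (2 * d + 1))) :=
    b2.trans (by gcongr; exact (le_max_left _ _).trans (le_max_right _ _))
  have c3 : mass μ e E J G ≤ K * (ω * ν) * (N ^ b * (R ^ b * P ^ a)) :=
    b3.trans (by
      have := hb.1
      gcongr; exact (le_max_right _ _).trans (le_max_right _ _))
  refine (le_rpow_mul_rpow_mul_rpow (mass_nonneg) c1 c2 c3 hu hv hw hs).trans ?_
  have hKω : 0 < K * (ω * ν) := by positivity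
  have hN0 : 0 < N := by linarith
  rw [interp_rpow hKω hR hP hN0 hs, ← e1, ← e2, hR', hP']
  calc _ = K * N ^ (b * w) * (ω * ν) * (R ^ β * P ^ κ) * (decay ε R * decay ε P) := by ring
    _ ≤ _ := by
        have h : N ^ (b * w) ≤ N ^ δ := by
          refine Real.rpow_le_rpow_of_exponent_le hN ?_
          nlinarith [hb.1]
        unfold decay
        gcongr

variable {n : ℕ}

theorem dotC_eq_inner (x ξ : Rn n) : dotC x ξ = ((⟪x, ξ⟫_ℝ : ℝ) : ℂ) := by
  simp [dotC, PiLp.inner_apply, mul_comm]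

theorem integrable_gaussian {ω : ℝ} (hω : 0 < ω) :
    Integrable fun ξ : Rn n => rexp (-ω * ‖ξ‖ ^ 2) := by
  have := (GaussianFourier.integrable_cexp_neg_mul_sq_norm_add (V := Rn n) (b := (ω : ℂ))
    (by simpa using hω) 0 0).norm
  simpa [Complex.norm_exp, ← Complex.ofReal_pow] using this

/-- The phase `e^{i(x·ξ - t|ξ|²)}`. -/
def phase (z : ℝ × Rn n) (ξ : Rn n) : ℂ :=
  Complex.exp (Complex.I * (dotC z.2 ξ - (z.1 : ℂ) * ((‖ξ‖ : ℝ) : ℂ) ^ 2))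

theorem norm_phase (z : ℝ × Rn n) (ξ : Rn n) : ‖phase z ξ‖ = 1 := by
  have : Complex.I * (dotC z.2 ξ - (z.1 : ℂ) * ((‖ξ‖ : ℝ) : ℂ) ^ 2) =
      ((⟪z.2, ξ⟫_ℝ - z.1 * ‖ξ‖ ^ 2 : ℝ) : ℂ) * Complex.I := by
    rw [dotC_eq_inner]; push_cast; ring
  rw [phase, this, Complex.norm_exp_ofReal_mul_I]

theorem continuous_phase : Continuous fun y : (ℝ × Rn n) × Rn n => phase y.1 y.2 := by
  simp only [phase, dotC_eq_inner]
  fun_prop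

/-- The Gaussian-damped conjugate plane wave as a function. -/
def waveFun (ω : ℝ) (z : ℝ × Rn n) (ξ : Rn n) : ℂ :=
  (starRingEnd ℂ) (phase z ξ) * ((rexp (-(ω / 2) * ‖ξ‖ ^ 2) : ℝ) : ℂ)

theorem norm_waveFun (ω : ℝ) (z : ℝ × Rn n) (ξ : Rn n) :
    ‖waveFun ω z ξ‖ = rexp (-(ω / 2) * ‖ξ‖ ^ 2) := by
  rw [waveFun, norm_mul, RCLike.norm_conj, norm_phase, one_mul, Complex.norm_real,
    Real.norm_of_nonneg (Real.exp_nonneg _)]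

theorem continuous_waveFun (ω : ℝ) (z : ℝ × Rn n) : Continuous (waveFun ω z) := by
  have : Continuous fun ξ => phase z ξ := continuous_phase.comp (Continuous.prodMk_right z)
  unfold waveFun
  fun_prop

theorem memLp_waveFun {ω : ℝ} (hω : 0 < ω) (z : ℝ × Rn n) :
    MemLp (waveFun ω z) 2 (volume : Measure (Rn n)) := by
  rw [memLp_two_iff_integrable_sq_norm (continuous_waveFun ω z).aestronglyMeasurable]
  refine (integrable_gaussian (n := n) hω).congr (Filter.Eventually.of_forall fun ξ => ?_)
  simp only [norm_waveFun]
  rw [← Real.exp_nat_mul]; congr 1; push_cast; ring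

open Classical in
/-- The Gaussian-damped conjugate plane waves as elements of `L²`. -/
def wave (ω : ℝ) (z : ℝ × Rn n) : Lp ℂ 2 (volume : Measure (Rn n)) :=
  if h : 0 < ω then (memLp_waveFun h z).toLp _ else 0

theorem coeFn_wave {ω : ℝ} (hω : 0 < ω) (z : ℝ × Rn n) : wave ω z =ᵐ[volume] waveFun ω z := by
  rw [wave, dif_pos hω]; exact MemLp.coeFn_toLp _

/-- The Gram kernel of the damped plane waves. -/
def gramKer (n : ℕ) (ω τ r : ℝ) : ℂ :=
  (π / (ω + τ * Complex.I)) ^ ((n / 2 : ℝ) : ℂ) *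
    Complex.exp (-(r : ℂ) ^ 2 / (4 * (ω + τ * Complex.I)))

theorem inner_wave {ω : ℝ} (hω : 0 < ω) (z z' : ℝ × Rn n) :
    ⟪wave ω z, wave ω z'⟫_ℂ = gramKer n ω (z.1 - z'.1) ‖z.2 - z'.2‖ := by
  have hb : 0 < ((ω : ℂ) + ((z.1 - z'.1 : ℝ) : ℂ) * Complex.I).re := by simpa using hω
  have := GaussianFourier.integral_cexp_neg_mul_sq_norm_add (V := Rn n) hb Complex.I (z.2 - z'.2)
  rw [L2.inner_def]
  calc _ = ∫ v : Rn n, Complex.exp (-((ω : ℂ) + ((z.1 - z'.1 : ℝ) : ℂ) * Complex.I) * ‖v‖ ^ 2 +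
          Complex.I * ⟪z.2 - z'.2, v⟫_ℝ) := by
        refine integral_congr_ae ?_
        filter_upwards [coeFn_wave hω z, coeFn_wave hω z'] with ξ h h'
        rw [h, h', RCLike.inner_apply, waveFun, waveFun, map_mul, Complex.conj_conj,
          Complex.conj_ofReal, Complex.ofReal_exp, phase, phase, ← Complex.exp_conj,
          ← Complex.exp_add, ← Complex.exp_add, ← Complex.exp_add]
        congr 1
        simp only [dotC_eq_inner, map_mul, map_sub, Complex.conj_I, Complex.conj_ofReal, map_pow,
          inner_sub_left]
        push_cast
        ring
    _ = _ := by
        rw [this, gramKer]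
        congr 2
        · simp
        · rw [Complex.I_sq]; ring

theorem continuous_gramKer {ω : ℝ} (hω : 0 < ω) :
    Continuous fun y : ℝ × ℝ => gramKer n ω y.1 y.2 := by
  have hre : ∀ τ : ℝ, 0 < ((ω : ℂ) + (τ : ℂ) * Complex.I).re := fun τ => by simpa using hω
  have hne : ∀ τ : ℝ, ((ω : ℂ) + (τ : ℂ) * Complex.I) ≠ 0 := fun τ h => by
    have := hre τ; rw [h] at this; simp at this
  unfold gramKer
  refine Continuous.mul (Continuous.cpow ?_ continuous_const ?_) (Complex.continuous_exp.comp ?_)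
  · exact continuous_const.div (by fun_prop) fun y => hne _
  · intro y
    left
    rw [Complex.div_re]
    have := hre y.1
    have h2 : 0 < Complex.normSq (ω + y.1 * Complex.I) := Complex.normSq_pos.2 (hne _)
    simp only [Complex.ofReal_re, Complex.ofReal_im, zero_mul, zero_div, add_zero]
    positivity
  · exact Continuous.div (by fun_prop) (by fun_prop) fun y => mul_ne_zero (by norm_num) (hne _)

theorem continuous_wave {ω : ℝ} (hω : 0 < ω) : Continuous (wave (n := n) ω) := by
  have hK : Continuous fun y : (ℝ × Rn n) × (ℝ × Rn n) => ⟪wave ω y.1, wave ω y.2⟫_ℂ := by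
    simp only [inner_wave hω]
    exact (continuous_gramKer (n := n) hω).comp
      (f := fun y : (ℝ × Rn n) × (ℝ × Rn n) => (y.1.1 - y.2.1, ‖y.1.2 - y.2.2‖)) (by fun_prop)
  rw [continuous_iff_continuousAt]
  intro z
  rw [ContinuousAt, tendsto_iff_norm_sub_tendsto_zero]
  have h1 : ∀ y, √ (RCLike.re (⟪wave ω y, wave ω y⟫_ℂ) -
      2 * RCLike.re (⟪wave ω y, wave ω z⟫_ℂ) + RCLike.re (⟪wave ω z, wave ω z⟫_ℂ)) =
        ‖wave ω y - wave ω z‖ := fun y => by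
    rw [inner_self_eq_norm_sq, inner_self_eq_norm_sq, ← @norm_sub_sq ℂ,
      Real.sqrt_sq (norm_nonneg _)]
  simp only [← h1]
  have c1 : Continuous fun y : ℝ × Rn n => ⟪wave ω y, wave ω y⟫_ℂ :=
    hK.comp (f := fun y : ℝ × Rn n => (y, y)) (by fun_prop)
  have c2 : Continuous fun y : ℝ × Rn n => ⟪wave ω y, wave ω z⟫_ℂ :=
    hK.comp (f := fun y : ℝ × Rn n => (y, z)) (by fun_prop)
  have c3 : Continuous fun y : ℝ × Rn n => √ (RCLike.re (⟪wave ω y, wave ω y⟫_ℂ) -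
      2 * RCLike.re (⟪wave ω y, wave ω z⟫_ℂ) + RCLike.re (⟪wave ω z, wave ω z⟫_ℂ)) :=
    (((RCLike.continuous_re.comp c1).sub (continuous_const.mul (RCLike.continuous_re.comp c2))).add
      continuous_const).sqrt
  have := c3.tendsto z
  rwa [h1, sub_self, norm_zero] at this

theorem norm_gramKer_le {ω : ℝ} (hω : 0 < ω) (τ r : ℝ) :
    ‖gramKer n ω τ r‖ ≤ (π / max ω |τ|) ^ (n / 2 : ℝ) := by
  have hre : ((ω : ℂ) + (τ : ℂ) * Complex.I).re = ω := by simp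
  have him : ((ω : ℂ) + (τ : ℂ) * Complex.I).im = τ := by simp
  rw [gramKer, norm_mul, Complex.norm_cpow_real, norm_div, Complex.norm_real,
    Real.norm_of_nonneg pi_pos.le]
  have hmax : max ω |τ| ≤ ‖(ω : ℂ) + (τ : ℂ) * Complex.I‖ := by
    refine max_le ?_ ?_
    · have := Complex.re_le_norm ((ω : ℂ) + (τ : ℂ) * Complex.I); rwa [hre] at this
    · have := Complex.abs_im_le_norm ((ω : ℂ) + (τ : ℂ) * Complex.I); rwa [him] at this
  have hm : 0 < max ω |τ| := lt_max_of_lt_left hω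
  have hexp : ‖Complex.exp (-(r : ℂ) ^ 2 / (4 * (ω + τ * Complex.I)))‖ ≤ 1 := by
    rw [Complex.norm_exp, Real.exp_le_one_iff]
    have : -(r : ℂ) ^ 2 / (4 * (ω + τ * Complex.I)) =
        ((-r ^ 2 / 4 : ℝ) : ℂ) * (ω + τ * Complex.I)⁻¹ := by
      push_cast
      rw [div_eq_mul_inv, mul_inv]; ring
    rw [this, Complex.re_ofReal_mul, Complex.inv_re, hre]
    exact mul_nonpos_of_nonpos_of_nonneg (by nlinarith [sq_nonneg r])
      (div_nonneg hω.le (Complex.normSq_nonneg _))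
  calc _ ≤ (π / ‖(ω : ℂ) + (τ : ℂ) * Complex.I‖) ^ (n / 2 : ℝ) * 1 := by gcongr
    _ ≤ _ := by rw [mul_one]; gcongr

theorem norm_gramKer_zero {ω : ℝ} (hω : 0 < ω) (r : ℝ) :
    ‖gramKer n ω 0 r‖ = (π / ω) ^ (n / 2 : ℝ) * rexp (-(1 / (4 * ω)) * r ^ 2) := by
  rw [gramKer, norm_mul, Complex.norm_cpow_real, norm_div, Complex.norm_real,
    Real.norm_of_nonneg pi_pos.le]
  simp only [Complex.ofReal_zero, zero_mul, add_zero, Complex.norm_real, Real.norm_of_nonneg hω.le,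
    Complex.norm_exp]
  congr 2
  have : -(r : ℂ) ^ 2 / (4 * ω) = ((-(1 / (4 * ω)) * r ^ 2 : ℝ) : ℂ) := by
    push_cast; ring
  rw [this, Complex.ofReal_re]

theorem lintegral_gramKer {ω : ℝ} (hω : 0 < ω) (x : Rn n) :
    ∫⁻ y : Rn n, ‖gramKer n ω 0 ‖x - y‖‖ₑ = ENNReal.ofReal ((2 * π) ^ n) := by
  rw [lintegral_sub_left_eq_self (fun y : Rn n => ‖gramKer n ω 0 ‖y‖‖ₑ) x]
  have hb : 0 < 1 / (4 * ω) := by positivity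
  simp only [← ofReal_norm, norm_gramKer_zero hω]
  rw [← ofReal_integral_eq_lintegral_ofReal ((integrable_gaussian hb).const_mul _)
    (Filter.Eventually.of_forall fun y => by positivity), integral_const_mul,
    GaussianFourier.integral_rexp_neg_mul_sq_norm hb, finrank_euclideanSpace, Fintype.card_fin,
    ← Real.mul_rpow (by positivity) (by positivity)]
  congr 1
  have : π / ω * (π / (1 / (4 * ω))) = (2 * π) ^ (2 : ℝ) := by
    rw [Real.rpow_two]; field_simp; ring
  rw [this, ← Real.rpow_mul (by positivity), mul_div_cancel₀ _ two_ne_zero, Real.rpow_natCast]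

theorem lintegral_mul_mul_kernel_le {Y : Type*} [MeasurableSpace Y] {μ : Measure Y} [SFinite μ]
    {f : Y → ℝ≥0∞} {k : Y → Y → ℝ≥0∞} (hf : AEMeasurable f μ)
    (hk : Measurable (Function.uncurry k)) {C : ℝ≥0∞} (hC : ∀ x, ∫⁻ y, k x y ∂μ = C)
    (hs : ∀ x y, k x y = k y x) :
    ∫⁻ x, f x * ∫⁻ y, f y * k x y ∂μ ∂μ ≤ C * ∫⁻ x, f x ^ 2 ∂μ := by
  wlog hfm : Measurable f generalizing f
  · have h := hf.ae_eq_mk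
    have e1 : ∀ x, ∫⁻ y, f y * k x y ∂μ = ∫⁻ y, hf.mk f y * k x y ∂μ := fun x =>
      lintegral_congr_ae (h.mono fun y hy => by simp only [hy])
    simp only [e1]
    have e2 : ∫⁻ x, f x * ∫⁻ y, hf.mk f y * k x y ∂μ ∂μ =
        ∫⁻ x, hf.mk f x * ∫⁻ y, hf.mk f y * k x y ∂μ ∂μ :=
      lintegral_congr_ae (h.mono fun y hy => by simp only [hy])
    have e3 : ∫⁻ x, f x ^ 2 ∂μ = ∫⁻ x, hf.mk f x ^ 2 ∂μ :=
      lintegral_congr_ae (h.mono fun y hy => by simp only [hy])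
    rw [e2, e3]
    exact this hf.measurable_mk.aemeasurable hf.measurable_mk
  have hkx : ∀ x, Measurable (k x) := fun x => hk.comp measurable_prodMk_left
  have e2 : ∫⁻ x, ∫⁻ y, f x ^ 2 * k x y ∂μ ∂μ = C * ∫⁻ x, f x ^ 2 ∂μ := by
    simp only [lintegral_const_mul _ (hkx _), hC]
    rw [lintegral_mul_const _ (hfm.pow_const 2), mul_comm]
  have m1 : Measurable fun y : Y × Y => f y.1 ^ 2 * k y.1 y.2 :=
    ((hfm.comp measurable_fst).pow_const 2).mul hk
  have e3 : ∫⁻ x, ∫⁻ y, f y ^ 2 * k x y ∂μ ∂μ = C * ∫⁻ x, f x ^ 2 ∂μ := by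
    rw [← e2, lintegral_lintegral_swap (f := fun x y => f x ^ 2 * k x y) m1.aemeasurable]
    simp only [hs]
  have h2 : 2 * ∫⁻ x, f x * ∫⁻ y, f y * k x y ∂μ ∂μ ≤ 2 * (C * ∫⁻ x, f x ^ 2 ∂μ) := by
    calc _ = ∫⁻ x, ∫⁻ y, 2 * (f x * f y) * k x y ∂μ ∂μ := by
          rw [← lintegral_const_mul' _ _ (by simp)]
          refine lintegral_congr fun x => ?_
          have m2 : Measurable fun y => f y * k x y := hfm.mul (hkx x)
          rw [← lintegral_const_mul _ m2, ← lintegral_const_mul _ (m2.const_mul _)]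
          exact lintegral_congr fun y => by ring
      _ ≤ ∫⁻ x, ∫⁻ y, (f x ^ 2 * k x y + f y ^ 2 * k x y) ∂μ ∂μ := by
          refine lintegral_mono fun x => lintegral_mono fun y => ?_
          rw [← add_mul]
          gcongr
          exact ennreal_two_mul_le _ _
      _ = C * ∫⁻ x, f x ^ 2 ∂μ + C * ∫⁻ x, f x ^ 2 ∂μ := by
          nth_rewrite 1 [← e2]
          rw [← e3, ← lintegral_add_left (Measurable.lintegral_prod_right' m1)]
          refine lintegral_congr fun x => ?_
          rw [lintegral_add_left ((hkx x).const_mul _)]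
      _ = _ := by ring
  exact (ENNReal.mul_le_mul_iff_right (by simp) (by simp)).1 h2

theorem dispersiveFamily_wave {ω : ℝ} (hω : 0 < ω) :
    DispersiveFamily (volume : Measure (Rn n)) (n / 2 : ℝ) ω ((2 * π) ^ n) (wave ω) where
  meas := (continuous_wave hω).stronglyMeasurable
  gram_le z z' := by rw [inner_wave hω]; exact norm_gramKer_le hω _ _
  bessel t φ hφ := by
    have hc : Continuous fun x : Rn n => wave ω (t, x) :=
      (continuous_wave hω).comp (Continuous.prodMk_right t)
    have hb : ∀ x : Rn n, ‖wave ω (t, x)‖ ≤ √((π / ω) ^ (n / 2 : ℝ)) := fun x => by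
      refine Real.le_sqrt_of_sq_le ?_
      rw [← @inner_self_eq_norm_sq ℂ, inner_wave hω, sub_self]
      refine (RCLike.re_le_norm _).trans ((norm_gramKer_le hω _ _).trans (le_of_eq ?_))
      simp [hω.le]
    have hi : Integrable fun x => φ x • wave ω (t, x) := by
      refine (hφ.norm.mul_const (√((π / ω) ^ (n / 2 : ℝ)))).mono'
        (hφ.aestronglyMeasurable.smul hc.aestronglyMeasurable)
        (Filter.Eventually.of_forall fun x => ?_)
      rw [norm_smul]
      gcongr
      exact hb x
    set Ψ := ∫ x, φ x • wave ω (t, x) with hΨ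
    have h1 : ∀ x, ‖⟪Ψ, wave ω (t, x)⟫_ℂ‖ₑ ≤ ∫⁻ y, ‖φ y‖ₑ * ‖gramKer n ω 0 ‖x - y‖‖ₑ := fun x => by
      rw [← ofReal_norm, norm_inner_symm, ofReal_norm, hΨ, ← integral_inner hi]
      refine (enorm_integral_le_lintegral_enorm _).trans (le_of_eq (lintegral_congr fun y => ?_))
      rw [inner_smul_right, enorm_mul, inner_wave hω, sub_self]
    calc ‖Ψ‖ₑ ^ 2 = ‖⟪Ψ, Ψ⟫_ℂ‖ₑ := by
          rw [inner_self_eq_norm_sq_to_K, enorm_pow]; congr 1; simp [enorm_eq_nnnorm]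
      _ = ‖∫ x, φ x * ⟪Ψ, wave ω (t, x)⟫_ℂ‖ₑ := by
          have := integral_inner (𝕜 := ℂ) hi Ψ
          simp only [inner_smul_right] at this
          rw [this]
      _ ≤ ∫⁻ x, ‖φ x‖ₑ * ‖⟪Ψ, wave ω (t, x)⟫_ℂ‖ₑ := by
          refine (enorm_integral_le_lintegral_enorm _).trans
            (le_of_eq (lintegral_congr fun y => ?_))
          rw [enorm_mul]
      _ ≤ ∫⁻ x, ‖φ x‖ₑ * ∫⁻ y, ‖φ y‖ₑ * ‖gramKer n ω 0 ‖x - y‖‖ₑ := by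
          gcongr with x; exact h1 x
      _ ≤ _ := by
          refine lintegral_mul_mul_kernel_le hφ.aestronglyMeasurable.enorm ?_
            (lintegral_gramKer hω) (fun x y => by rw [norm_sub_rev])
          exact ((continuous_gramKer (n := n) hω).comp
            (f := fun y : Rn n × Rn n => ((0 : ℝ), ‖y.1 - y.2‖)) (by fun_prop)).measurable.enorm

theorem tsum_mul_rpow_le {ι : Type*} {q : ℝ} (hq : 1 ≤ q) (w f : ι → ℝ≥0∞) :
    (∑' i, w i * f i) ^ q ≤ (∑' i, w i) ^ (q - 1) * ∑' i, w i * f i ^ q := by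
  have hq0 : 0 < q := by linarith
  have h : ∑' i, w i * f i ≤ (∑' i, w i) ^ (1 - q⁻¹) * (∑' i, w i * f i ^ q) ^ q⁻¹ := by
    rw [ENNReal.tsum_eq_iSup_sum]
    refine iSup_le fun s => (ENNReal.inner_le_weight_mul_Lp_of_nonneg s hq w f).trans ?_
    have : 0 ≤ 1 - q⁻¹ := by rw [sub_nonneg]; exact inv_le_one_of_one_le₀ hq
    gcongr <;> exact ENNReal.sum_le_tsum _
  calc _ ≤ ((∑' i, w i) ^ (1 - q⁻¹) * (∑' i, w i * f i ^ q) ^ q⁻¹) ^ q := by gcongr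
    _ = _ := by
        rw [ENNReal.mul_rpow_of_nonneg _ _ hq0.le, ← ENNReal.rpow_mul, ← ENNReal.rpow_mul,
          inv_mul_cancel₀ hq0.ne', ENNReal.rpow_one]
        congr 2
        field_simp

theorem tsum_sq_le_weighted {ι : Type*} (x v : ι → ℝ≥0∞) (h0 : ∀ i, v i ≠ 0) (h1 : ∀ i, v i ≠ ∞) :
    (∑' i, x i) ^ 2 ≤ (∑' i, v i) * ∑' i, x i ^ 2 / v i := by
  have := tsum_mul_rpow_le (q := 2) one_le_two v fun i => x i / v i
  simp only [ENNReal.mul_div_cancel (h0 _) (h1 _)] at this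
  rw [ENNReal.rpow_two] at this
  refine this.trans (le_of_eq ?_)
  norm_num
  congr 1
  refine tsum_congr fun i => ?_
  rw [ENNReal.div_eq_inv_mul, mul_pow, ENNReal.div_eq_inv_mul, sq (v i)⁻¹, mul_assoc, ← mul_assoc,
    ENNReal.mul_inv_cancel (h0 i) (h1 i), one_mul]

theorem summable_exp_neg_mul_abs_int {c : ℝ} (hc : 0 < c) :
    Summable fun m : ℤ => rexp (-(c * |(m : ℝ)|)) := by
  have h : Summable fun m : ℕ => rexp (-(c * (m : ℝ))) := by
    have := Real.summable_exp_nat_mul_iff.2 (neg_neg_of_pos hc)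
    refine this.congr fun m => by congr 1; ring
  refine Summable.of_nat_of_neg ?_ ?_ <;> simpa using h

theorem exists_tsum_decay_le {ε b : ℝ} (hε : 0 < ε) (hb : 1 < b) :
    ∃ C > 0, ∀ x : ℝ, 0 < x →
      ∑' m : ℤ, ENNReal.ofReal (decay ε (b ^ m * x)) ≤ ENNReal.ofReal C := by
  have hL : 0 < Real.log b := Real.log_pos hb
  set L := Real.log b
  have hs := summable_exp_neg_mul_abs_int (mul_pos hε hL)
  refine ⟨rexp (ε * L) * ∑' m : ℤ, rexp (-(ε * L * |(m : ℝ)|)),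
    mul_pos (Real.exp_pos _) (hs.tsum_pos (fun _ => (Real.exp_pos _).le) 0 (Real.exp_pos _)),
    fun x hx => ?_⟩
  rw [← tsum_mul_left, ENNReal.ofReal_tsum_of_nonneg (fun m => by positivity) (hs.mul_left _),
    ← (Equiv.subRight ⌊Real.log x / L⌋).tsum_eq]
  refine ENNReal.tsum_le_tsum fun m => ENNReal.ofReal_le_ofReal ?_
  rw [decay, ← Real.exp_add, Real.exp_le_exp]
  have hlog : Real.log (b ^ ((Equiv.subRight ⌊Real.log x / L⌋) m) * x) =
      m * L + (Real.log x - ⌊Real.log x / L⌋ * L) := by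
    rw [Real.log_mul (by positivity) hx.ne', Real.log_zpow]
    simp only [Equiv.subRight_apply]
    push_cast; ring
  rw [hlog]
  have h1 : 0 ≤ Real.log x - ⌊Real.log x / L⌋ * L := by
    have := Int.floor_le (Real.log x / L); rw [le_div_iff₀ hL] at this; linarith
  have h2 : Real.log x - ⌊Real.log x / L⌋ * L ≤ L := by
    have := (Int.lt_floor_add_one (Real.log x / L)).le; rw [div_le_iff₀ hL] at this; linarith
  set θ := Real.log x - ⌊Real.log x / L⌋ * L
  have h3 : |(m : ℝ)| * L - L ≤ |m * L + θ| := by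
    have := abs_sub_abs_le_abs_sub ((m : ℝ) * L) (-θ)
    rw [abs_neg, abs_of_nonneg h1, abs_mul, abs_of_pos hL, sub_neg_eq_add] at this
    linarith
  nlinarith

theorem decay_pos (ε x : ℝ) : 0 < decay ε x := Real.exp_pos _

theorem decay_anti {ε ε' : ℝ} (h : ε ≤ ε') (x : ℝ) : decay ε' x ≤ decay ε x := by
  unfold decay; gcongr

theorem decay_mul (ε ε' x : ℝ) : decay ε x * decay ε' x = decay (ε + ε') x := by
  rw [decay, decay, decay, ← Real.exp_add]; congr 1; ring

/-- Multiplication of an `L²` function by a bounded function. -/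
def mult (m : Rn n → ℝ) (hm : Measurable m) (h1 : ∀ ξ, |m ξ| ≤ 1)
    (g : Lp ℂ 2 (volume : Measure (Rn n))) : Lp ℂ 2 (volume : Measure (Rn n)) :=
  MemLp.toLp (fun ξ => (m ξ : ℂ) * g ξ) <| by
    refine (Lp.memLp g).mono ?_ (Filter.Eventually.of_forall fun ξ => ?_)
    · exact (Complex.measurable_ofReal.comp hm).aestronglyMeasurable.mul (Lp.aestronglyMeasurable g)
    · rw [norm_mul, Complex.norm_real, Real.norm_eq_abs]
      exact mul_le_of_le_one_left (norm_nonneg _) (h1 ξ)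

section mult

variable {m : Rn n → ℝ} {hm : Measurable m} {h1 : ∀ ξ, |m ξ| ≤ 1}

theorem coeFn_mult (g : Lp ℂ 2 (volume : Measure (Rn n))) :
    mult m hm h1 g =ᵐ[volume] fun ξ => (m ξ : ℂ) * g ξ := MemLp.coeFn_toLp _

theorem inner_mult (g h : Lp ℂ 2 (volume : Measure (Rn n))) :
    ⟪mult m hm h1 g, h⟫_ℂ = ⟪g, mult m hm h1 h⟫_ℂ := by
  rw [L2.inner_def, L2.inner_def]
  refine integral_congr_ae ?_
  filter_upwards [coeFn_mult (hm := hm) (h1 := h1) g, coeFn_mult (hm := hm) (h1 := h1) h]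
    with ξ e1 e2
  rw [e1, e2, RCLike.inner_apply, RCLike.inner_apply, map_mul, Complex.conj_ofReal]
  ring

theorem enorm_sq_eq_lintegral (g : Lp ℂ 2 (volume : Measure (Rn n))) :
    ‖g‖ₑ ^ 2 = ∫⁻ ξ, ‖g ξ‖ₑ ^ 2 := by
  have := eLpNorm_nnreal_pow_eq_lintegral (f := g) (p := 2) (μ := volume) (by norm_num)
  rw [Lp.enorm_def]
  simpa using this

theorem enorm_mult_sq_le {A : Set (Rn n)} (hA : MeasurableSet A) (hmA : ∀ ξ ∉ A, m ξ = 0)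
    (g : Lp ℂ 2 (volume : Measure (Rn n))) :
    ‖mult m hm h1 g‖ₑ ^ 2 ≤ ∫⁻ ξ in A, ‖g ξ‖ₑ ^ 2 := by
  rw [enorm_sq_eq_lintegral, ← lintegral_indicator hA]
  refine lintegral_mono_ae ?_
  filter_upwards [coeFn_mult (hm := hm) (h1 := h1) g] with ξ e1
  rw [e1]
  by_cases h : ξ ∈ A
  · rw [indicator_of_mem h]
    gcongr
    rw [enorm_mul]
    refine mul_le_of_le_one_left zero_le ?_
    rw [← ofReal_norm, Complex.norm_real]
    exact ENNReal.ofReal_le_one.2 (h1 ξ)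
  · simp [hmA ξ h]

theorem norm_mult_le (g : Lp ℂ 2 (volume : Measure (Rn n))) : ‖mult m hm h1 g‖ ≤ ‖g‖ := by
  have := enorm_mult_sq_le (hm := hm) (h1 := h1) MeasurableSet.univ (by simp) g
  rw [setLIntegral_univ, ← enorm_sq_eq_lintegral] at this
  rw [← ofReal_norm, ← ofReal_norm, ← ENNReal.ofReal_pow (norm_nonneg _),
    ← ENNReal.ofReal_pow (norm_nonneg _), ENNReal.ofReal_le_ofReal_iff (by positivity)] at this
  exact (sq_le_sq₀ (norm_nonneg _) (norm_nonneg _)).1 this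

theorem sum_inner_mult_le {ι : Type*} {J : Finset ι} {γ : ι → Lp ℂ 2 (volume : Measure (Rn n))}
    (hγ : Orthonormal ℂ fun j : J => γ j) (h : Lp ℂ 2 (volume : Measure (Rn n))) :
    ∑ j ∈ J, ‖⟪mult m hm h1 (γ j), h⟫_ℂ‖ ^ 2 ≤ ‖h‖ ^ 2 := by
  simp only [inner_mult]
  rw [← Finset.sum_coe_sort]
  refine (hγ.sum_inner_products_le (s := Finset.univ) (mult m hm h1 h)).trans ?_
  gcongr
  exact norm_mult_le h

end mult

/-- The dyadic annulus `2^k ≤ |ξ| < 2^{k+1}`. -/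
def dyad (n : ℕ) (k : ℤ) : Set (Rn n) := (‖·‖) ⁻¹' Ico ((2 : ℝ) ^ k) ((2 : ℝ) ^ (k + 1))

theorem measurableSet_dyad (k : ℤ) : MeasurableSet (dyad n k) :=
  measurable_norm measurableSet_Ico

theorem pairwise_disjoint_dyad : Pairwise (Function.onFun Disjoint (dyad n)) := by
  have h : Monotone fun k : ℤ => (2 : ℝ) ^ k := zpow_right_mono₀ one_le_two
  intro i j hij
  exact (h.pairwise_disjoint_on_Ico_succ hij).preimage _

theorem iUnion_dyad : ⋃ k, dyad n k = {0}ᶜ := by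
  ext ξ
  simp only [mem_iUnion, mem_compl_iff, mem_singleton_iff]
  constructor
  · rintro ⟨k, hk⟩ rfl
    have : (2 : ℝ) ^ k ≤ 0 := by simpa using hk.1
    exact absurd this (not_le.2 (by positivity))
  · intro h
    obtain ⟨k, hk⟩ := exists_mem_Ico_zpow (norm_pos_iff.2 h) one_lt_two
    exact ⟨k, hk⟩

/-- The multiplier relating a dyadic piece to the Gaussian-damped waves. -/
def dyadMult (n : ℕ) (s : ℝ) (k : ℤ) : Rn n → ℝ :=
  (dyad n k).indicator fun ξ =>
    ((2 : ℝ) ^ k / ‖ξ‖) ^ s * rexp ((((2 : ℝ) ^ k) ^ 2)⁻¹ / 2 * ‖ξ‖ ^ 2 - 2)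

theorem measurable_dyadMult (s : ℝ) (k : ℤ) : Measurable (dyadMult n s k) := by
  refine Measurable.indicator ?_ (measurableSet_dyad k)
  fun_prop

theorem abs_dyadMult_le {s : ℝ} (hs : 0 ≤ s) (k : ℤ) (ξ : Rn n) : |dyadMult n s k ξ| ≤ 1 := by
  by_cases h : ξ ∈ dyad n k
  · rw [dyadMult, indicator_of_mem h]
    have hy : (0 : ℝ) < 2 ^ k := by positivity
    have h1 : (2 : ℝ) ^ k ≤ ‖ξ‖ := h.1
    have h2 : ‖ξ‖ ≤ 2 * 2 ^ k := by
      have : ‖ξ‖ < 2 ^ (k + 1) := h.2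
      rw [zpow_add_one₀ two_ne_zero] at this
      linarith
    have hξ : 0 < ‖ξ‖ := hy.trans_le h1
    rw [abs_of_nonneg (by positivity)]
    refine mul_le_one₀ (Real.rpow_le_one (by positivity) ((div_le_one hξ).2 h1) hs)
      (Real.exp_nonneg _) (Real.exp_le_one_iff.2 ?_)
    have : ‖ξ‖ ^ 2 ≤ 4 * (2 ^ k) ^ 2 := by nlinarith
    have : (((2 : ℝ) ^ k) ^ 2)⁻¹ / 2 * ‖ξ‖ ^ 2 ≤ (((2 : ℝ) ^ k) ^ 2)⁻¹ / 2 * (4 * (2 ^ k) ^ 2) := by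
      gcongr
    refine (sub_le_sub_right this 2).trans (le_of_eq ?_)
    field_simp; norm_num
  · simp [dyadMult, h]

/-- The adjoint Fourier restriction operator `a ↦ (2π)^{-n} ∫ e^{i(x·ξ - t|ξ|²)} a(ξ) dξ`. -/
def extend (a : Rn n → ℂ) (z : ℝ × Rn n) : ℂ :=
  ((2 * π : ℝ) ^ (-(n : ℝ)) : ℝ) • ∫ ξ : Rn n, phase z ξ * a ξ

theorem integrable_phase_mul {a : Rn n → ℂ} (ha : Integrable a) (z : ℝ × Rn n) :
    Integrable fun ξ => phase z ξ * a ξ := by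
  refine ha.norm.mono' ?_ (Filter.Eventually.of_forall fun ξ => by
    rw [norm_mul, norm_phase, one_mul])
  exact (continuous_phase.comp (Continuous.prodMk_right z)).aestronglyMeasurable.mul
    ha.aestronglyMeasurable

theorem enorm_extend_le (hn : 1 ≤ n) {a : Rn n → ℂ} (ha : Integrable a) (z : ℝ × Rn n) :
    ‖extend a z‖ₑ ≤ ENNReal.ofReal ((2 * π : ℝ) ^ (-(n : ℝ))) *
      ∑' k, ‖∫ ξ in dyad n k, phase z ξ * a ξ‖ₑ := by
  have : Nonempty (Fin n) := ⟨⟨0, hn⟩⟩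
  have hi := integrable_phase_mul ha z
  have h1 : ∫ ξ : Rn n, phase z ξ * a ξ = ∑' k, ∫ ξ in dyad n k, phase z ξ * a ξ := by
    have h := (hasSum_integral_iUnion (μ := volume) (measurableSet_dyad (n := n))
      pairwise_disjoint_dyad hi.integrableOn).tsum_eq
    have h0 := (ae_eq_univ (μ := volume) (s := ({0}ᶜ : Set (Rn n)))).2 (by simp)
    rw [h, iUnion_dyad, setIntegral_congr_set h0, setIntegral_univ]
  rw [extend, enorm_smul, h1, ← ofReal_norm, Real.norm_of_nonneg (by positivity)]
  gcongr
  exact enorm_tsum_le_tsum_enorm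

theorem dyadic_piece_eq {s : ℝ} (hs : 0 ≤ s) {a : Rn n → ℂ}
    {γ : Lp ℂ 2 (volume : Measure (Rn n))}
    (hγ : γ =ᵐ[volume] fun ξ => (((2 * π) ^ (-(n / 2 : ℝ)) * ‖ξ‖ ^ s : ℝ) : ℂ) * a ξ)
    (k : ℤ) (z : ℝ × Rn n) :
    ∫ ξ in dyad n k, phase z ξ * a ξ =
      ((rexp 2 * (2 * π) ^ (n / 2 : ℝ) * (((2 : ℝ) ^ k) ^ s)⁻¹ : ℝ) : ℂ) *
        ⟪wave (((2 : ℝ) ^ k) ^ 2)⁻¹ z,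
          mult (dyadMult n s k) (measurable_dyadMult s k) (abs_dyadMult_le hs k) γ⟫_ℂ := by
  have hω : 0 < (((2 : ℝ) ^ k) ^ 2)⁻¹ := by positivity
  rw [L2.inner_def, ← integral_const_mul, ← integral_indicator (measurableSet_dyad k)]
  refine integral_congr_ae ?_
  filter_upwards [coeFn_mult (hm := measurable_dyadMult s k) (h1 := abs_dyadMult_le hs k) γ,
    coeFn_wave hω z, hγ] with ξ e1 e2 e3
  rw [e1, e2, e3, RCLike.inner_apply]
  by_cases h : ξ ∈ dyad n k
  · have hy : (0 : ℝ) < 2 ^ k := by positivity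
    have hξ : 0 < ‖ξ‖ := hy.trans_le h.1
    rw [indicator_of_mem h, dyadMult, indicator_of_mem h, waveFun, map_mul, Complex.conj_conj,
      Complex.conj_ofReal]
    have : rexp 2 * (2 * π) ^ (n / 2 : ℝ) * (((2 : ℝ) ^ k) ^ s)⁻¹ *
        (((2 : ℝ) ^ k / ‖ξ‖) ^ s * rexp ((((2 : ℝ) ^ k) ^ 2)⁻¹ / 2 * ‖ξ‖ ^ 2 - 2)) *
        ((2 * π) ^ (-(n / 2 : ℝ)) * ‖ξ‖ ^ s) *
        rexp (-((((2 : ℝ) ^ k) ^ 2)⁻¹ / 2) * ‖ξ‖ ^ 2) = 1 := by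
      rw [Real.div_rpow hy.le hξ.le, Real.rpow_neg (by positivity), sub_eq_add_neg, Real.exp_add,
        neg_mul, Real.exp_neg, Real.exp_neg]
      have := Real.rpow_pos_of_pos hξ s
      field_simp
    calc phase z ξ * a ξ = phase z ξ * a ξ * ((1 : ℝ) : ℂ) := by simp
      _ = _ := by rw [← this]; push_cast; ring
  · simp [h, dyadMult]

theorem scale_identity {y M Φ ν β κ s d : ℝ} (hy : 0 < y) (hM : 0 < M) (hΦ : 0 < Φ) (hν : 0 < ν)
    (hs : 2 * s = 2 * d * κ + 2 * β - 2) :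
    ((y ^ s)⁻¹) ^ 2 * ((y ^ 2)⁻¹ * ν * ((Φ / ((y ^ 2)⁻¹ * ν)) ^ β * (M * ((y ^ 2)⁻¹) ^ (-d)) ^ κ)) =
      Φ ^ β * M ^ κ * ν ^ (1 - β) := by
  obtain ⟨Y, rfl⟩ : ∃ Y, y = rexp Y := ⟨_, (Real.exp_log hy).symm⟩
  obtain ⟨m, rfl⟩ : ∃ Y, M = rexp Y := ⟨_, (Real.exp_log hM).symm⟩
  obtain ⟨f, rfl⟩ : ∃ Y, Φ = rexp Y := ⟨_, (Real.exp_log hΦ).symm⟩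
  obtain ⟨v, rfl⟩ : ∃ Y, ν = rexp Y := ⟨_, (Real.exp_log hν).symm⟩
  simp only [← Real.exp_neg, ← Real.exp_nat_mul, ← Real.exp_mul, ← Real.exp_add, ← Real.exp_sub]
  congr 1
  push_cast
  linear_combination (-Y) * hs

/-- The restricted estimate on a slab, summed over all frequencies. -/
theorem exists_restricted_bound {n : ℕ} (hn : 2 ≤ n) {β κ δ s : ℝ} (hβ : β ∈ Ioo (0 : ℝ) 1)
    (hκ : κ ∈ Ioo (0 : ℝ) 1) (h1 : 2 < 2 * β + n * κ) (h2 : 1 + (n - 1) * β < n * κ)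
    (hδ : 0 < δ) (hs : 2 * s = n * κ + 2 * β - 2) :
    ∃ K > 0, ∃ ε > 0, ∀ (J : Finset ℕ) (a : ℕ → Rn n → ℂ)
      (γ : ℕ → Lp ℂ 2 (volume : Measure (Rn n))), J.Nonempty → (∀ j ∈ J, Integrable (a j)) →
      (Orthonormal ℂ fun j : J => γ j) →
      (∀ j ∈ J, γ j =ᵐ[volume]
        fun ξ => (((2 * π) ^ (-(n / 2 : ℝ)) * ‖ξ‖ ^ s : ℝ) : ℂ) * a j ξ) →
      ∃ ν : ℤ → ℝ, (∀ k, 0 ≤ ν k) ∧ ∑' k, ENNReal.ofReal (ν k) ≤ J.card ∧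
        ∀ (E : Set (ℝ × Rn n)) (F : Set ℝ) (M Φ : ℝ), Slab volume E F M Φ → 0 < M → 0 < Φ →
          ∫⁻ z in E, ∑ j ∈ J, ‖extend (a j) z‖ₑ ^ 2 ≤
            ENNReal.ofReal (K * (J.card : ℝ) ^ δ * (Φ ^ β * M ^ κ)) *
              ∑' k, ENNReal.ofReal (ν k ^ (1 - β) * (decay ε (Φ * (4 ^ k / ν k)) *
                decay ε (((2 : ℝ) ^ n) ^ k * M))) := by
  have hs0 : 0 ≤ s := by linarith
  have hn2 : (2 : ℝ) ≤ n := by exact_mod_cast hn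
  obtain ⟨K, hK, ε, hε, hmass⟩ := exists_mass_le_decay (Lp ℂ 2 (volume : Measure (Rn n))) (Rn n) ℕ
    volume (d := n / 2) (C₀ := (2 * π) ^ n) (by linarith) (by positivity) hβ hκ (by linarith)
    (by linarith) hδ
  obtain ⟨V, hV, hsum⟩ := exists_tsum_decay_le (half_pos hε)
    (one_lt_pow₀ (one_lt_two (α := ℝ)) (by omega : n ≠ 0))
  set K₁ : ℝ := (2 * π : ℝ) ^ (-(n : ℝ)) * (rexp 2 * (2 * π) ^ (n / 2 : ℝ)) with hK₁
  have hK₁0 : 0 < K₁ := by positivity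
  refine ⟨K₁ ^ 2 * V * K, by positivity, ε / 2, half_pos hε, fun J a γ hJ ha hγ hγa => ?_⟩
  have hN : (1 : ℝ) ≤ J.card := by exact_mod_cast hJ.card_pos
  -- frequency masses
  set ν : ℤ → ℝ := fun k => (∑ j ∈ J, ∫⁻ ξ in dyad n k, ‖γ j ξ‖ₑ ^ 2).toReal with hνd
  have hγ1 : ∀ j ∈ J, ∫⁻ ξ, ‖γ j ξ‖ₑ ^ 2 = 1 := fun j hj => by
    rw [← enorm_sq_eq_lintegral, ← ofReal_norm, hγ.1 ⟨j, hj⟩]; simp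
  have hle : ∀ k, ∑ j ∈ J, ∫⁻ ξ in dyad n k, ‖γ j ξ‖ₑ ^ 2 ≤ J.card := fun k => by
    refine (Finset.sum_le_sum fun j hj =>
      (setLIntegral_le_lintegral _ _).trans (hγ1 j hj).le).trans ?_
    simp
  have hνe : ∀ k, ENNReal.ofReal (ν k) = ∑ j ∈ J, ∫⁻ ξ in dyad n k, ‖γ j ξ‖ₑ ^ 2 := fun k =>
    ENNReal.ofReal_toReal ((hle k).trans_lt (by simp)).ne
  have hν0 : ∀ k, 0 ≤ ν k := fun k => ENNReal.toReal_nonneg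
  have hνN : ∀ k, ν k ≤ J.card := fun k => by
    rw [← ENNReal.ofReal_le_ofReal_iff (by positivity), hνe]; simpa using hle k
  refine ⟨ν, hν0, ?_, fun E F M Φ hE hM hΦ => ?_⟩
  · simp only [hνe]
    rw [Summable.tsum_finsetSum fun _ _ => ENNReal.summable]
    calc _ ≤ ∑ j ∈ J, (1 : ℝ≥0∞) := by
          refine Finset.sum_le_sum fun j hj => ?_
          rw [← lintegral_iUnion measurableSet_dyad pairwise_disjoint_dyad]
          exact (setLIntegral_le_lintegral _ _).trans (hγ1 j hj).le
      _ = _ := by simp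
  set G : ℤ → ℕ → Lp ℂ 2 (volume : Measure (Rn n)) := fun k j =>
    mult (dyadMult n s k) (measurable_dyadMult s k) (abs_dyadMult_le hs0 k) (γ j) with hG
  have hGν : ∀ k, ∑ j ∈ J, ‖G k j‖ ^ 2 ≤ ν k := fun k => by
    rw [← ENNReal.ofReal_le_ofReal_iff (hν0 k), hνe,
      ENNReal.ofReal_sum_of_nonneg fun _ _ => by positivity]
    refine Finset.sum_le_sum fun j _ => ?_
    rw [ENNReal.ofReal_pow (norm_nonneg _), ofReal_norm]
    refine enorm_mult_sq_le (measurableSet_dyad k) (fun ξ hξ => ?_) (γ j)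
    simp [dyadMult, hξ]
  set v : ℤ → ℝ := fun k => decay (ε / 2) (((2 : ℝ) ^ n) ^ k * M) with hv
  have hv0 : ∀ k, 0 < v k := fun k => decay_pos _ _
  set B : ℤ → ℝ := fun k => K * (J.card : ℝ) ^ δ * (Φ ^ β * M ^ κ) *
    (ν k ^ (1 - β) * (decay (ε / 2) (Φ * (4 ^ k / ν k)) * v k)) with hB
  set W : ℤ → ℝ × Rn n → Lp ℂ 2 (volume : Measure (Rn n)) := fun k =>
    wave (((2 : ℝ) ^ k) ^ 2)⁻¹ with hW
  have hω : ∀ k : ℤ, 0 < (((2 : ℝ) ^ k) ^ 2)⁻¹ := fun k => by positivity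
  have hmass' : ∀ k, (((2 : ℝ) ^ k) ^ s)⁻¹ ^ 2 * (v k)⁻¹ * mass volume (W k) E J (G k) ≤ B k :=
    fun k => by
    have hvk := hv0 k
    have hy : (0 : ℝ) < 2 ^ k := by positivity
    rcases (hν0 k).eq_or_lt with h | h
    · have hG0 : ∀ j ∈ J, G k j = 0 := fun j hj => by
        have h3 := (Finset.sum_eq_zero_iff_of_nonneg fun j _ => by positivity).1
          (le_antisymm ((hGν k).trans h.symm.le) (Finset.sum_nonneg fun j _ => by positivity)) j hj
        simpa using h3
      have hm0 : mass volume (W k) E J (G k) = 0 :=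
        Finset.sum_eq_zero fun j hj => by simp [coeff, hG0 j hj]
      rw [hm0, mul_zero]
      simp only [hB]
      have := decay_pos (ε / 2) (Φ * (4 ^ k / ν k))
      have := hν0 k
      positivity
    · have hm := hmass _ M Φ (ν k) J.card (W k) E F J (G k) (dispersiveFamily_wave (hω k)) (hω k)
        hE hM hΦ (fun h => sum_inner_mult_le hγ h) (hGν k) h (hνN k) hN
      have hid := scale_identity (s := s) (κ := κ) (β := β) (d := n / 2) hy hM hΦ h (by linarith)
      have eP : M * ((((2 : ℝ) ^ k) ^ 2)⁻¹) ^ (-(n / 2 : ℝ)) = ((2 : ℝ) ^ n) ^ k * M := by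
        rw [Real.inv_rpow (by positivity), ← Real.rpow_neg (by positivity), neg_neg,
          ← Real.rpow_natCast ((2 : ℝ) ^ k) 2, ← Real.rpow_mul hy.le, mul_comm M]
        congr 1
        rw [show ((2 : ℕ) : ℝ) * (n / 2) = n by push_cast; ring, Real.rpow_natCast, ← zpow_natCast,
          ← zpow_mul, mul_comm k, zpow_mul, zpow_natCast]
      have eR : Φ / ((((2 : ℝ) ^ k) ^ 2)⁻¹ * ν k) = Φ * (4 ^ k / ν k) := by
        rw [show (4 : ℝ) = 2 ^ 2 by norm_num, ← zpow_natCast, ← zpow_mul, ← zpow_natCast,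
          ← zpow_mul, mul_comm k]
        field_simp
      set R := Φ / ((((2 : ℝ) ^ k) ^ 2)⁻¹ * ν k)
      set P := M * ((((2 : ℝ) ^ k) ^ 2)⁻¹) ^ (-(n / 2 : ℝ))
      have hvP : decay ε P = v k * v k := by
        rw [hv]; simp only; rw [← eP, decay_mul, add_halves]
      calc _ ≤ (((2 : ℝ) ^ k) ^ s)⁻¹ ^ 2 * (v k)⁻¹ * (K * (J.card : ℝ) ^ δ *
            ((((2 : ℝ) ^ k) ^ 2)⁻¹ * ν k) * (R ^ β * P ^ κ) * (decay ε R * decay ε P)) := by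
            gcongr
        _ = K * (J.card : ℝ) ^ δ * ((((2 : ℝ) ^ k) ^ s)⁻¹ ^ 2 *
            ((((2 : ℝ) ^ k) ^ 2)⁻¹ * ν k * (R ^ β * P ^ κ))) * (decay ε R * v k) := by
            rw [hvP]; field_simp
        _ = K * (J.card : ℝ) ^ δ * (Φ ^ β * M ^ κ * ν k ^ (1 - β)) * (decay ε R * v k) := by
            rw [hid]
        _ ≤ K * (J.card : ℝ) ^ δ * (Φ ^ β * M ^ κ * ν k ^ (1 - β)) * (decay (ε / 2) R * v k) := by
            have : decay ε R ≤ decay (ε / 2) R := decay_anti (by linarith) _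
            gcongr
        _ = B k := by simp only [hB]; rw [← eR]; ring
  have hpt : ∀ z, ∑ j ∈ J, ‖extend (a j) z‖ₑ ^ 2 ≤ ENNReal.ofReal (K₁ ^ 2 * V) *
      ∑ j ∈ J, ∑' k, ENNReal.ofReal ((((2 : ℝ) ^ k) ^ s)⁻¹ ^ 2 * (v k)⁻¹) *
        ‖⟪W k z, G k j⟫_ℂ‖ₑ ^ 2 :=
    fun z => by
    rw [Finset.mul_sum]
    refine Finset.sum_le_sum fun j hj => ?_
    have e1 := enorm_extend_le (by omega) (ha j hj) z
    have e2 : ∑' k, ‖∫ ξ in dyad n k, phase z ξ * a j ξ‖ₑ =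
        ENNReal.ofReal (rexp 2 * (2 * π) ^ (n / 2 : ℝ)) *
          ∑' k, ENNReal.ofReal ((((2 : ℝ) ^ k) ^ s)⁻¹) * ‖⟪W k z, G k j⟫_ℂ‖ₑ := by
      rw [← ENNReal.tsum_mul_left]
      refine tsum_congr fun k => ?_
      rw [dyadic_piece_eq hs0 (hγa j hj), enorm_mul, ← mul_assoc,
        ← ENNReal.ofReal_mul (by positivity), ← ofReal_norm, Complex.norm_real,
        Real.norm_of_nonneg (by positivity)]
    rw [e2, ← mul_assoc, ← ENNReal.ofReal_mul (by positivity), ← hK₁] at e1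
    have e3 := tsum_sq_le_weighted
      (fun k : ℤ => ENNReal.ofReal ((((2 : ℝ) ^ k) ^ s)⁻¹) * ‖⟪W k z, G k j⟫_ℂ‖ₑ)
      (fun k => ENNReal.ofReal (v k)) (fun k => by simpa using hv0 k) (fun k => by simp)
    calc _ ≤ (ENNReal.ofReal K₁ *
          ∑' k, ENNReal.ofReal ((((2 : ℝ) ^ k) ^ s)⁻¹) * ‖⟪W k z, G k j⟫_ℂ‖ₑ) ^ 2 := by gcongr
      _ ≤ ENNReal.ofReal K₁ ^ 2 * (ENNReal.ofReal V * _) := by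
          rw [mul_pow]
          gcongr
          refine e3.trans ?_
          gcongr
          exact hsum M hM
      _ = _ := by
          rw [← mul_assoc, ENNReal.ofReal_mul (p := K₁ ^ 2) (by positivity),
            ENNReal.ofReal_pow hK₁0.le]
          congr 1
          refine tsum_congr fun k => ?_
          have hvk := hv0 k
          rw [mul_pow, ENNReal.ofReal_mul (by positivity), ENNReal.ofReal_pow (by positivity),
            ENNReal.ofReal_inv_of_pos hvk, ENNReal.div_eq_inv_mul]
          ring
  have hWm : ∀ k j, Measurable fun z => ‖⟪W k z, G k j⟫_ℂ‖ₑ ^ 2 := fun k j =>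
    (((continuous_wave (hω k)).inner continuous_const).measurable.enorm).pow_const 2
  calc _ ≤ ∫⁻ z in E, ENNReal.ofReal (K₁ ^ 2 * V) *
      ∑ j ∈ J, ∑' k, ENNReal.ofReal ((((2 : ℝ) ^ k) ^ s)⁻¹ ^ 2 * (v k)⁻¹) *
        ‖⟪W k z, G k j⟫_ℂ‖ₑ ^ 2 := lintegral_mono hpt
    _ = ENNReal.ofReal (K₁ ^ 2 * V) *
      ∑' k, ENNReal.ofReal ((((2 : ℝ) ^ k) ^ s)⁻¹ ^ 2 * (v k)⁻¹) *
        ENNReal.ofReal (mass volume (W k) E J (G k)) := by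
        rw [lintegral_const_mul' _ _ (by simp), lintegral_finsetSum' _ fun j _ =>
          (Measurable.tsum fun k => (hWm k j).const_mul _).aemeasurable]
        congr 1
        have e1 : ∀ j ∈ J, ∫⁻ z in E, ∑' k, ENNReal.ofReal ((((2 : ℝ) ^ k) ^ s)⁻¹ ^ 2 * (v k)⁻¹) *
            ‖⟪W k z, G k j⟫_ℂ‖ₑ ^ 2 = ∑' k, ENNReal.ofReal ((((2 : ℝ) ^ k) ^ s)⁻¹ ^ 2 * (v k)⁻¹) *
            ENNReal.ofReal (∫ z, ‖coeff (W k) E (G k j) z‖ ^ 2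
              ∂((volume : Measure ℝ).prod (volume : Measure (Rn n)))) := fun j _ => by
          rw [lintegral_tsum fun k => ((hWm k j).const_mul _).aemeasurable]
          refine tsum_congr fun k => ?_
          rw [lintegral_const_mul _ (hWm k j),
            ← lintegral_coeff_sq (dispersiveFamily_wave (hω k)) (hω k) hE,
            ← lintegral_indicator hE.meas]
          congr 1
          refine lintegral_congr fun z => ?_
          by_cases hz : z ∈ E <;> simp [coeff, hz, hW]
        rw [Finset.sum_congr rfl e1, ← Summable.tsum_finsetSum fun _ _ => ENNReal.summable]
        refine tsum_congr fun k => ?_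
        rw [← Finset.mul_sum, mass, ENNReal.ofReal_sum_of_nonneg fun _ _ => by positivity]
    _ ≤ ENNReal.ofReal (K₁ ^ 2 * V) * ∑' k, ENNReal.ofReal (B k) := by
        gcongr with k
        rw [← ENNReal.ofReal_mul (by have := hv0 k; positivity)]
        exact ENNReal.ofReal_le_ofReal (hmass' k)
    _ = _ := by
        have hpos : 0 ≤ K * (J.card : ℝ) ^ δ * (Φ ^ β * M ^ κ) := by positivity
        simp only [hB, ENNReal.ofReal_mul hpos, ENNReal.tsum_mul_left]
        rw [← mul_assoc, ← ENNReal.ofReal_mul (by positivity)]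
        congr 2; ring

/-- The dyadic interval `(2^i, 2^{i+1}]` in `[0, ∞]`. -/
def layer (i : ℤ) : Set ℝ≥0∞ := Ioc (ENNReal.ofReal (2 ^ i)) (ENNReal.ofReal (2 ^ (i + 1)))

theorem exists_mem_layer {x : ℝ≥0∞} (h0 : x ≠ 0) (h : x ≠ ∞) : ∃ i, x ∈ layer i := by
  obtain ⟨i, hi⟩ := exists_mem_Ioc_zpow (ENNReal.toReal_pos h0 h) one_lt_two
  refine ⟨i, (ENNReal.ofReal_lt_iff_lt_toReal (by positivity) h).2 hi.1, ?_⟩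
  exact (ENNReal.le_ofReal_iff_toReal_le h (by positivity)).2 hi.2

theorem rpow_le_tsum_layer {r : ℝ} (hr : 0 < r) {x : ℝ≥0∞} (h : x ≠ ∞) :
    x ^ r ≤ ∑' i : ℤ, ENNReal.ofReal (2 ^ (i + 1)) ^ r * (layer i).indicator 1 x := by
  rcases eq_or_ne x 0 with rfl | h0
  · simp [hr]
  obtain ⟨i, hi⟩ := exists_mem_layer h0 h
  refine le_trans ?_ (ENNReal.le_tsum i)
  rw [indicator_of_mem hi, Pi.one_apply, mul_one]
  exact ENNReal.rpow_le_rpow hi.2 hr.le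

theorem mul_measure_le_setLIntegral {α : Type*} [MeasurableSpace α] {μ : Measure α} {s : Set α}
    (hs : MeasurableSet s) {c : ℝ≥0∞} {f : α → ℝ≥0∞} (h : ∀ x ∈ s, c ≤ f x) :
    c * μ s ≤ ∫⁻ x in s, f x ∂μ := by
  rw [← setLIntegral_const]
  exact setLIntegral_mono' hs h

theorem tsum_rpow_le_tsum {ι : Type*} {r : ℝ} (h0 : 0 < r) (h1 : r ≤ 1) (f : ι → ℝ≥0∞) :
    (∑' i, f i) ^ r ≤ ∑' i, f i ^ r := by
  rw [← ENNReal.le_rpow_inv_iff h0, ENNReal.tsum_eq_iSup_sum]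
  refine iSup_le fun s => (ENNReal.le_rpow_inv_iff h0).2 ?_
  refine (Finset.le_sum_of_subadditive (fun x : ℝ≥0∞ => x ^ r) (by simp [h0])
    (fun a b => ENNReal.rpow_add_le_add_rpow a b h0.le h1) s f).trans (ENNReal.sum_le_tsum s)

theorem exists_tsum_dyadic_le {q : ℝ} (hq : 0 < q) :
    ∃ C > 0, ∀ B : ℝ≥0∞, ∑' i : ℤ, {i : ℤ | ENNReal.ofReal (2 ^ i) ≤ B}.indicator
      (fun i => ENNReal.ofReal (2 ^ i) ^ q) i ≤ ENNReal.ofReal C * B ^ q := by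
  obtain ⟨C, hC, h⟩ := exists_tsum_decay_le hq one_lt_two
  refine ⟨C, hC, fun B => ?_⟩
  rcases eq_or_ne B ∞ with rfl | hB
  · rw [ENNReal.top_rpow_of_pos hq, ENNReal.mul_top (by simpa using hC)]; exact le_top
  lift B to NNReal using hB
  rcases eq_or_ne B 0 with rfl | hB0
  · simp only [ENNReal.coe_zero, nonpos_iff_eq_zero, ENNReal.ofReal_eq_zero]
    have : {i : ℤ | (2 : ℝ) ^ i ≤ 0} = ∅ := by
      ext i; simpa using (by positivity : (0 : ℝ) < 2 ^ i)
    simp [this]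
  have hBp : (0 : ℝ) < B := by positivity
  rw [mul_comm]
  refine le_trans ?_ (mul_le_mul_right (h (B : ℝ)⁻¹ (by positivity)) _)
  rw [← ENNReal.tsum_mul_left]
  refine ENNReal.tsum_le_tsum fun i => ?_
  by_cases hi : i ∈ {i : ℤ | ENNReal.ofReal (2 ^ i) ≤ B}
  · rw [indicator_of_mem hi]
    have hi' : (2 : ℝ) ^ i ≤ B := by
      have : ENNReal.ofReal (2 ^ i) ≤ B := hi
      rwa [← ENNReal.ofReal_coe_nnreal, ENNReal.ofReal_le_ofReal_iff (by positivity)] at this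
    have h2 : (0 : ℝ) < 2 ^ i := by positivity
    rw [← ENNReal.ofReal_coe_nnreal, ENNReal.ofReal_rpow_of_pos h2,
      ENNReal.ofReal_rpow_of_pos hBp, ← ENNReal.ofReal_mul (by positivity)]
    refine ENNReal.ofReal_le_ofReal (le_of_eq ?_)
    have h3 : Real.log (2 ^ i * (B : ℝ)⁻¹) ≤ 0 :=
      Real.log_nonpos (by positivity) (by rw [← div_eq_mul_inv]; exact div_le_one_of_le₀ hi' hBp.le)
    rw [decay, abs_of_nonpos h3, Real.log_mul h2.ne' (by positivity), Real.log_inv,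
      Real.rpow_def_of_pos h2, Real.rpow_def_of_pos hBp, ← Real.exp_add]
    congr 1; ring
  · rw [indicator_of_notMem hi]; exact zero_le

theorem level_identity {p q M Φ : ℝ} (hp : p ≠ 0) (hq : q ≠ 0) (hM : 0 < M) (hΦ : 0 < Φ) :
    (2 : ℝ) ^ q * M ^ (q / p) * Φ *
      (Φ ^ (1 - 1 / q) * M ^ (1 - 1 / p) / (M / 2 * (Φ / 2))) ^ q = 8 ^ q := by
  obtain ⟨m, rfl⟩ : ∃ Y, M = rexp Y := ⟨_, (Real.exp_log hM).symm⟩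
  obtain ⟨f, rfl⟩ : ∃ Y, Φ = rexp Y := ⟨_, (Real.exp_log hΦ).symm⟩
  have h8 : (8 : ℝ) = rexp (3 * Real.log 2) := by
    rw [mul_comm, Real.exp_mul, Real.exp_log two_pos]; norm_num
  rw [h8]
  obtain ⟨b, hb⟩ : ∃ Y, (2 : ℝ) = rexp Y := ⟨_, (Real.exp_log two_pos).symm⟩
  rw [hb, Real.log_exp]
  simp only [← Real.exp_mul, ← Real.exp_add, ← Real.exp_sub]
  congr 1
  field_simp
  ring

/-- A mixed-norm bound from bounds for the mass on slabs. -/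
theorem exists_level_set_bound {X : Type*} [MeasurableSpace X] (μ : Measure X) [SFinite μ]
    {p q : ℝ} (hq : 1 ≤ q) (hqp : q ≤ p) :
    ∃ C > 0, ∀ (ρ : ℝ × X → ℝ≥0∞) (L : ℝ) (Y : ℤ → ℤ → ℝ≥0∞) (T : Set ℝ) (A : Set X),
      Measurable ρ → (∀ z, ρ z ≠ ∞) → 0 < L → volume T ≠ ∞ → μ A ≠ ∞ →
      (∀ z, ρ z ≠ 0 → z.1 ∈ T ∧ z.2 ∈ A) →
      (∀ (E : Set (ℝ × X)) (F : Set ℝ) (m f : ℤ), Slab μ E F (2 ^ (m + 1)) (2 ^ (f + 1)) →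
        ∫⁻ z in E, ρ z ∂((volume : Measure ℝ).prod μ) ≤
          ENNReal.ofReal (L * (((2 : ℝ) ^ (f + 1)) ^ (1 - 1 / q) *
            ((2 : ℝ) ^ (m + 1)) ^ (1 - 1 / p))) * Y m f) →
      ∫⁻ t, (∫⁻ x, ρ (t, x) ^ p ∂μ) ^ (q / p) ≤
        ENNReal.ofReal (C * L ^ q) * ∑' m, ∑' f, Y m f ^ q := by
  have hq0 : 0 < q := by linarith
  have hp0 : 0 < p := by linarith
  have hqp0 : 0 < q / p := by positivity
  have hqp1 : q / p ≤ 1 := (div_le_one hp0).2 hqp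
  obtain ⟨C, hC, hdy⟩ := exists_tsum_dyadic_le hq0
  refine ⟨8 ^ q * C, by positivity, fun ρ L Y T A hρ hfin hL hT hA hsupp hslab => ?_⟩
  set S : ℤ → Set (ℝ × X) := fun i => ρ ⁻¹' layer i with hS
  have hSm : ∀ i, MeasurableSet (S i) := fun i => hρ measurableSet_Ioc
  have hSρ : ∀ i z, z ∈ S i → ρ z ≠ 0 := fun i z hz => (bot_le.trans_lt hz.1).ne'
  set σ : ℤ → ℝ → ℝ≥0∞ := fun i t => μ (Prod.mk t ⁻¹' S i) with hσ
  have hσm : ∀ i, Measurable (σ i) := fun i => measurable_measure_prodMk_left (hSm i)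
  have hσA : ∀ i t, σ i t ≠ ∞ := fun i t => by
    have h : Prod.mk t ⁻¹' S i ⊆ A := fun x hx => (hsupp _ (hSρ i _ hx)).2
    exact ((measure_mono h).trans_lt hA.lt_top).ne
  set F : ℤ → ℤ → Set ℝ := fun i m => σ i ⁻¹' layer m with hF
  have hFm : ∀ i m, MeasurableSet (F i m) := fun i m => hσm i measurableSet_Ioc
  have hFT : ∀ i m, volume (F i m) ≠ ∞ := fun i m => by
    refine ((measure_mono fun t ht => ?_).trans_lt hT.lt_top).ne
    have h1 : σ i t ≠ 0 := (bot_le.trans_lt ht.1).ne'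
    obtain ⟨x, hx⟩ := nonempty_of_measure_ne_zero h1
    exact (hsupp _ (hSρ i _ hx)).1
  have hmain : ∀ i m f, volume (F i m) ∈ layer f →
      ENNReal.ofReal (2 ^ i) ≤ ENNReal.ofReal (L * (((2 : ℝ) ^ (f + 1)) ^ (1 - 1 / q) *
            ((2 : ℝ) ^ (m + 1)) ^ (1 - 1 / p) / ((2 : ℝ) ^ (m + 1) / 2 * (2 ^ (f + 1) / 2)))) *
              Y m f := by
    intro i m f hf
    have hE : Slab μ (S i ∩ Prod.fst ⁻¹' F i m) (F i m) (2 ^ (m + 1)) (2 ^ (f + 1)) := by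
      refine ⟨(hSm i).inter (measurable_fst (hFm i m)), hFm i m, fun t => ?_, fun z hz => hz.2,
        hf.2⟩
      by_cases ht : t ∈ F i m
      · exact (measure_mono fun x hx => hx.1).trans ht.2
      · have : Prod.mk t ⁻¹' (S i ∩ Prod.fst ⁻¹' F i m) = ∅ := by
          ext x; simp [ht]
        simp [this]
    have h1 := hslab _ _ m f hE
    have h2 : ENNReal.ofReal (2 ^ i) * (ENNReal.ofReal (2 ^ m) * ENNReal.ofReal (2 ^ f)) ≤
        ∫⁻ z in S i ∩ Prod.fst ⁻¹' F i m, ρ z ∂((volume : Measure ℝ).prod μ) := by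
      calc _ ≤ ENNReal.ofReal (2 ^ i) * (ENNReal.ofReal (2 ^ m) * volume (F i m)) := by
            gcongr; exact hf.1.le
        _ ≤ ENNReal.ofReal (2 ^ i) * ∫⁻ t in F i m, σ i t := by
            gcongr
            exact mul_measure_le_setLIntegral (hFm i m) fun t ht => ht.1.le
        _ = ENNReal.ofReal (2 ^ i) *
            ((volume : Measure ℝ).prod μ) (S i ∩ Prod.fst ⁻¹' F i m) := by
            rw [Measure.prod_apply hE.meas, ← lintegral_indicator (hFm i m)]
            congr 1
            refine lintegral_congr fun t => ?_
            by_cases ht : t ∈ F i m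
            · rw [indicator_of_mem ht]; simp only [hσ]; congr 1; ext x; simp [ht]
            · rw [indicator_of_notMem ht]
              have : Prod.mk t ⁻¹' (S i ∩ Prod.fst ⁻¹' F i m) = ∅ := by
                ext x; simp [ht]
              simp [this]
        _ ≤ _ := mul_measure_le_setLIntegral hE.meas fun z hz => hz.1.1.le
    have h3 := h2.trans h1
    have e2 : ∀ k : ℤ, (2 : ℝ) ^ (k + 1) / 2 = 2 ^ k := fun k => by
      rw [zpow_add_one₀ two_ne_zero]; ring
    rw [← ENNReal.ofReal_mul (by positivity)] at h3
    rw [e2, e2, ← mul_div_assoc, ENNReal.ofReal_div_of_pos (by positivity), ENNReal.div_eq_inv_mul,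
      mul_assoc, mul_comm _⁻¹, ← div_eq_mul_inv, ENNReal.le_div_iff_mul_le]
    · exact h3
    · left; simpa using (by positivity : (0 : ℝ) < 2 ^ m * 2 ^ f)
    · left; simp
  calc ∫⁻ t, (∫⁻ x, ρ (t, x) ^ p ∂μ) ^ (q / p)
      ≤ ∫⁻ t, ∑' i : ℤ, ∑' m : ℤ, ENNReal.ofReal (2 ^ (i + 1)) ^ q *
          (ENNReal.ofReal (2 ^ (m + 1)) ^ (q / p) * (F i m).indicator 1 t) := by
        refine lintegral_mono fun t => ?_
        calc _ ≤ (∑' i : ℤ, ENNReal.ofReal (2 ^ (i + 1)) ^ p * σ i t) ^ (q / p) := by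
              refine ENNReal.rpow_le_rpow ?_ hqp0.le
              have hm : ∀ i, MeasurableSet (Prod.mk t ⁻¹' S i) := fun i =>
                measurable_prodMk_left (hSm i)
              calc _ ≤ ∫⁻ x, ∑' i : ℤ, ENNReal.ofReal (2 ^ (i + 1)) ^ p *
                    (Prod.mk t ⁻¹' S i).indicator 1 x ∂μ :=
                    lintegral_mono fun x => rpow_le_tsum_layer hp0 (hfin (t, x))
                _ = _ := by
                    rw [lintegral_tsum fun i =>
                      ((measurable_one.indicator (hm i)).const_mul _).aemeasurable]
                    refine tsum_congr fun i => ?_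
                    rw [lintegral_const_mul _ (measurable_one.indicator (hm i)),
                      lintegral_indicator_one (hm i)]
          _ ≤ ∑' i : ℤ, (ENNReal.ofReal (2 ^ (i + 1)) ^ p * σ i t) ^ (q / p) :=
              tsum_rpow_le_tsum hqp0 hqp1 _
          _ ≤ _ := by
              refine ENNReal.tsum_le_tsum fun i => ?_
              rw [ENNReal.mul_rpow_of_nonneg _ _ hqp0.le, ← ENNReal.rpow_mul,
                mul_div_cancel₀ _ hp0.ne', ENNReal.tsum_mul_left]
              gcongr
              exact rpow_le_tsum_layer hqp0 (hσA i t)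
    _ = ∑' i : ℤ, ∑' m : ℤ, ENNReal.ofReal (2 ^ (i + 1)) ^ q *
          (ENNReal.ofReal (2 ^ (m + 1)) ^ (q / p) * volume (F i m)) := by
        have hm : ∀ i m, Measurable fun t => ENNReal.ofReal (2 ^ (i + 1)) ^ q *
          (ENNReal.ofReal (2 ^ (m + 1)) ^ (q / p) * (F i m).indicator 1 t) := fun i m =>
            ((measurable_one.indicator (hFm i m)).const_mul _).const_mul _
        rw [lintegral_tsum fun i => (Measurable.tsum fun m => hm i m).aemeasurable]
        refine tsum_congr fun i => ?_
        rw [lintegral_tsum fun m => (hm i m).aemeasurable]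
        refine tsum_congr fun m => ?_
        rw [lintegral_const_mul _ ((measurable_one.indicator (hFm i m)).const_mul _),
          lintegral_const_mul _ (measurable_one.indicator (hFm i m)),
          lintegral_indicator_one (hFm i m)]
    _ ≤ ∑' i : ℤ, ∑' m : ℤ, ∑' f : ℤ, ENNReal.ofReal (2 ^ (i + 1)) ^ q *
          (ENNReal.ofReal (2 ^ (m + 1)) ^ (q / p) *
            (ENNReal.ofReal (2 ^ (f + 1)) * (layer f).indicator 1 (volume (F i m)))) := by
        refine ENNReal.tsum_le_tsum fun i => ENNReal.tsum_le_tsum fun m => ?_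
        simp only [ENNReal.tsum_mul_left]
        gcongr
        simpa using rpow_le_tsum_layer one_pos (hFT i m)
    _ = ∑' m : ℤ, ∑' f : ℤ, ∑' i : ℤ, ENNReal.ofReal (2 ^ (i + 1)) ^ q *
          (ENNReal.ofReal (2 ^ (m + 1)) ^ (q / p) *
            (ENNReal.ofReal (2 ^ (f + 1)) * (layer f).indicator 1 (volume (F i m)))) := by
        rw [ENNReal.tsum_comm]
        refine tsum_congr fun m => ENNReal.tsum_comm
    _ ≤ ∑' m : ℤ, ∑' f : ℤ, ENNReal.ofReal (8 ^ q * C * L ^ q) * Y m f ^ q := by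
        refine ENNReal.tsum_le_tsum fun m => ENNReal.tsum_le_tsum fun f => ?_
        set M : ℝ := 2 ^ (m + 1) with hM
        set Φ : ℝ := 2 ^ (f + 1) with hΦ
        have hM0 : 0 < M := by positivity
        have hΦ0 : 0 < Φ := by positivity
        set H : ℝ := Φ ^ (1 - 1 / q) * M ^ (1 - 1 / p) / (M / 2 * (Φ / 2)) with hH
        have hH0 : 0 < H := by positivity
        have hB : ENNReal.ofReal (2 ^ q * M ^ (q / p) * Φ) * (ENNReal.ofReal C *
            (ENNReal.ofReal (L * H) * Y m f) ^ q) =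
            ENNReal.ofReal (8 ^ q * C * L ^ q) * Y m f ^ q := by
          rw [ENNReal.mul_rpow_of_nonneg _ _ hq0.le, ENNReal.ofReal_rpow_of_pos (by positivity),
            ← mul_assoc, ← mul_assoc, ← ENNReal.ofReal_mul (by positivity),
            ← ENNReal.ofReal_mul (by positivity)]
          congr 2
          rw [Real.mul_rpow hL.le hH0.le, ← level_identity hp0.ne' hq0.ne' hM0 hΦ0]
          ring
        rw [← hB]
        refine le_trans ?_ (mul_le_mul_right (hdy _) _)
        rw [← ENNReal.tsum_mul_left]
        refine ENNReal.tsum_le_tsum fun i => ?_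
        by_cases hi : volume (F i m) ∈ layer f
        · have h2 : (0 : ℝ) < 2 ^ i := by positivity
          rw [indicator_of_mem hi, indicator_of_mem (show i ∈ {i : ℤ | ENNReal.ofReal (2 ^ i) ≤
            ENNReal.ofReal (L * H) * Y m f} from hmain i m f hi), Pi.one_apply, mul_one,
            ENNReal.ofReal_rpow_of_pos (by positivity), ENNReal.ofReal_rpow_of_pos hM0,
            ENNReal.ofReal_rpow_of_pos h2,
            ← ENNReal.ofReal_mul (by positivity), ← ENNReal.ofReal_mul (by positivity),
            ← ENNReal.ofReal_mul (by positivity), zpow_add_one₀ two_ne_zero,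
            Real.mul_rpow h2.le zero_le_two]
          exact ENNReal.ofReal_le_ofReal (by ring_nf; rfl)
        · rw [indicator_of_notMem hi]; simp
    _ = _ := by simp only [ENNReal.tsum_mul_left]

theorem continuous_extend {a : Rn n → ℂ} (ha : Integrable a) : Continuous (extend a) := by
  unfold extend
  refine Continuous.const_smul (M := ℝ) ?_ _
  refine continuous_of_dominated (fun z => (integrable_phase_mul ha z).aestronglyMeasurable)
    (fun z => Filter.Eventually.of_forall fun ξ => (by rw [norm_mul, norm_phase, one_mul] :
      ‖phase z ξ * a ξ‖ ≤ ‖a ξ‖)) ha.norm (Filter.Eventually.of_forall fun ξ => ?_)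
  exact (continuous_phase.comp (Continuous.prodMk_left ξ)).mul continuous_const

theorem exists_tsum_tsum_decay_le (hn : n ≠ 0) {ε q : ℝ} (hε : 0 < ε) (hq : 1 ≤ q) :
    ∃ C > 0, ∀ ν : ℤ → ℝ, (∀ k, 0 ≤ ν k) →
      ∑' m : ℤ, ∑' f : ℤ, (∑' k, ENNReal.ofReal (ν k ^ (1 / q) *
        (decay ε (2 ^ (f + 1) * (4 ^ k / ν k)) * decay ε (((2 : ℝ) ^ n) ^ k * 2 ^ (m + 1))))) ^ q ≤
      ENNReal.ofReal C * ∑' k, ENNReal.ofReal (ν k) := by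
  have hq0 : 0 < q := by linarith
  obtain ⟨C₁, hC₁, h₁⟩ := exists_tsum_decay_le hε (one_lt_pow₀ (one_lt_two (α := ℝ)) hn)
  obtain ⟨C₂, hC₂, h₂⟩ := exists_tsum_decay_le hε (one_lt_two)
  refine ⟨C₁ ^ (q - 1) * (C₂ * C₂), by positivity, fun ν hν => ?_⟩
  set w : ℤ → ℤ → ℤ → ℝ≥0∞ := fun m f k => ENNReal.ofReal (decay ε (2 ^ (f + 1) * (4 ^ k / ν k)) *
    decay ε (((2 : ℝ) ^ n) ^ k * 2 ^ (m + 1))) with hw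
  have hd1 : ∀ x, decay ε x ≤ 1 := fun x => by
    rw [decay]; exact Real.exp_le_one_iff.2 (by have := abs_nonneg (Real.log x); nlinarith)
  have hd0 : ∀ x, 0 ≤ decay ε x := fun x => (decay_pos ε x).le
  have hY : ∀ m f, (∑' k, ENNReal.ofReal (ν k ^ (1 / q) *
        (decay ε (2 ^ (f + 1) * (4 ^ k / ν k)) * decay ε (((2 : ℝ) ^ n) ^ k * 2 ^ (m + 1))))) ^ q ≤
        ENNReal.ofReal (C₁ ^ (q - 1)) * ∑' k, w m f k * ENNReal.ofReal (ν k) := by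
    intro m f
    have e : ∀ k, ENNReal.ofReal (ν k ^ (1 / q) * (decay ε (2 ^ (f + 1) * (4 ^ k / ν k)) *
        decay ε (((2 : ℝ) ^ n) ^ k * 2 ^ (m + 1)))) = w m f k * ENNReal.ofReal (ν k ^ (1 / q)) :=
      fun k => by
        rw [mul_comm (ν k ^ (1 / q)), ENNReal.ofReal_mul (mul_nonneg (hd0 _) (hd0 _))]
    have e' : ∀ k, ENNReal.ofReal (ν k ^ (1 / q)) ^ q = ENNReal.ofReal (ν k) := fun k => by
      rw [ENNReal.ofReal_rpow_of_nonneg (Real.rpow_nonneg (hν k) _) hq0.le, ← Real.rpow_mul (hν k),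
        one_div_mul_cancel hq0.ne', Real.rpow_one]
    simp only [e]
    refine (tsum_mul_rpow_le hq _ _).trans ?_
    simp only [e']
    gcongr
    rw [← ENNReal.ofReal_rpow_of_nonneg hC₁.le (by linarith)]
    refine ENNReal.rpow_le_rpow (le_trans ?_ (h₁ (2 ^ (m + 1)) (by positivity))) (by linarith)
    refine ENNReal.tsum_le_tsum fun k => ENNReal.ofReal_le_ofReal ?_
    exact mul_le_of_le_one_left (hd0 _) (hd1 _)
  calc _ ≤ ∑' m : ℤ, ∑' f : ℤ, ENNReal.ofReal (C₁ ^ (q - 1)) *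
        ∑' k, w m f k * ENNReal.ofReal (ν k) :=
        ENNReal.tsum_le_tsum fun m => ENNReal.tsum_le_tsum fun f => hY m f
    _ = ENNReal.ofReal (C₁ ^ (q - 1)) *
        ∑' k, (∑' m : ℤ, ∑' f : ℤ, w m f k) * ENNReal.ofReal (ν k) := by
        simp only [ENNReal.tsum_mul_left]
        congr 1
        simp only [← ENNReal.tsum_mul_right]
        rw [ENNReal.tsum_comm (β := ℤ) (f := fun k m => ∑' f, w m f k * ENNReal.ofReal (ν k))]
        exact tsum_congr fun m => ENNReal.tsum_comm
    _ ≤ ENNReal.ofReal (C₁ ^ (q - 1)) *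
        ∑' k, ENNReal.ofReal (C₂ * C₂) * ENNReal.ofReal (ν k) := by
        refine mul_le_mul_right (ENNReal.tsum_le_tsum fun k => ?_) _
        rcases (hν k).eq_or_lt with h | h
        · simp [← h]
        gcongr
        have hz : ∀ (z : ℤ) (x : ℝ), (2 : ℝ) ^ (z + 1) * x = 2 ^ z * (2 * x) := fun z x => by
          rw [zpow_add_one₀ two_ne_zero]; ring
        have e : ∀ m f, w m f k = ENNReal.ofReal (decay ε (2 ^ f * (2 * (4 ^ k / ν k)))) *
            ENNReal.ofReal (decay ε (2 ^ m * (2 * ((2 : ℝ) ^ n) ^ k))) := fun m f => by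
          rw [← ENNReal.ofReal_mul (hd0 _), ← hz, ← hz, mul_comm ((2 : ℝ) ^ (m + 1))]
        simp only [e, ENNReal.tsum_mul_right]
        rw [ENNReal.tsum_mul_left, ENNReal.ofReal_mul hC₂.le]
        exact mul_le_mul' (h₂ _ (by positivity)) (h₂ _ (by positivity))
    _ = _ := by
        rw [ENNReal.tsum_mul_left, ← mul_assoc, ← ENNReal.ofReal_mul (by positivity)]

/-- The estimate for finite systems with equal weights. -/
theorem exists_finset_bound (hn : 2 ≤ n) {p q s δ : ℝ} (hpq : IntOCDA n (1 / p) (1 / q))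
    (hs : 2 * s = n - (2 / q + n / p)) (hδ : 0 < δ) :
    ∃ C > 0, ∀ (J : Finset ℕ) (a : ℕ → Rn n → ℂ)
      (γ : ℕ → Lp ℂ 2 (volume : Measure (Rn n))), J.Nonempty → (∀ j ∈ J, Integrable (a j)) →
      (Orthonormal ℂ fun j : J => γ j) →
      (∀ j ∈ J, γ j =ᵐ[volume]
        fun ξ => (((2 * π) ^ (-(n / 2 : ℝ)) * ‖ξ‖ ^ s : ℝ) : ℂ) * a j ξ) →
      ∫⁻ t, (∫⁻ x, (∑ j ∈ J, ‖extend (a j) (t, x)‖ₑ ^ 2) ^ p) ^ (q / p) ≤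
        ENNReal.ofReal (C * (J.card : ℝ) ^ (1 + δ * q)) := by
  obtain ⟨hp1, hq1, hlt, hlt'⟩ := hpq
  have hp0 : 0 < p := one_div_pos.1 hp1.1
  have hq0 : 0 < q := one_div_pos.1 hq1.1
  have hn2 : (2 : ℝ) ≤ n := by exact_mod_cast hn
  have h1q : 1 ≤ q := by
    have := hq1.2; rw [div_lt_one hq0] at this; exact this.le
  have hlt2 : n * (1 / p) < (n - 1) * (1 / q) := by
    rw [div_mul_eq_mul_div, div_lt_iff₀ (by linarith)] at hlt; linarith
  have hqp : q ≤ p := by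
    have h : (n - 1 : ℝ) * (1 / q) ≤ n * (1 / q) := by
      have := hq1.1; nlinarith
    have h2 : 1 / p < 1 / q := lt_of_mul_lt_mul_left (hlt2.trans_le h) (by linarith)
    exact ((one_div_lt_one_div hp0 hq0).1 h2).le
  obtain ⟨K, hK, ε, hε, hres⟩ := exists_restricted_bound hn (β := 1 - 1 / q) (κ := 1 - 1 / p)
    (δ := δ) (s := s) ⟨by linarith [hq1.2], by linarith [hq1.1]⟩
    ⟨by linarith [hp1.2], by linarith [hp1.1]⟩ (by linarith) (by linarith) hδ
    (by rw [hs]; ring)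
  obtain ⟨C₁, hC₁, hlev⟩ := exists_level_set_bound (volume : Measure (Rn n)) h1q hqp
  obtain ⟨C₂, hC₂, hsum⟩ := exists_tsum_tsum_decay_le (n := n) (by omega) hε h1q
  refine ⟨C₁ * K ^ q * C₂, by positivity, fun J a γ hJ ha hγ hγa => ?_⟩
  obtain ⟨ν, hν, hνN, hslab⟩ := hres J a γ hJ ha hγ hγa
  have hN : (0 : ℝ) < J.card := by exact_mod_cast hJ.card_pos
  set ρ : ℝ × Rn n → ℝ≥0∞ := fun z => ∑ j ∈ J, ‖extend (a j) z‖ₑ ^ 2 with hρ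
  have hρm : Measurable ρ := by
    refine Finset.measurable_fun_sum _ fun j hj => ?_
    exact ((continuous_extend (ha j hj)).measurable.enorm).pow_const 2
  set Q : ℕ → Set (ℝ × Rn n) := fun R => Metric.closedBall 0 R ×ˢ Metric.closedBall 0 R with hQ
  have hQm : ∀ R, MeasurableSet (Q R) := fun R =>
    Metric.isClosed_closedBall.measurableSet.prod Metric.isClosed_closedBall.measurableSet
  have hQmono : Monotone Q := fun R R' h => by
    have h' : (R : ℝ) ≤ R' := by exact_mod_cast h
    exact prod_mono (Metric.closedBall_subset_closedBall h')
      (Metric.closedBall_subset_closedBall h')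
  set ρR : ℕ → ℝ × Rn n → ℝ≥0∞ := fun R => (Q R).indicator ρ with hρR
  have hρRm : ∀ R, Measurable (ρR R) := fun R => hρm.indicator (hQm R)
  have hmono : ∀ z, Monotone fun R => ρR R z := fun z R R' h =>
    indicator_le_indicator_of_subset (hQmono h) (fun _ => zero_le) z
  have hlim : ∀ z, Filter.Tendsto (fun R => ρR R z) Filter.atTop (nhds (ρ z)) := fun z => by
    refine tendsto_const_nhds.congr' ?_
    obtain ⟨R, hR⟩ := exists_nat_ge (max ‖z.1‖ ‖z.2‖)
    filter_upwards [Filter.eventually_ge_atTop R] with R' hR'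
    have h' : (R : ℝ) ≤ R' := by exact_mod_cast hR'
    refine (indicator_of_mem ?_ _).symm
    exact ⟨by simpa using (le_max_left _ _).trans (hR.trans h'),
      by simpa using (le_max_right _ _).trans (hR.trans h')⟩
  have hbound : ∀ R, ∫⁻ t, (∫⁻ x, ρR R (t, x) ^ p) ^ (q / p) ≤
      ENNReal.ofReal (C₁ * K ^ q * C₂ * (J.card : ℝ) ^ (1 + δ * q)) := fun R => by
    have h := hlev (ρR R) (K * (J.card : ℝ) ^ δ) (fun m f => ∑' k, ENNReal.ofReal (ν k ^ (1 / q) *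
        (decay ε (2 ^ (f + 1) * (4 ^ k / ν k)) * decay ε (((2 : ℝ) ^ n) ^ k * 2 ^ (m + 1)))))
      (Metric.closedBall 0 R) (Metric.closedBall 0 R) (hρRm R) (fun z => ?_) (by positivity)
      measure_closedBall_lt_top.ne measure_closedBall_lt_top.ne
      (fun z hz => ?_) (fun E F m f hE => ?_)
    · refine h.trans ?_
      refine (mul_le_mul_right ((hsum ν hν).trans (mul_le_mul_right hνN _)) _).trans ?_
      rw [← ENNReal.ofReal_natCast, ← ENNReal.ofReal_mul hC₂.le,
        ← ENNReal.ofReal_mul (by positivity)]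
      refine ENNReal.ofReal_le_ofReal (le_of_eq ?_)
      rw [Real.mul_rpow hK.le (by positivity), ← Real.rpow_mul hN.le, Real.rpow_add hN,
        Real.rpow_one]
      ring
    · refine ((indicator_le_self _ _ z).trans_lt ?_).ne
      exact ENNReal.sum_lt_top.2 fun j _ => by simp
    · have hz' : z ∈ Q R := by
        by_contra h; exact hz (indicator_of_notMem h _)
      exact hz'
    · refine (lintegral_mono fun z => indicator_le_self _ _ z).trans ?_
      have := hslab E F _ _ hE (by positivity) (by positivity)
      rwa [_root_.sub_sub_cancel] at this
  refine le_of_tendsto' (x := Filter.atTop) ?_ hbound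
  refine lintegral_tendsto_of_tendsto_of_monotone (fun R => ?_) ?_ ?_
  · exact (((hρRm R).pow_const p).lintegral_prod_right').pow_const _ |>.aemeasurable
  · refine Filter.Eventually.of_forall fun t R R' h => ?_
    refine ENNReal.rpow_le_rpow (lintegral_mono fun x => ?_) (by positivity)
    exact ENNReal.rpow_le_rpow (hmono _ h) hp0.le
  · refine Filter.Eventually.of_forall fun t => ?_
    refine (ENNReal.continuous_rpow_const.tendsto _).comp ?_
    refine lintegral_tendsto_of_tendsto_of_monotone (fun R => ?_) ?_ ?_
    · exact (((hρRm R).comp measurable_prodMk_left).pow_const p).aemeasurable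
    · exact Filter.Eventually.of_forall fun x R R' h => ENNReal.rpow_le_rpow (hmono _ h) hp0.le
    · exact Filter.Eventually.of_forall fun x =>
        (ENNReal.continuous_rpow_const.tendsto _).comp (hlim (t, x))

theorem continuous_FT (f : Rn n → ℂ) : Continuous (FT f) := by
  have hc : Continuous fun y : Rn n × Rn n => Complex.exp (-(Complex.I * dotC y.2 y.1)) := by
    simp only [dotC_eq_inner]
    fun_prop
  have h1 : ∀ ξ x : Rn n, ‖Complex.exp (-(Complex.I * dotC x ξ))‖ = 1 := fun ξ x => by
    rw [dotC_eq_inner, ← mul_neg, mul_comm, ← Complex.ofReal_neg, Complex.norm_exp_ofReal_mul_I]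
  by_cases hf : Integrable f
  · unfold FT
    refine continuous_of_dominated (bound := fun x => ‖f x‖) (fun ξ => ?_)
      (fun ξ => Filter.Eventually.of_forall fun x => by rw [norm_mul, h1, one_mul]) hf.norm
      (Filter.Eventually.of_forall fun x => ?_)
    · exact (hc.comp (Continuous.prodMk_right ξ)).aestronglyMeasurable.mul
        hf.aestronglyMeasurable
    · exact (hc.comp (Continuous.prodMk_left x)).mul continuous_const
  · have : FT f = fun _ => 0 := by
      ext ξ
      refine integral_undef fun h => hf ?_
      have h2 := h.bdd_mul (f := fun x => Complex.exp (Complex.I * dotC x ξ)) (c := 1) ?_ ?_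
      · refine h2.congr (Filter.Eventually.of_forall fun x => ?_)
        simp only
        rw [← mul_assoc, ← Complex.exp_add, add_neg_cancel, Complex.exp_zero, one_mul]
      · simp only [dotC_eq_inner]
        exact Continuous.aestronglyMeasurable (by fun_prop)
      · refine Filter.Eventually.of_forall fun x => ?_
        rw [dotC_eq_inner, mul_comm, Complex.norm_exp_ofReal_mul_I]
    rw [this]
    exact continuous_const

theorem schrodinger_eq_extend (f : Rn n → ℂ) (t : ℝ) (x : Rn n) :
    schrodinger f t x = extend (FT f) (t, x) := by
  simp [schrodinger, prop, extend, phase]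

theorem extend_eq_zero {a : Rn n → ℂ} (ha : ¬ Integrable a) (z : ℝ × Rn n) : extend a z = 0 := by
  rw [extend, integral_undef, smul_zero]
  intro h
  refine ha ?_
  have hc : Continuous fun ξ : Rn n => phase z ξ :=
    continuous_phase.comp (Continuous.prodMk_right z)
  have h2 := h.bdd_mul (f := fun ξ => (starRingEnd ℂ) (phase z ξ)) (c := 1)
    (Complex.continuous_conj.comp hc).aestronglyMeasurable
    (Filter.Eventually.of_forall fun ξ => by rw [RCLike.norm_conj, norm_phase])
  refine h2.congr (Filter.Eventually.of_forall fun ξ => ?_)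
  simp only
  rw [← mul_assoc, ← Complex.normSq_eq_conj_mul_self, Complex.normSq_eq_norm_sq, norm_phase]
  simp

/-- Orthonormality in `Ḣ^s` as orthonormality of the normalised frequency profiles in `L²`. -/
theorem exists_orthonormal_profile {s : ℝ} (hs : 0 ≤ s) {f : ℕ → Rn n → ℂ}
    (h : OrthonormalHs s f) :
    ∃ γ : ℕ → Lp ℂ 2 (volume : Measure (Rn n)), Orthonormal ℂ γ ∧ ∀ j, γ j =ᵐ[volume]
      fun ξ => (((2 * π) ^ (-(n / 2 : ℝ)) * ‖ξ‖ ^ s : ℝ) : ℂ) * FT (f j) ξ := by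
  set g : ℕ → Rn n → ℂ := fun j ξ => (((2 * π) ^ (-(n / 2 : ℝ)) * ‖ξ‖ ^ s : ℝ) : ℂ) * FT (f j) ξ
    with hg
  have hgm : ∀ j, AEStronglyMeasurable (g j) volume := fun j => by
    refine Continuous.aestronglyMeasurable (Continuous.mul ?_ (continuous_FT _))
    exact Complex.continuous_ofReal.comp
      (continuous_const.mul (continuous_norm.rpow_const fun _ => Or.inr hs))
  have hmul : ∀ j k ξ, g k ξ * (starRingEnd ℂ) (g j ξ) = ((2 * π : ℝ) ^ (-(n : ℝ)) : ℝ) •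
      (((‖ξ‖ ^ (2 * s) : ℝ) : ℂ) * (FT (f k) ξ * (starRingEnd ℂ) (FT (f j) ξ))) := fun j k ξ => by
    have e : ((2 * π : ℝ) ^ (-(n : ℝ)) : ℝ) =
        (2 * π) ^ (-(n / 2 : ℝ)) * (2 * π) ^ (-(n / 2 : ℝ)) := by
      rw [← Real.rpow_add (by positivity)]; congr 1; ring
    have e' : ‖ξ‖ ^ (2 * s) = ‖ξ‖ ^ s * ‖ξ‖ ^ s := by
      rw [two_mul, Real.rpow_add_of_nonneg (norm_nonneg _) hs hs]
    rw [hg, e, e', Complex.real_smul, map_mul, Complex.conj_ofReal]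
    push_cast
    ring
  have hinner : ∀ j k, ∫ ξ, g k ξ * (starRingEnd ℂ) (g j ξ) = if k = j then 1 else 0 := fun j k => by
    rw [← h k j, ← integral_smul]
    exact integral_congr_ae (Filter.Eventually.of_forall fun ξ => hmul j k ξ)
  have hL : ∀ j, MemLp (g j) 2 volume := fun j => by
    rw [memLp_two_iff_integrable_sq_norm (hgm j)]
    have h1 : Integrable fun ξ => g j ξ * (starRingEnd ℂ) (g j ξ) := by
      by_contra h0
      have := hinner j j
      rw [integral_undef h0] at this
      simp at this
    refine h1.norm.congr (Filter.Eventually.of_forall fun ξ => ?_)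
    simp [sq]
  refine ⟨fun j => (hL j).toLp (g j), ?_, fun j => (hL j).coeFn_toLp⟩
  rw [orthonormal_iff_ite]
  intro j k
  rw [L2.inner_def]
  have : ∫ ξ, ⟪(hL j).toLp (g j) ξ, (hL k).toLp (g k) ξ⟫_ℂ =
      ∫ ξ, g k ξ * (starRingEnd ℂ) (g j ξ) := by
    refine integral_congr_ae ?_
    filter_upwards [(hL j).coeFn_toLp, (hL k).coeFn_toLp] with ξ h1 h2
    rw [h1, h2, RCLike.inner_apply]
  rw [this, hinner]
  simp [eq_comm]

theorem lintegral_tsum_rpow_le {α : Type*} [MeasurableSpace α] {μ : Measure α} {p : ℝ} (hp : 1 ≤ p)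
    {F : ℕ → α → ℝ≥0∞} (hF : ∀ m, Measurable (F m)) :
    (∫⁻ x, (∑' m, F m x) ^ p ∂μ) ^ (1 / p) ≤ ∑' m, (∫⁻ x, F m x ^ p ∂μ) ^ (1 / p) := by
  have hp0 : 0 < p := by linarith
  have hfin : ∀ N, (∫⁻ x, (∑ m ∈ Finset.range N, F m x) ^ p ∂μ) ^ (1 / p) ≤
      ∑ m ∈ Finset.range N, (∫⁻ x, F m x ^ p ∂μ) ^ (1 / p) := by
    intro N
    induction N with
    | zero => simp [hp0]
    | succ N ih =>
      simp only [Finset.sum_range_succ]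
      refine le_trans ?_ (add_le_add_left ih _)
      exact ENNReal.lintegral_Lp_add_le
        (Finset.measurable_fun_sum _ fun m _ => hF m).aemeasurable (hF N).aemeasurable hp
  refine le_of_tendsto' (x := Filter.atTop) ?_ fun N => (hfin N).trans (ENNReal.sum_le_tsum _)
  refine (ENNReal.continuous_rpow_const.tendsto _).comp ?_
  refine lintegral_tendsto_of_tendsto_of_monotone (fun N => ?_) ?_ ?_
  · exact ((Finset.measurable_fun_sum _ fun m _ => hF m).pow_const p).aemeasurable
  · refine Filter.Eventually.of_forall fun x N N' h => ENNReal.rpow_le_rpow ?_ hp0.le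
    exact Finset.sum_le_sum_of_subset (Finset.range_mono h)
  · exact Filter.Eventually.of_forall fun x =>
      (ENNReal.continuous_rpow_const.tendsto _).comp (ENNReal.tendsto_nat_tsum _)

theorem lintegral_lintegral_tsum_rpow_le {X : Type*} [MeasurableSpace X] {μ : Measure X} [SFinite μ]
    {p q : ℝ} (hp : 1 ≤ p) (hq : 1 ≤ q) {F : ℕ → ℝ × X → ℝ≥0∞} (hF : ∀ m, Measurable (F m)) :
    (∫⁻ t, (∫⁻ x, (∑' m, F m (t, x)) ^ p ∂μ) ^ (q / p)) ^ (1 / q) ≤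
      ∑' m, (∫⁻ t, (∫⁻ x, F m (t, x) ^ p ∂μ) ^ (q / p)) ^ (1 / q) := by
  have hq0 : 0 < q := by linarith
  have e : ∀ x : ℝ≥0∞, x ^ (q / p) = (x ^ (1 / p)) ^ q := fun x => by
    rw [← ENNReal.rpow_mul]; congr 1; ring
  simp only [e]
  refine le_trans (ENNReal.rpow_le_rpow (lintegral_mono fun t => ENNReal.rpow_le_rpow
    (lintegral_tsum_rpow_le hp fun m => (hF m).comp measurable_prodMk_left) hq0.le)
    (by positivity)) ?_
  exact lintegral_tsum_rpow_le hq fun m =>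
    (((hF m).pow_const p).lintegral_prod_right').pow_const _

theorem exists_level_sets {α Λ : ℝ} (hα : 0 < α) (hΛ : 0 < Λ) {lam : ℕ → ℝ}
    (h : ∑' j, ENNReal.ofReal |lam j| ^ α = ENNReal.ofReal (Λ ^ α)) :
    ∃ J : ℕ → Finset ℕ, (∀ m, ((J m).card : ℝ) ≤ (2 ^ (m + 1)) ^ α) ∧
      (∀ m, ∀ j ∈ J m, |lam j| ≤ Λ * (1 / 2) ^ m) ∧ ∀ j, lam j ≠ 0 → ∃ m, j ∈ J m := by
  have hpow : ∀ j, ENNReal.ofReal |lam j| ^ α = ENNReal.ofReal (|lam j| ^ α) := fun j =>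
    ENNReal.ofReal_rpow_of_nonneg (abs_nonneg _) hα.le
  simp only [hpow] at h
  have hfin : ∀ m : ℕ, ∃ J : Finset ℕ, (∀ j, j ∈ J ↔ Λ * (1 / 2) ^ (m + 1) ≤ |lam j| ∧
      |lam j| ≤ Λ * (1 / 2) ^ m) ∧ (J.card : ℝ) ≤ (2 ^ (m + 1)) ^ α := fun m => by
    have hc : 0 < (Λ * (1 / 2) ^ (m + 1)) ^ α := by positivity
    obtain ⟨hf, hcard⟩ := ENNReal.finset_card_const_le_le_of_tsum_le ENNReal.ofReal_ne_top h.le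
      (ε := ENNReal.ofReal ((Λ * (1 / 2) ^ (m + 1)) ^ α)) (by simpa using hc)
    refine ⟨hf.toFinset.filter fun j => |lam j| ≤ Λ * (1 / 2) ^ m, fun j => ?_, ?_⟩
    · simp only [Finset.mem_filter, Set.Finite.mem_toFinset, Set.mem_ofPred_eq]
      rw [ENNReal.ofReal_le_ofReal_iff (by positivity),
        Real.rpow_le_rpow_iff (by positivity) (abs_nonneg _) hα]
    · rw [← ENNReal.ofReal_div_of_pos hc, ← ENNReal.ofReal_natCast,
        ENNReal.ofReal_le_ofReal_iff (by positivity),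
        ← Real.div_rpow hΛ.le (by positivity)] at hcard
      have e : Λ / (Λ * (1 / 2) ^ (m + 1)) = 2 ^ (m + 1) := by
        rw [one_div, inv_pow]; field_simp
      rw [e] at hcard
      exact le_trans (by exact_mod_cast Finset.card_filter_le _ _) hcard
  choose J hJ hcard using hfin
  refine ⟨J, hcard, fun m j hj => ((hJ m j).1 hj).2, fun j hj => ?_⟩
  have h0 : 0 < |lam j| := abs_pos.2 hj
  have h1 : |lam j| ≤ Λ := by
    have := (ENNReal.le_tsum j).trans h.le
    rwa [ENNReal.ofReal_le_ofReal_iff (by positivity),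
      Real.rpow_le_rpow_iff (abs_nonneg _) hΛ.le hα] at this
  obtain ⟨m, hm1, hm2⟩ := exists_nat_pow_near_of_lt_one (div_pos h0 hΛ) ((div_le_one hΛ).2 h1)
    (one_half_pos (α := ℝ)) one_half_lt_one
  refine ⟨m, (hJ m j).2 ⟨?_, ?_⟩⟩
  · rw [lt_div_iff₀ hΛ] at hm1; linarith
  · rw [div_le_iff₀ hΛ] at hm2; linarith

theorem exists_mixedLp_density_le (hn : 2 ≤ n) {p q s α : ℝ} (hpq : IntOCDA n (1 / p) (1 / q))
    (hs : 2 * s = n - (2 / q + n / p)) (hα : 1 ≤ α) (hαq : α < q) :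
    ∃ C : ℝ, 0 < C ∧ ∀ (f : ℕ → Rn n → ℂ) (lam : ℕ → ℝ),
      OrthonormalHs s f → seqNormE (ENNReal.ofReal α) lam ≠ ∞ →
      mixedLp (ENNReal.ofReal q) (ENNReal.ofReal p) (density lam f)
        ≤ ENNReal.ofReal C * seqNormE (ENNReal.ofReal α) lam := by
  classical
  have hp1 := hpq.1
  have hq1 := hpq.2.1
  have hp0 : 0 < p := one_div_pos.1 hp1.1
  have hq0 : 0 < q := one_div_pos.1 hq1.1
  have hα0 : 0 < α := by linarith
  have h1q : 1 ≤ q := by linarith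
  have h1p : 1 ≤ p := by
    have := hp1.2; rw [div_lt_one hp0] at this; exact this.le
  have hs0 : 0 ≤ s := by
    have := hpq.2.2.2
    have e : 2 / q + n / p = 2 * (1 / q) + n * (1 / p) := by ring
    linarith
  obtain ⟨δ, hδ, hθ⟩ : ∃ δ, 0 < δ ∧ α * (1 / q + δ) < 1 := by
    refine ⟨(1 / α - 1 / q) / 2, half_pos (sub_pos.2 (one_div_lt_one_div_of_lt hα0 hαq)), ?_⟩
    have h1 : α * (1 / q) < 1 := by rw [mul_one_div]; exact (div_lt_one hq0).2 hαq
    have h2 : α * (1 / α) = 1 := mul_one_div_cancel hα0.ne'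
    nlinarith
  set θ := α * (1 / q + δ) with hθd
  have hθ0 : 0 < θ := by have := hq1.1; positivity
  obtain ⟨C₀, hC₀, hfinset⟩ := exists_finset_bound hn hpq hs hδ
  set r : ℝ := 2 ^ (θ - 1) with hr
  have hr0 : 0 < r := by positivity
  have hr1 : r < 1 := Real.rpow_lt_one_of_one_lt_of_neg one_lt_two (by linarith)
  have hgeo := (hasSum_geometric_of_lt_one hr0.le hr1)
  have h1r : 0 < 1 - r := by linarith
  have hq0' : 0 ≤ 1 / q := hq1.1.le
  clear_value r θ
  refine ⟨C₀ ^ (1 / q) * 2 ^ θ * (1 - r)⁻¹, by positivity, fun f lam hf hlam => ?_⟩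
  have hαt : (ENNReal.ofReal α).toReal = α := ENNReal.toReal_ofReal hα0.le
  have hpt : (ENNReal.ofReal p).toReal = p := ENNReal.toReal_ofReal hp0.le
  have hqt : (ENNReal.ofReal q).toReal = q := ENNReal.toReal_ofReal hq0.le
  rw [seqNormE, if_neg ENNReal.ofReal_ne_top, hαt] at hlam ⊢
  -- the density is dominated termwise
  set ρ : ℕ → ℝ × Rn n → ℝ≥0∞ := fun j z => ‖extend (FT (f j)) z‖ₑ ^ 2 with hρ
  have hdens : ∀ t x, ‖density lam f t x‖ₑ ≤ ∑' j, ENNReal.ofReal |lam j| * ρ j (t, x) := by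
    intro t x
    refine enorm_tsum_le_tsum_enorm.trans (le_of_eq (tsum_congr fun j => ?_))
    rw [enorm_mul, Real.enorm_eq_ofReal_abs, enorm_pow, enorm_norm]
    simp only [hρ, schrodinger_eq_extend]
  have hmixed : mixedLp (ENNReal.ofReal q) (ENNReal.ofReal p) (density lam f) ≤
      (∫⁻ t, (∫⁻ x, (∑' j, ENNReal.ofReal |lam j| * ρ j (t, x)) ^ p) ^ (q / p)) ^ (1 / q) := by
    rw [mixedLp, eLp, if_neg ENNReal.ofReal_ne_top, hqt]
    refine ENNReal.rpow_le_rpow (lintegral_mono fun t => ?_) (by positivity)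
    simp only
    rw [eLpNorm_eq_lintegral_rpow_enorm_toReal (by simpa using hp0) ENNReal.ofReal_ne_top, hpt,
      ← ENNReal.rpow_mul, show 1 / p * q = q / p by ring]
    refine ENNReal.rpow_le_rpow (lintegral_mono fun x => ?_) (by positivity)
    exact ENNReal.rpow_le_rpow (hdens t x) hp0.le
  refine hmixed.trans ?_
  set S := ∑' j, ENNReal.ofReal |lam j| ^ α with hS
  have hSt : S ≠ ∞ := fun h => hlam (by rw [h, ENNReal.top_rpow_of_pos (by positivity)])
  rcases eq_or_ne S 0 with h0 | h0
  · have hl : ∀ j, ENNReal.ofReal |lam j| = 0 := fun j => by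
      have := ENNReal.tsum_eq_zero.1 h0 j
      rwa [ENNReal.rpow_eq_zero_iff_of_pos hα0] at this
    simp [hl, hp0, hq0, div_pos hq0 hp0]
  set Λ := S.toReal ^ (1 / α) with hΛ
  have hΛ0 : 0 < Λ := Real.rpow_pos_of_pos (ENNReal.toReal_pos h0 hSt) _
  have hSΛ : S ^ (1 / α) = ENNReal.ofReal Λ := by
    rw [hΛ, ← ENNReal.ofReal_rpow_of_nonneg ENNReal.toReal_nonneg (by positivity),
      ENNReal.ofReal_toReal hSt]
  have hSΛ' : S = ENNReal.ofReal (Λ ^ α) := by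
    rw [← ENNReal.ofReal_rpow_of_pos hΛ0, ← hSΛ, ← ENNReal.rpow_mul, one_div_mul_cancel hα0.ne',
      ENNReal.rpow_one]
  obtain ⟨J, hJc, hJl, hJm⟩ := exists_level_sets hα0 hΛ0 hSΛ'
  obtain ⟨γ, hγ, hγa⟩ := exists_orthonormal_profile hs0 hf
  set J' : ℕ → Finset ℕ := fun m => (J m).filter fun j => Integrable (FT (f j)) with hJ'
  have hρm : ∀ m, Measurable fun z => ∑ j ∈ J' m, ρ j z := fun m => by
    refine Finset.measurable_fun_sum _ fun j hj => ?_
    exact ((continuous_extend (Finset.mem_filter.1 hj).2).measurable.enorm).pow_const 2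
  have hterm : ∀ z, ∑' j, ENNReal.ofReal |lam j| * ρ j z ≤
      ∑' m : ℕ, ENNReal.ofReal (Λ * (1 / 2) ^ m) * ∑ j ∈ J' m, ρ j z := by
    intro z
    calc _ ≤ ∑' j, ∑' m : ℕ, ENNReal.ofReal (Λ * (1 / 2) ^ m) *
          (if j ∈ J' m then ρ j z else 0) := by
          refine ENNReal.tsum_le_tsum fun j => ?_
          by_cases hl : lam j = 0
          · simp [hl]
          by_cases hi : Integrable (FT (f j))
          · obtain ⟨m, hm⟩ := hJm j hl
            refine le_trans ?_ (ENNReal.le_tsum m)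
            rw [if_pos (Finset.mem_filter.2 ⟨hm, hi⟩)]
            gcongr
            exact hJl m j hm
          · simp [hρ, extend_eq_zero hi]
      _ = _ := by
          rw [ENNReal.tsum_comm]
          refine tsum_congr fun m => ?_
          rw [ENNReal.tsum_mul_left, tsum_eq_sum (s := J' m) fun j hj => if_neg hj]
          congr 1
          exact Finset.sum_congr rfl fun j hj => if_pos hj
  have hblock : ∀ m : ℕ, (∫⁻ t, (∫⁻ x, (∑ j ∈ J' m, ρ j (t, x)) ^ p) ^ (q / p)) ^ (1 / q) ≤
      ENNReal.ofReal (C₀ ^ (1 / q) * (2 ^ (m + 1)) ^ θ) := fun m => by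
    rcases (J' m).eq_empty_or_nonempty with h | h
    · simp [h, hp0, hq0, div_pos hq0 hp0]
    have h1 := hfinset (J' m) (fun j => FT (f j)) γ h (fun j hj => (Finset.mem_filter.1 hj).2)
      (hγ.comp _ Subtype.val_injective) fun j _ => hγa j
    have hJ0 : (0 : ℝ) ≤ (J' m).card := Nat.cast_nonneg _
    refine (ENNReal.rpow_le_rpow h1 hq0').trans ?_
    rw [ENNReal.ofReal_rpow_of_nonneg (mul_nonneg hC₀.le (Real.rpow_nonneg hJ0 _)) hq0']
    refine ENNReal.ofReal_le_ofReal ?_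
    have hc : ((J' m).card : ℝ) ≤ (2 ^ (m + 1)) ^ α :=
      le_trans (by exact_mod_cast Finset.card_filter_le _ _) (hJc m)
    rw [Real.mul_rpow hC₀.le (Real.rpow_nonneg hJ0 _), ← Real.rpow_mul hJ0,
      show (1 + δ * q) * (1 / q) = 1 / q + δ by field_simp, hθd, Real.rpow_mul (by positivity)]
    exact mul_le_mul_of_nonneg_left (Real.rpow_le_rpow hJ0 hc (add_nonneg hq0' hδ.le))
      (Real.rpow_nonneg hC₀.le _)
  calc _ ≤ (∫⁻ t, (∫⁻ x, (∑' m : ℕ, ENNReal.ofReal (Λ * (1 / 2) ^ m) *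
          ∑ j ∈ J' m, ρ j (t, x)) ^ p) ^ (q / p)) ^ (1 / q) := by
        refine ENNReal.rpow_le_rpow (lintegral_mono fun t => ENNReal.rpow_le_rpow
          (lintegral_mono fun x => ENNReal.rpow_le_rpow (hterm (t, x)) hp0.le) ?_) hq0'
        exact div_nonneg hq0.le hp0.le
    _ ≤ ∑' m : ℕ, (∫⁻ t, (∫⁻ x, (ENNReal.ofReal (Λ * (1 / 2) ^ m) *
          ∑ j ∈ J' m, ρ j (t, x)) ^ p) ^ (q / p)) ^ (1 / q) :=
        lintegral_lintegral_tsum_rpow_le h1p h1q fun m => (hρm m).const_mul _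
    _ = ∑' m : ℕ, ENNReal.ofReal (Λ * (1 / 2) ^ m) *
          (∫⁻ t, (∫⁻ x, (∑ j ∈ J' m, ρ j (t, x)) ^ p) ^ (q / p)) ^ (1 / q) := by
        refine tsum_congr fun m => ?_
        have hqp0 : 0 ≤ q / p := by positivity
        simp only [ENNReal.mul_rpow_of_nonneg _ _ hp0.le]
        have hm1 : Measurable fun z => (∑ j ∈ J' m, ρ j z) ^ p := (hρm m).pow_const p
        have hx : ∀ t, ∫⁻ x, ENNReal.ofReal (Λ * (1 / 2) ^ m) ^ p * (∑ j ∈ J' m, ρ j (t, x)) ^ p =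
            ENNReal.ofReal (Λ * (1 / 2) ^ m) ^ p * ∫⁻ x, (∑ j ∈ J' m, ρ j (t, x)) ^ p := fun t =>
          lintegral_const_mul _ (hm1.comp measurable_prodMk_left)
        simp only [hx, ENNReal.mul_rpow_of_nonneg _ _ hqp0]
        rw [lintegral_const_mul _ (hm1.lintegral_prod_right'.pow_const _),
          ENNReal.mul_rpow_of_nonneg _ _ (by positivity), ← ENNReal.rpow_mul, ← ENNReal.rpow_mul,
          show p * (q / p * (1 / q)) = 1 by field_simp, ENNReal.rpow_one]
    _ ≤ ∑' m : ℕ, ENNReal.ofReal (Λ * (1 / 2) ^ m) *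
          ENNReal.ofReal (C₀ ^ (1 / q) * (2 ^ (m + 1)) ^ θ) :=
        ENNReal.tsum_le_tsum fun m => mul_le_mul_right (hblock m) _
    _ = ∑' m : ℕ, ENNReal.ofReal (Λ * C₀ ^ (1 / q) * 2 ^ θ) * ENNReal.ofReal (r ^ m) := by
        refine tsum_congr fun m => ?_
        rw [← ENNReal.ofReal_mul (by positivity), ← ENNReal.ofReal_mul (by positivity)]
        congr 1
        have e : ((2 : ℝ) ^ (m + 1)) ^ θ = (2 ^ θ) ^ m * 2 ^ θ := by
          rw [← Real.rpow_natCast, ← Real.rpow_natCast, ← Real.rpow_mul zero_le_two,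
            ← Real.rpow_mul zero_le_two, ← Real.rpow_add two_pos]
          congr 1; push_cast; ring
        rw [e, hr, Real.rpow_sub_one two_ne_zero, div_pow, div_pow, one_pow]
        ring
    _ = _ := by
        rw [ENNReal.tsum_mul_left, ← ENNReal.ofReal_tsum_of_nonneg (fun m => by positivity)
          hgeo.summable, hgeo.tsum_eq, hSΛ, ← ENNReal.ofReal_mul (by positivity),
          ← ENNReal.ofReal_mul (by positivity)]
        congr 1; ring

theorem exists_FT_eq {a : Rn n → ℂ} (ha : ContDiff ℝ (⊤ : ℕ∞) a) (hc : HasCompactSupport a) :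
    ∃ f : Rn n → ℂ, FT f = a := by
  have h2π : (2 * π : ℝ) ≠ 0 := by positivity
  set g : SchwartzMap (Rn n) ℂ := HasCompactSupport.toSchwartzMap (f := fun w => a ((2 * π) • w))
    (hc.comp_smul h2π) (ha.comp (contDiff_const_smul _)) with hg
  refine ⟨FourierTransformInv.fourierInv g, ?_⟩
  ext ξ
  have h1 : FourierTransform.fourier (FourierTransformInv.fourierInv g) = g :=
    FourierTransform.fourier_fourierInv_eq g
  have h2 := congrArg (fun h : SchwartzMap (Rn n) ℂ => h ((2 * π)⁻¹ • ξ)) h1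
  simp only [SchwartzMap.fourier_coe, Real.fourier_eq'] at h2
  have h3 : g ((2 * π)⁻¹ • ξ) = a ξ := by
    change a ((2 * π) • (2 * π)⁻¹ • ξ) = a ξ
    rw [smul_inv_smul₀ h2π]
  rw [h3] at h2
  rw [← h2]
  refine integral_congr_ae (Filter.Eventually.of_forall fun x => ?_)
  simp only [smul_eq_mul, dotC_eq_inner, inner_smul_right]
  congr 2
  push_cast
  field_simp

/-- The `Ḣ^s`-normalised dilate of the frequency profile `φ` to frequencies `∼ R`. -/
def packet (s : ℝ) (φ : Rn n → ℝ) (R : ℝ) (ξ : Rn n) : ℝ := R ^ (-(s + n / 2)) * φ (R⁻¹ • ξ)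

/-- A profile for wave packets, normalised in `Ḣ^s` and supported in `3/4 < |ξ| < 5/4`. -/
structure IsProfile (s : ℝ) (φ : Rn n → ℝ) : Prop where
  smooth : ContDiff ℝ (⊤ : ℕ∞) φ
  compact : HasCompactSupport φ
  nonneg : ∀ ξ, 0 ≤ φ ξ
  supp : ∀ ξ, φ ξ ≠ 0 → ‖ξ‖ ∈ Ioo (3 / 4 : ℝ) (5 / 4)
  normalised : (2 * π) ^ (-(n : ℝ)) * ∫ ξ, ‖ξ‖ ^ (2 * s) * φ ξ ^ 2 = 1
  pos : 0 < ∫ ξ, φ ξ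

theorem exists_isProfile (hn : 1 ≤ n) {s : ℝ} (hs : 0 ≤ s) : ∃ φ : Rn n → ℝ, IsProfile s φ := by
  obtain ⟨e, he⟩ : ∃ e : Rn n, ‖e‖ = 1 := ⟨EuclideanSpace.single ⟨0, hn⟩ 1, by simp⟩
  obtain ⟨ψ, hout⟩ : ∃ ψ : ContDiffBump e, ψ.rOut = 1 / 4 :=
    ⟨⟨1 / 8, 1 / 4, by norm_num, by norm_num⟩, rfl⟩
  have hψe : ψ e = 1 := ψ.one_of_mem_closedBall (Metric.mem_closedBall_self ψ.rIn_pos.le)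
  have hψc : Continuous (ψ : Rn n → ℝ) := ψ.continuous
  have hcs : HasCompactSupport fun ξ : Rn n => ‖ξ‖ ^ (2 * s) * ψ ξ ^ 2 := by
    refine ψ.hasCompactSupport.mono fun ξ hξ => ?_
    simp only [Function.mem_support, ne_eq] at hξ ⊢
    exact fun h => hξ (by simp [h])
  have hK : 0 < ∫ ξ : Rn n, ‖ξ‖ ^ (2 * s) * ψ ξ ^ 2 := by
    refine Continuous.integral_pos_of_hasCompactSupport_nonneg_nonzero (x := e)
      ((continuous_norm.rpow_const fun _ => Or.inr (by positivity)).mul (hψc.pow 2)) hcs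
      (fun ξ => by positivity) (by simp [he, hψe])
  obtain ⟨K, hKd⟩ : ∃ K, K = ∫ ξ : Rn n, ‖ξ‖ ^ (2 * s) * ψ ξ ^ 2 := ⟨_, rfl⟩
  rw [← hKd] at hK
  have hM : 0 < ∫ ξ : Rn n, ψ ξ :=
    Continuous.integral_pos_of_hasCompactSupport_nonneg_nonzero (x := e) hψc ψ.hasCompactSupport
      (fun ξ => ψ.nonneg) (by simp [hψe])
  have hP : 0 < (2 * π : ℝ) ^ (-(n : ℝ)) * K := mul_pos (Real.rpow_pos_of_pos (by positivity) _) hK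
  refine ⟨fun ξ => (√((2 * π : ℝ) ^ (-(n : ℝ)) * K))⁻¹ * ψ ξ, ⟨contDiff_const.mul ψ.contDiff,
    ψ.hasCompactSupport.mul_left, fun ξ => mul_nonneg (by positivity) ψ.nonneg, fun ξ hξ => ?_,
    ?_, ?_⟩⟩
  · have h1 : ξ ∈ Function.support ψ := right_ne_zero_of_mul hξ
    rw [ψ.support_eq, Metric.mem_ball, dist_eq_norm, hout] at h1
    have h3 := norm_sub_norm_le e ξ
    have h4 := norm_sub_norm_le ξ e
    rw [norm_sub_rev] at h3
    rw [he] at h3 h4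
    constructor <;> linarith
  · simp only [mul_pow, inv_pow, Real.sq_sqrt hP.le]
    have : ∀ ξ : Rn n, ‖ξ‖ ^ (2 * s) * (((2 * π : ℝ) ^ (-(n : ℝ)) * K)⁻¹ * ψ ξ ^ 2) =
        ((2 * π : ℝ) ^ (-(n : ℝ)) * K)⁻¹ * (‖ξ‖ ^ (2 * s) * ψ ξ ^ 2) := fun ξ => by ring
    simp only [this]
    rw [integral_const_mul, ← hKd, mul_left_comm, inv_mul_cancel₀ hP.ne']
  · rw [integral_const_mul]
    exact mul_pos (inv_pos.2 (Real.sqrt_pos.2 hP)) hM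

section packet

variable {s R : ℝ} {φ : Rn n → ℝ}

theorem IsProfile.norm_mem (h : IsProfile s φ) (hR : 0 < R) {ξ : Rn n} (hξ : packet s φ R ξ ≠ 0) :
    ‖ξ‖ ∈ Ioo (3 / 4 * R) (5 / 4 * R) := by
  have := h.supp _ (right_ne_zero_of_mul hξ)
  rw [norm_smul, norm_inv, Real.norm_of_nonneg hR.le, inv_mul_eq_div] at this
  exact ⟨(lt_div_iff₀ hR).1 this.1, (div_lt_iff₀ hR).1 this.2⟩

theorem IsProfile.contDiff_packet (h : IsProfile s φ) (R : ℝ) :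
    ContDiff ℝ (⊤ : ℕ∞) (packet s φ R) :=
  contDiff_const.mul (h.smooth.comp (contDiff_const_smul _))

theorem IsProfile.hasCompactSupport_packet (h : IsProfile s φ) (hR : 0 < R) :
    HasCompactSupport (packet s φ R) :=
  (h.compact.comp_smul (inv_ne_zero hR.ne')).mul_left

theorem IsProfile.integrable_packet (h : IsProfile s φ) (hR : 0 < R) :
    Integrable (packet s φ R) :=
  (h.contDiff_packet R).continuous.integrable_of_hasCompactSupport (h.hasCompactSupport_packet hR)

theorem IsProfile.packet_nonneg (h : IsProfile s φ) (hR : 0 < R) (ξ : Rn n) :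
    0 ≤ packet s φ R ξ := mul_nonneg (by positivity) (h.nonneg _)

theorem integral_dilate (hR : 0 < R) (g : Rn n → ℝ) :
    ∫ ξ, g (R⁻¹ • ξ) = R ^ (n : ℝ) * ∫ ξ, g ξ := by
  rw [Measure.integral_comp_smul, finrank_euclideanSpace_fin, inv_pow, inv_inv,
    abs_of_pos (by positivity), smul_eq_mul, Real.rpow_natCast]

theorem integral_packet (hR : 0 < R) :
    ∫ ξ, packet s φ R ξ = R ^ (n / 2 - s) * ∫ ξ, φ ξ := by
  unfold packet
  rw [integral_const_mul, integral_dilate hR, ← mul_assoc, ← Real.rpow_add hR]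
  congr 2; ring

theorem IsProfile.integral_packet_sq (h : IsProfile s φ) (hR : 0 < R) :
    (2 * π) ^ (-(n : ℝ)) * ∫ ξ, ‖ξ‖ ^ (2 * s) * (packet s φ R ξ * packet s φ R ξ) = 1 := by
  have e : ∀ ξ : Rn n, ‖ξ‖ ^ (2 * s) * (packet s φ R ξ * packet s φ R ξ) =
      R ^ (-(n : ℝ)) * (fun ξ => ‖ξ‖ ^ (2 * s) * φ ξ ^ 2) (R⁻¹ • ξ) := fun ξ => by
    have e1 : ‖R⁻¹ • ξ‖ ^ (2 * s) = R ^ (-(2 * s)) * ‖ξ‖ ^ (2 * s) := by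
      rw [norm_smul, norm_inv, Real.norm_of_nonneg hR.le, Real.mul_rpow (by positivity)
        (norm_nonneg _), Real.inv_rpow hR.le, Real.rpow_neg hR.le]
    have e2 : R ^ (-(n : ℝ)) * R ^ (-(2 * s)) = R ^ (-(s + n / 2)) * R ^ (-(s + n / 2)) := by
      rw [← Real.rpow_add hR, ← Real.rpow_add hR]; congr 1; ring
    simp only [packet, e1]
    linear_combination (-(‖ξ‖ ^ (2 * s) * φ (R⁻¹ • ξ) ^ 2)) * e2
  rw [integral_congr_ae (Filter.Eventually.of_forall e), integral_const_mul,
    integral_dilate hR fun ξ => ‖ξ‖ ^ (2 * s) * φ ξ ^ 2, ← mul_assoc (R ^ (-(n : ℝ))),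
    ← Real.rpow_add hR,
    neg_add_cancel, Real.rpow_zero, one_mul, h.normalised]

theorem IsProfile.orthonormalHs (h : IsProfile s φ) {f : ℕ → Rn n → ℂ}
    (hf : ∀ j, FT (f j) = fun ξ => ((packet s φ (2 ^ j) ξ : ℝ) : ℂ)) : OrthonormalHs s f := by
  intro j k
  simp only [hf, Complex.conj_ofReal, ← Complex.ofReal_mul, integral_complex_ofReal,
    Complex.real_smul]
  split_ifs with hjk
  · subst hjk
    rw [h.integral_packet_sq (by positivity), Complex.ofReal_one]
  · have : ∀ i l : ℕ, i < l → ∀ ξ, packet s φ (2 ^ i) ξ * packet s φ (2 ^ l) ξ = 0 := by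
      intro i l hil ξ
      by_contra h0
      have h1 := (h.norm_mem (by positivity) (left_ne_zero_of_mul h0)).2
      have h2 := (h.norm_mem (by positivity) (right_ne_zero_of_mul h0)).1
      have h3 : (2 : ℝ) ^ (i + 1) ≤ 2 ^ l := pow_le_pow_right₀ one_le_two hil
      rw [pow_succ] at h3
      have : (0 : ℝ) < 2 ^ i := by positivity
      linarith
    have h0 : ∀ ξ, packet s φ (2 ^ j) ξ * packet s φ (2 ^ k) ξ = 0 := fun ξ => by
      rcases lt_or_gt_of_ne hjk with hl | hl
      · exact this j k hl ξ
      · rw [mul_comm]; exact this k j hl ξ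
    simp [h0]

theorem half_le_re_phase {z : ℝ × Rn n} {ξ : Rn n} (hR : 0 < R) (hξ : ‖ξ‖ ≤ 5 / 4 * R)
    (ht : |z.1| ≤ 1 / 4 * (R ^ 2)⁻¹) (hx : ‖z.2‖ ≤ 1 / 4 * R⁻¹) : 1 / 2 ≤ (phase z ξ).re := by
  have e : phase z ξ = Complex.exp (((⟪z.2, ξ⟫_ℝ - z.1 * ‖ξ‖ ^ 2 : ℝ) : ℂ) * Complex.I) := by
    rw [phase, dotC_eq_inner]; congr 1; push_cast; ring
  rw [e, Complex.exp_ofReal_mul_I_re]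
  refine le_trans ?_ (Real.one_sub_sq_div_two_le_cos)
  have h1 : |⟪z.2, ξ⟫_ℝ| ≤ 1 / 4 * R⁻¹ * (5 / 4 * R) :=
    (abs_real_inner_le_norm _ _).trans (mul_le_mul hx hξ (norm_nonneg _) (by positivity))
  have h2 : |z.1 * ‖ξ‖ ^ 2| ≤ 1 / 4 * (R ^ 2)⁻¹ * (5 / 4 * R) ^ 2 := by
    rw [abs_mul, abs_of_nonneg (sq_nonneg ‖ξ‖)]
    exact mul_le_mul ht (pow_le_pow_left₀ (norm_nonneg _) hξ 2) (by positivity) (by positivity)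
  have e1 : 1 / 4 * R⁻¹ * (5 / 4 * R) = 5 / 16 := by field_simp; norm_num
  have e2 : 1 / 4 * (R ^ 2)⁻¹ * (5 / 4 * R) ^ 2 = 25 / 64 := by field_simp; norm_num
  rw [e1] at h1
  rw [e2] at h2
  have h3 : |⟪z.2, ξ⟫_ℝ - z.1 * ‖ξ‖ ^ 2| ≤ 1 := (abs_sub _ _).trans (by linarith)
  have := (sq_le_one_iff_abs_le_one _).2 h3
  linarith

theorem IsProfile.le_norm_extend (h : IsProfile s φ) (hR : 0 < R) {z : ℝ × Rn n}
    (ht : |z.1| ≤ 1 / 4 * (R ^ 2)⁻¹) (hx : ‖z.2‖ ≤ 1 / 4 * R⁻¹) :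
    (2 * π) ^ (-(n : ℝ)) * (1 / 2 * ∫ ξ, φ ξ) * R ^ (n / 2 - s) ≤
      ‖extend (fun ξ => ((packet s φ R ξ : ℝ) : ℂ)) z‖ := by
  have hi : Integrable fun ξ => ((packet s φ R ξ : ℝ) : ℂ) := (h.integrable_packet hR).ofReal
  have hip := integrable_phase_mul hi z
  have h1 : 1 / 2 * ∫ ξ, packet s φ R ξ ≤ ‖∫ ξ, phase z ξ * ((packet s φ R ξ : ℝ) : ℂ)‖ := by
    refine le_trans ?_ (Complex.re_le_norm _)
    rw [← RCLike.re_eq_complex_re, ← integral_re hip, ← integral_const_mul]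
    refine integral_mono ((h.integrable_packet hR).const_mul _) hip.re fun ξ => ?_
    simp only [RCLike.re_eq_complex_re, Complex.re_mul_ofReal]
    by_cases h0 : packet s φ R ξ = 0
    · simp [h0]
    · exact mul_le_mul_of_nonneg_right
        (half_le_re_phase hR (h.norm_mem hR h0).2.le ht hx) (h.packet_nonneg hR ξ)
  rw [extend, norm_smul, Real.norm_of_nonneg (by positivity), mul_assoc]
  refine mul_le_mul_of_nonneg_left ?_ (by positivity)
  rw [integral_packet hR] at h1
  linarith

end packet

theorem IsProfile.le_eLpNorm_density {s p R c : ℝ} {φ : Rn n → ℝ} (hp : 0 < p)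
    (h : IsProfile s φ) (hc0 : 0 ≤ c)
    (hc : c = (2 * π) ^ (-(n : ℝ)) * (1 / 2 * ∫ ξ, φ ξ)) {f : ℕ → Rn n → ℂ}
    (hf : ∀ j, FT (f j) = fun ξ => ((packet s φ (2 ^ j) ξ : ℝ) : ℂ)) {N j : ℕ} (hj : j < N)
    (hR : R = 2 ^ j) {t : ℝ} (ht : |t| ≤ 1 / 4 * (R ^ 2)⁻¹) :
    ENNReal.ofReal (c ^ 2 * (volume (Metric.closedBall (0 : Rn n) (1 / 4))).toReal ^ (1 / p) *
        R ^ (n - 2 * s - n / p)) ≤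
      eLpNorm (density (fun j => if j < N then 1 else 0) f t) (ENNReal.ofReal p) volume := by
  have hR0 : 0 < R := by rw [hR]; positivity
  set B := Metric.closedBall (0 : Rn n) (1 / 4 * R⁻¹) with hB
  have hlow : ∀ x, ‖B.indicator (fun _ => (c * R ^ (n / 2 - s)) ^ 2) x‖ ≤
      ‖density (fun j => if j < N then 1 else 0) f t x‖ := fun x => by
    have hsum : density (fun j => if j < N then 1 else 0) f t x =
        ∑ i ∈ Finset.range N, ‖schrodinger (f i) t x‖ ^ 2 := by
      rw [density, density2, tsum_eq_sum (s := Finset.range N) fun i hi => by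
        rw [if_neg (by simpa using hi), zero_mul]]
      exact Finset.sum_congr rfl fun i hi => by rw [if_pos (Finset.mem_range.1 hi), one_mul]
    rw [hsum, Real.norm_of_nonneg (Finset.sum_nonneg fun i _ => sq_nonneg _)]
    by_cases hx : x ∈ B
    · rw [indicator_of_mem hx, Real.norm_of_nonneg (sq_nonneg _)]
      refine le_trans ?_ (Finset.single_le_sum (fun i _ => sq_nonneg ‖schrodinger (f i) t x‖)
        (Finset.mem_range.2 hj))
      refine pow_le_pow_left₀ (by positivity) ?_ 2
      rw [schrodinger_eq_extend, hf, ← hR, hc]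
      exact h.le_norm_extend hR0 ht (by simpa [hB] using hx)
    · rw [indicator_of_notMem hx, norm_zero]
      exact Finset.sum_nonneg fun i _ => sq_nonneg _
  refine le_trans (le_of_eq ?_) (eLpNorm_mono hlow)
  have hBm : MeasurableSet B := measurableSet_closedBall
  rw [eLpNorm_indicator_const hBm (by simpa using hp)
    ENNReal.ofReal_ne_top, ENNReal.toReal_ofReal hp.le, Real.enorm_of_nonneg (sq_nonneg _)]
  have hv : volume B = ENNReal.ofReal (R ^ (-(n : ℝ)) *
      (volume (Metric.closedBall (0 : Rn n) (1 / 4))).toReal) := by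
    rw [hB, mul_comm (1 / 4), Measure.addHaar_closedBall_mul _ _ (by positivity) (by norm_num),
      finrank_euclideanSpace_fin, ENNReal.ofReal_mul (by positivity),
      ENNReal.ofReal_toReal measure_closedBall_lt_top.ne, Real.rpow_neg hR0.le, Real.rpow_natCast,
      inv_pow]
  rw [hv, ENNReal.ofReal_rpow_of_nonneg (by positivity) (by positivity),
    ← ENNReal.ofReal_mul (sq_nonneg _), Real.mul_rpow (by positivity) ENNReal.toReal_nonneg,
    ← Real.rpow_mul hR0.le]
  congr 1
  have e : R ^ (n - 2 * s - n / p) = (R ^ (n / 2 - s)) ^ 2 * R ^ (-(n : ℝ) * (1 / p)) := by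
    rw [sq, ← Real.rpow_add hR0, ← Real.rpow_add hR0]; congr 1; ring
  rw [e]; ring

theorem IsProfile.exists_le_lintegral {s p q : ℝ} {φ : Rn n → ℝ} (hp : 0 < p) (hq : 0 < q)
    (hs : 2 * s = n - (2 / q + n / p)) (h : IsProfile s φ) {f : ℕ → Rn n → ℂ}
    (hf : ∀ j, FT (f j) = fun ξ => ((packet s φ (2 ^ j) ξ : ℝ) : ℂ)) :
    ∃ κ : ℝ, 0 < κ ∧ ∀ N : ℕ, ENNReal.ofReal (N * κ) ≤
      ∫⁻ t, eLpNorm (density (fun j => if j < N then 1 else 0) f t)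
        (ENNReal.ofReal p) volume ^ q := by
  obtain ⟨c, hc⟩ : ∃ c, c = (2 * π) ^ (-(n : ℝ)) * (1 / 2 * ∫ ξ, φ ξ) := ⟨_, rfl⟩
  have hc0 : 0 < c := by
    have := h.pos
    rw [hc]
    exact mul_pos (Real.rpow_pos_of_pos (by positivity) _) (by positivity)
  set V := (volume (Metric.closedBall (0 : Rn n) (1 / 4))).toReal with hV
  have hV0 : 0 < V := ENNReal.toReal_pos
    (Metric.measure_closedBall_pos volume _ (by norm_num)).ne' measure_closedBall_lt_top.ne
  set b := c ^ 2 * V ^ (1 / p) with hb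
  have hb0 : 0 < b := by positivity
  refine ⟨b ^ q * (3 / 16), by positivity, fun N => ?_⟩
  set F := fun t : ℝ => eLpNorm (density (fun j => if j < N then 1 else 0) f t)
    (ENNReal.ofReal p) volume ^ q with hF
  set I : ℕ → Set ℝ := fun j => Ioc (1 / 4 * (1 / 4 : ℝ) ^ (j + 1)) (1 / 4 * (1 / 4) ^ j) with hI
  have hdisj : Pairwise (Function.onFun Disjoint I) := by
    have ha : Antitone fun j : ℕ => 1 / 4 * (1 / 4 : ℝ) ^ j := fun i j hij =>
      mul_le_mul_of_nonneg_left (pow_le_pow_of_le_one (by norm_num) (by norm_num) hij) (by norm_num)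
    exact ha.pairwise_disjoint_on_Ioc_succ
  have hpiece : ∀ j < N, ENNReal.ofReal (b ^ q * (3 / 16)) ≤ ∫⁻ t in I j, F t := fun j hj => by
    have hR0 : (0 : ℝ) < 2 ^ j := by positivity
    have e4 : ((1 : ℝ) / 4) ^ j = ((2 ^ j) ^ 2)⁻¹ := by
      rw [← pow_mul, mul_comm, pow_mul, one_div, inv_pow]; norm_num
    calc ENNReal.ofReal (b ^ q * (3 / 16))
        = ∫⁻ _ in I j, ENNReal.ofReal (b * (2 ^ j) ^ (n - 2 * s - n / p)) ^ q := by
          rw [lintegral_const, Measure.restrict_apply_univ, hI, Real.volume_Ioc,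
            ENNReal.ofReal_rpow_of_nonneg (by positivity) hq.le,
            ← ENNReal.ofReal_mul (by positivity)]
          congr 1
          have e : n - 2 * s - n / p = 2 / q := by rw [hs]; ring
          rw [e, Real.mul_rpow hb0.le (by positivity), ← Real.rpow_mul hR0.le,
            div_mul_cancel₀ _ hq.ne', Real.rpow_two, pow_succ (1 / 4 : ℝ) j, e4]
          field_simp
          norm_num
      _ ≤ ∫⁻ t in I j, F t := by
          refine setLIntegral_mono' measurableSet_Ioc fun t ht => ENNReal.rpow_le_rpow ?_ hq.le
          refine h.le_eLpNorm_density hp hc0.le hc hf hj rfl ?_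
          rw [abs_of_pos (lt_trans (by positivity) ht.1), ← e4]
          exact ht.2
  calc ENNReal.ofReal (N * (b ^ q * (3 / 16)))
      = ∑ _j ∈ Finset.range N, ENNReal.ofReal (b ^ q * (3 / 16)) := by
        rw [Finset.sum_const, Finset.card_range, nsmul_eq_mul,
          ENNReal.ofReal_mul (Nat.cast_nonneg _),
          ENNReal.ofReal_natCast]
    _ ≤ ∑ j ∈ Finset.range N, ∫⁻ t in I j, F t :=
        Finset.sum_le_sum fun j hj => hpiece j (Finset.mem_range.1 hj)
    _ = ∫⁻ t in ⋃ j ∈ Finset.range N, I j, F t :=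
        (lintegral_biUnion_finset (fun i _ j _ hij => hdisj hij)
          (fun _ _ => measurableSet_Ioc) _).symm
    _ ≤ ∫⁻ t, F t := setLIntegral_le_lintegral _ _

theorem not_exists_mixedLp_density_le (hn : 1 ≤ n) {p q s α : ℝ} (hp : 0 < p) (hq : 0 < q)
    (hs0 : 0 ≤ s) (hs : 2 * s = n - (2 / q + n / p)) (hα : q < α) :
    ¬ ∃ C : ℝ, 0 < C ∧ ∀ (f : ℕ → Rn n → ℂ) (lam : ℕ → ℝ),
      OrthonormalHs s f → seqNormE (ENNReal.ofReal α) lam ≠ ∞ →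
      mixedLp (ENNReal.ofReal q) (ENNReal.ofReal p) (density lam f)
        ≤ ENNReal.ofReal C * seqNormE (ENNReal.ofReal α) lam := by
  rintro ⟨C, hC, H⟩
  have hα0 : 0 < α := hq.trans hα
  obtain ⟨φ, hφ⟩ := exists_isProfile hn hs0
  have hex : ∀ j : ℕ, ∃ f : Rn n → ℂ, FT f = fun ξ => ((packet s φ (2 ^ j) ξ : ℝ) : ℂ) := fun j =>
    exists_FT_eq (Complex.ofRealCLM.contDiff.comp (hφ.contDiff_packet _))
      ((hφ.hasCompactSupport_packet (by positivity)).comp_left Complex.ofReal_zero)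
  choose f hf using hex
  obtain ⟨κ, hκ, hle⟩ := hφ.exists_le_lintegral hp hq hs hf
  have hseq : ∀ N : ℕ, seqNormE (ENNReal.ofReal α) (fun j => if j < N then 1 else 0) =
      ENNReal.ofReal ((N : ℝ) ^ (1 / α)) := fun N => by
    rw [seqNormE, if_neg ENNReal.ofReal_ne_top, ENNReal.toReal_ofReal hα0.le,
      tsum_eq_sum (s := Finset.range N) fun j hj => by
        rw [if_neg (by simpa using hj), abs_zero, ENNReal.ofReal_zero,
          ENNReal.zero_rpow_of_pos hα0],
      Finset.sum_congr rfl fun j hj => by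
        rw [if_pos (Finset.mem_range.1 hj), abs_one, ENNReal.ofReal_one, ENNReal.one_rpow],
      Finset.sum_const, Finset.card_range, nsmul_one, ← ENNReal.ofReal_natCast,
      ENNReal.ofReal_rpow_of_nonneg (Nat.cast_nonneg _) (by positivity)]
  have hbound : ∀ N : ℕ, (N : ℝ) * κ ≤ C ^ q * (N : ℝ) ^ (q / α) := fun N => by
    have h1 := H f (fun j => if j < N then 1 else 0) (hφ.orthonormalHs hf)
      (by rw [hseq]; exact ENNReal.ofReal_ne_top)
    rw [hseq, ← ENNReal.ofReal_mul hC.le, mixedLp, eLp, if_neg ENNReal.ofReal_ne_top,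
      ENNReal.toReal_ofReal hq.le, one_div, ENNReal.rpow_inv_le_iff hq,
      ENNReal.ofReal_rpow_of_nonneg (by positivity) hq.le] at h1
    have h2 := (hle N).trans h1
    rwa [ENNReal.ofReal_le_ofReal_iff (by positivity), Real.mul_rpow hC.le (by positivity),
      ← Real.rpow_mul (Nat.cast_nonneg _), one_div_mul_eq_div] at h2
  have hlt : 0 < 1 - q / α := sub_pos.2 ((div_lt_one hα0).2 hα)
  have ht := (tendsto_rpow_atTop hlt).comp (tendsto_natCast_atTop_atTop (R := ℝ))
  obtain ⟨N, hN, hN1⟩ := ((ht.eventually_gt_atTop (C ^ q / κ)).and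
    (Filter.eventually_ge_atTop 1)).exists
  have hN0 : (0 : ℝ) < N := by exact_mod_cast hN1
  have h3 := hbound N
  have e : (N : ℝ) = (N : ℝ) ^ (1 - q / α) * (N : ℝ) ^ (q / α) := by
    rw [← Real.rpow_add hN0, sub_add_cancel, Real.rpow_one]
  have h4 : (C ^ q / κ) * (N : ℝ) ^ (q / α) * κ < N * κ := by
    refine mul_lt_mul_of_pos_right ?_ hκ
    conv_rhs => rw [e]
    exact mul_lt_mul_of_pos_right hN (by positivity)
  have e' : (C ^ q / κ) * (N : ℝ) ^ (q / α) * κ = C ^ q * (N : ℝ) ^ (q / α) := by field_simp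
  linarith

end OS

/-- (Bez–Hong–Lee–Nakamura–Sawano.)  Global orthonormal Strichartz
estimates in the interior of `OCDA` for every `α < q`, with data orthonormal in
`Ḣ^s(ℝⁿ)`, `2s = n - (2/q + n/p)`; moreover the estimate fails for every `α > q`. -/
theorem global_OCDA (n : ℕ) (hn : 2 ≤ n) (p q s : ℝ)
    (hpq : IntOCDA n (1 / p) (1 / q))
    (hs : 2 * s = n - (2 / q + n / p)) :
    (∀ α : ℝ, 1 ≤ α → α < q →
      ∃ C : ℝ, 0 < C ∧ ∀ (f : ℕ → Rn n → ℂ) (lam : ℕ → ℝ),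
        OrthonormalHs s f → seqNormE (ENNReal.ofReal α) lam ≠ ∞ →
        mixedLp (ENNReal.ofReal q) (ENNReal.ofReal p) (density lam f)
          ≤ ENNReal.ofReal C * seqNormE (ENNReal.ofReal α) lam) ∧
    ∀ α : ℝ, q < α →
      ¬ ∃ C : ℝ, 0 < C ∧ ∀ (f : ℕ → Rn n → ℂ) (lam : ℕ → ℝ),
        OrthonormalHs s f → seqNormE (ENNReal.ofReal α) lam ≠ ∞ →
        mixedLp (ENNReal.ofReal q) (ENNReal.ofReal p) (density lam f)
          ≤ ENNReal.ofReal C * seqNormE (ENNReal.ofReal α) lam := by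
  obtain ⟨hp, hq, -, hlt⟩ := id hpq
  have hp0 : 0 < p := one_div_pos.1 hp.1
  have hq0 : 0 < q := one_div_pos.1 hq.1
  have hs0 : 0 ≤ s := by
    have e : 2 / q + n / p = 2 * (1 / q) + n * (1 / p) := by ring
    linarith
  exact ⟨fun α hα hαq => exists_mixedLp_density_le hn hpq hs hα hαq,
    fun α hα => not_exists_mixedLp_density_le (by omega) hp0 hq0 hs0 hs hα⟩
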